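/- Fix b ∈ (0,1) and Λ > 0. For every L > 0 there exists ε₀ > 0, depending only on n, W, b, Λ, L, such that: if ε ≤ ε₀ and u_ε is a stable solution of the singularly perturbed Allen–Cahn equation in B₁(0) ⊂ ℝⁿ satisfying ∇u_ε ≠ 0 and |B(u_ε)| ≤ Λ on {|u_ε| ≤ 1−b} ∩ B₁(0), then for every x ∈ {u_ε = 0} ∩ B_{7/8}(0) one has dist(x, {u_ε = 0} ∖ Γ_x) ≥ L ε, where Γ_x denotes the connected component of {u_ε = 0} containing x. In other words, ε⁻¹ dist(x, {u_ε = 0} ∖ Γ_x) → +∞ as ε → 0, uniformly over such solutions and points. -/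

import Mathlib

open Set Metric MeasureTheory Filter
open scoped RealInnerProductSpace

noncomputable section

/-- Euclidean space `ℝⁿ`. -/
abbrev Euc (n : ℕ) : Type := EuclideanSpace ℝ (Fin n)

/-- Standard orthonormal basis vector of `ℝⁿ`. -/
def eb (n : ℕ) (i : Fin n) : Euc n := EuclideanSpace.basisFun (Fin n) ℝ i

/-- Laplacian, as the trace of the second derivative along the standard orthonormal basis. -/
def lap {n : ℕ} (f : Euc n → ℝ) (x : Euc n) : ℝ :=
  ∑ i : Fin n, iteratedFDeriv ℝ 2 f x ![eb n i, eb n i]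

/-- Divergence of a vector field. -/
def divg {n : ℕ} (F : Euc n → Euc n) (x : Euc n) : ℝ :=
  ∑ i : Fin n, ⟪fderiv ℝ F x (eb n i), eb n i⟫

/-- Squared Frobenius norm of the Hessian. -/
def hessSq {n : ℕ} (f : Euc n → ℝ) (x : Euc n) : ℝ :=
  ∑ i : Fin n, ∑ j : Fin n, (iteratedFDeriv ℝ 2 f x ![eb n i, eb n j]) ^ 2

open Classical in
/-- `|B(u)(x)|`, with value `0` where the gradient vanishes. -/
def Bnorm {n : ℕ} (u : Euc n → ℝ) (x : Euc n) : ℝ :=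
  if gradient u x = 0 then 0
  else Real.sqrt ((hessSq u x - ‖gradient (fun y => ‖gradient u y‖) x‖ ^ 2) /
    ‖gradient u x‖ ^ 2)

/-- Mean curvature of level sets: `div(∇u/|∇u|)`. -/
def meanCurv {n : ℕ} (u : Euc n → ℝ) (x : Euc n) : ℝ :=
  divg (fun y => ‖gradient u y‖⁻¹ • gradient u y) x

/-- Orthogonal projection onto the tangent space of the level set of `u` through `x`. -/
def tproj {n : ℕ} (u : Euc n → ℝ) (x X : Euc n) : Euc n :=
  X - (⟪gradient u x, X⟫ / ‖gradient u x‖ ^ 2) • gradient u x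

/-- Second fundamental form of the level set of `u` through `x`, extended to all of `ℝⁿ`
via the tangential projection. -/
def sff {n : ℕ} (u : Euc n → ℝ) (x X Y : Euc n) : ℝ :=
  iteratedFDeriv ℝ 2 u x ![tproj u x X, tproj u x Y] / ‖gradient u x‖

/-- `W` is a double-well potential. -/
def IsDoubleWell (W : ℝ → ℝ) : Prop :=
  ContDiffOn ℝ 3 W (Icc (-1) 1) ∧ (∀ t ∈ Ioo (-1:ℝ) 1, 0 < W t) ∧
  W (-1) = 0 ∧ W 1 = 0 ∧ deriv W (-1) = 0 ∧ deriv W 1 = 0 ∧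
  iteratedDeriv 2 W (-1) = 1 ∧ iteratedDeriv 2 W 1 = 1 ∧
  deriv W 0 = 0 ∧ ∀ t ∈ Ioo (-1:ℝ) 1, deriv W t = 0 → t = 0

/-- `u` is a classical solution of the singularly perturbed Allen–Cahn equation
`ε Δu = ε⁻¹ W′(u)`, `|u| < 1`, on `Ω`. -/
def ACSolution {n : ℕ} (W : ℝ → ℝ) (ε : ℝ) (u : Euc n → ℝ) (Ω : Set (Euc n)) : Prop :=
  ContDiffOn ℝ 2 u Ω ∧ (∀ x ∈ Ω, u x ∈ Ioo (-1:ℝ) 1) ∧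
  ∀ x ∈ Ω, ε * lap u x = ε⁻¹ * deriv W (u x)

/-- Stability: `∫_Ω ε²|∇η|² + W″(u)η² ≥ 0` for all smooth `η` compactly supported in `Ω`. -/
def StableAC {n : ℕ} (W : ℝ → ℝ) (ε : ℝ) (u : Euc n → ℝ) (Ω : Set (Euc n)) : Prop :=
  ∀ η : Euc n → ℝ, ContDiff ℝ (⊤ : ℕ∞) η → HasCompactSupport η → tsupport η ⊆ Ω →
    0 ≤ ∫ x in Ω, (ε ^ 2 * ‖gradient η x‖ ^ 2 + iteratedDeriv 2 W (u x) * (η x) ^ 2)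

/-- `∇u ≠ 0` and `|B(u)| ≤ Λ` on `{|u| ≤ 1−b} ∩ Ω`. -/
def CurvBound {n : ℕ} (u : Euc n → ℝ) (b Λ : ℝ) (Ω : Set (Euc n)) : Prop :=
  ∀ x ∈ Ω, |u x| ≤ 1 - b → gradient u x ≠ 0 ∧ Bnorm u x ≤ Λ

/-- The part of the zero set `{u = 0}` away from the connected component of `x`. -/
def compSet {n : ℕ} (u : Euc n → ℝ) (x : Euc n) : Set (Euc n) :=
  {y | u y = 0} \ connectedComponentIn {y | u y = 0} x

/-- `A(r) = sup { e^{−D(x)} : x ∈ {u = 0} ∩ closure(B_r(0)) }`, where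
`D(x) = dist(x, {u=0} ∖ Γ_x)` and points with `{u=0} ∖ Γ_x = ∅` contribute `0`. -/
def Afun {n : ℕ} (u : Euc n → ℝ) (r : ℝ) : ℝ :=
  sSup {t : ℝ | ∃ x : Euc n, u x = 0 ∧ x ∈ closedBall 0 r ∧ (compSet u x).Nonempty ∧
    t = Real.exp (-Metric.infDist x (compSet u x))}

/-- The rescaled stable Allen–Cahn setting: `Δu = W′(u)` on `B_{1/ε}(0)`, stable, with
`∇u ≠ 0` and `|B(u)| ≤ Λε` on `{|u| ≤ 1−b}`. -/
def RescaledSetting {n : ℕ} (W : ℝ → ℝ) (b Λ ε : ℝ) (u : Euc n → ℝ) : Prop :=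
  ACSolution W 1 u (ball 0 (1/ε)) ∧ StableAC W 1 u (ball 0 (1/ε)) ∧
  CurvBound u b (Λ * ε) (ball 0 (1/ε))

open Topology in
/-- Mollification of a compactly supported `C¹` function. -/
theorem exists_smooth_approx {n : ℕ} {η : Euc n → ℝ} {U : Set (Euc n)} (h1 : ContDiff ℝ 1 η)
    (hc : HasCompactSupport η) (hU : IsOpen U) (hηU : tsupport η ⊆ U) :
    ∃ (K : Set (Euc n)) (ηk : ℕ → Euc n → ℝ) (M : ℝ), IsCompact K ∧ K ⊆ U ∧
      (∀ k, ContDiff ℝ (⊤ : ℕ∞) (ηk k)) ∧ (∀ k, tsupport (ηk k) ⊆ K) ∧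
      (∀ k z, |ηk k z| ≤ M ∧ ‖fderiv ℝ (ηk k) z‖ ≤ M) ∧
      ∀ z, Tendsto (fun k => ηk k z) atTop (𝓝 (η z)) ∧
        Tendsto (fun k => fderiv ℝ (ηk k) z) atTop (𝓝 (fderiv ℝ η z)) := by
  have hcK : IsCompact (tsupport η) := hc
  obtain ⟨δ, hδ, hδU⟩ := hcK.exists_cthickening_subset_open hU hηU
  have hd0 : ∀ k : ℕ, 0 < δ / (k + 1) := fun k => by positivity
  let φ : ℕ → ContDiffBump (0 : Euc n) := fun k =>
    ⟨δ / (k + 1) / 2, δ / (k + 1), by have := hd0 k; positivity, by have := hd0 k; linarith⟩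
  have hrout : ∀ k, (φ k).rOut = δ / (k + 1) := fun k => rfl
  have hroutle : ∀ k, (φ k).rOut ≤ δ := fun k => by
    rw [hrout]; apply div_le_self hδ.le; linarith [Nat.cast_nonneg (α := ℝ) k]
  have hφ : Tendsto (fun k => (φ k).rOut) atTop (𝓝 0) := by
    simp only [hrout]
    exact tendsto_const_div_atTop_nhds_zero_nat δ |>.comp (tendsto_add_atTop_nat 1) |>.congr
      (by intro k; simp)
  have hηc : Continuous η := h1.continuous
  have hDc : Continuous (fderiv ℝ η) := h1.continuous_fderiv one_ne_zero
  obtain ⟨M1, hM1⟩ := hηc.bounded_above_of_compact_support hc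
  obtain ⟨M2, hM2⟩ := hDc.bounded_above_of_compact_support (hc.fderiv ℝ)
  have hli : LocallyIntegrable η (volume : Measure (Euc n)) := hηc.locallyIntegrable
  let ηk : ℕ → Euc n → ℝ := fun k =>
    convolution ((φ k).normed volume) η (ContinuousLinearMap.lsmul ℝ ℝ) volume
  have hpre : (ContinuousLinearMap.precompR (Euc n) (ContinuousLinearMap.lsmul ℝ ℝ : ℝ →L[ℝ] ℝ →L[ℝ] ℝ))
      = (ContinuousLinearMap.lsmul ℝ ℝ : ℝ →L[ℝ] (Euc n →L[ℝ] ℝ) →L[ℝ] (Euc n →L[ℝ] ℝ)) := by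
    ext a T
    simp
  have hfd : ∀ k z, fderiv ℝ (ηk k) z =
      convolution ((φ k).normed volume) (fderiv ℝ η) (ContinuousLinearMap.lsmul ℝ ℝ) volume z := by
    intro k z
    rw [← hpre]
    exact (hc.hasFDerivAt_convolution_right (ContinuousLinearMap.lsmul ℝ ℝ)
      ((φ k).continuous_normed.locallyIntegrable) h1 z).fderiv
  refine ⟨cthickening δ (tsupport η), ηk, 3 * |M1| + 3 * |M2|, hcK.cthickening, hδU, ?_, ?_, ?_, ?_⟩
  · intro k
    exact (φ k).hasCompactSupport_normed.contDiff_convolution_left _ (φ k).contDiff_normed hli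
  · intro k
    refine closure_minimal ?_ isClosed_cthickening
    refine (support_convolution_subset _).trans ?_
    rintro z ⟨a, ha, c, hcη, rfl⟩
    rw [ContDiffBump.support_normed_eq] at ha
    refine mem_cthickening_of_dist_le _ c δ _ (subset_tsupport _ hcη) ?_
    rw [mem_ball_zero_iff] at ha
    simpa [dist_eq_norm] using ha.le.trans (hroutle k)
  · intro k z
    constructor
    · have := (φ k).dist_normed_convolution_le (μ := (volume : Measure (Euc n))) (x₀ := z) (ε := 2 * |M1|)
        hηc.aestronglyMeasurable (fun x _ => by
          rw [dist_eq_norm]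
          have := norm_sub_le (η x) (η z)
          linarith [hM1 x, hM1 z, le_abs_self M1])
      rw [dist_eq_norm] at this
      have h2 := norm_sub_norm_le (ηk k z) (η z)
      rw [← Real.norm_eq_abs]
      have h3 : ‖ηk k z - η z‖ ≤ 2 * |M1| := this
      linarith [hM1 z, le_abs_self M1, abs_nonneg M2]
    · rw [hfd]
      have := (φ k).dist_normed_convolution_le (μ := (volume : Measure (Euc n))) (x₀ := z) (ε := 2 * |M2|)
        hDc.aestronglyMeasurable (fun x _ => by
          rw [dist_eq_norm]
          have := norm_sub_le (fderiv ℝ η x) (fderiv ℝ η z)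
          linarith [hM2 x, hM2 z, le_abs_self M2])
      rw [dist_eq_norm] at this
      have h2 := norm_sub_norm_le (convolution ((φ k).normed volume) (fderiv ℝ η)
        (ContinuousLinearMap.lsmul ℝ ℝ) volume z) (fderiv ℝ η z)
      linarith [hM2 z, le_abs_self M2, abs_nonneg M1]
  · intro z
    constructor
    · exact ContDiffBump.convolution_tendsto_right_of_continuous hφ hηc z
    · simp only [hfd]
      exact ContDiffBump.convolution_tendsto_right_of_continuous hφ hDc z

/-- The integral of a directional derivative of a compactly supported `C¹` function vanishes. -/
theorem integral_fderiv_apply_eq_zero {n : ℕ} {H : Euc n → ℝ} (hH : ContDiff ℝ 1 H)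
    (hc : HasCompactSupport H) (v : Euc n) : ∫ z, fderiv ℝ H z v = 0 := by
  have hD : Continuous fun z => fderiv ℝ H z v :=
    (hH.continuous_fderiv one_ne_zero).clm_apply continuous_const
  have hDi : Integrable fun z => fderiv ℝ H z v :=
    hD.integrable_of_hasCompactSupport (hc.fderiv_apply ℝ v)
  have hHi : Integrable H := hH.continuous.integrable_of_hasCompactSupport hc
  have := integral_mul_fderiv_eq_neg_fderiv_mul_of_integrable (μ := (volume : Measure (Euc n)))
    (f := fun _ : Euc n => (1 : ℝ)) (g := H) (v := v) (by simp) (by simpa using hDi)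
    (by simpa using hHi) (fun x _ => by fun_prop)
    (fun x _ => (hH.differentiable one_ne_zero).differentiableAt)
  simpa using this

theorem contDiff_of_tsupport_subset {E F : Type*} [NormedAddCommGroup E] [NormedSpace ℝ E]
    [NormedAddCommGroup F] [NormedSpace ℝ F] {m : WithTop ℕ∞} {f : E → F} {U : Set E}
    (hU : IsOpen U) (hf : ContDiffOn ℝ m f U) (hs : tsupport f ⊆ U) : ContDiff ℝ m f := by
  rw [contDiff_iff_contDiffAt]
  intro z
  by_cases hz : z ∈ tsupport f
  · exact hf.contDiffAt (hU.mem_nhds (hs hz))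
  · exact contDiffAt_const.congr_of_eventuallyEq (notMem_tsupport_iff_eventuallyEq.1 hz)

/-- A `C¹` nonlinearity `f` on `(-1, 1)` with derivative `f'` bounded by `K` and `f 0 = 0`. -/
structure Nonlinearity (f f' : ℝ → ℝ) (K : ℝ) : Prop where
  deriv : ∀ t ∈ Ioo (-1:ℝ) 1, HasDerivAt f (f' t) t
  cont : ContinuousOn f' (Ioo (-1:ℝ) 1)
  bound : ∀ t ∈ Ioo (-1:ℝ) 1, |f' t| ≤ K
  growth : ∀ t ∈ Ioo (-1:ℝ) 1, |f t| ≤ K * |t|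

/-- A stable solution `u` of `Δu = f(u)` in `B_R(0)` with gradient `g` and Hessian `S`, such that on
`{|u| ≤ 1 - b}` the gradient does not vanish and the Hessian is `κ`-close to that of a function
of one variable. -/
structure LayerSol {n : ℕ} (f f' : ℝ → ℝ) (b κ R : ℝ) (u : Euc n → ℝ) (g : Euc n → Euc n)
    (S : Euc n → Euc n →L[ℝ] Euc n) : Prop where
  grad : ∀ z ∈ ball (0 : Euc n) R, HasGradientAt u (g z) z
  hess : ∀ z ∈ ball (0 : Euc n) R, HasFDerivAt g (S z) z
  cont : ContinuousOn S (ball 0 R)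
  range : ∀ z ∈ ball (0 : Euc n) R, u z ∈ Ioo (-1:ℝ) 1
  symm : ∀ z ∈ ball (0 : Euc n) R, ∀ X Y, ⟪S z X, Y⟫ = ⟪X, S z Y⟫
  pde : ∀ z ∈ ball (0 : Euc n) R, ∑ i, ⟪S z (eb n i), eb n i⟫ = f (u z)
  pos : ∀ z ∈ ball (0 : Euc n) R, |u z| ≤ 1 - b → g z ≠ 0
  curv : ∀ z ∈ ball (0 : Euc n) R, |u z| ≤ 1 - b → ∀ X,
    ‖S z X - (f (u z) * ⟪g z, X⟫ / ‖g z‖ ^ 2) • g z‖ ≤ κ * ‖g z‖ * ‖X‖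
  stable : ∀ η : Euc n → ℝ, ContDiff ℝ (⊤ : ℕ∞) η → HasCompactSupport η →
    tsupport η ⊆ ball 0 R → 0 ≤ ∫ z, (‖gradient η z‖ ^ 2 + f' (u z) * (η z) ^ 2)

theorem contDiffOn_one_of_hasFDerivAt {E F : Type*} [NormedAddCommGroup E] [NormedSpace ℝ E]
    [NormedAddCommGroup F] [NormedSpace ℝ F] {f : E → F} {f' : E → E →L[ℝ] F} {U : Set E}
    (hU : IsOpen U) (h : ∀ z ∈ U, HasFDerivAt f (f' z) z) (hc : ContinuousOn f' U) :
    ContDiffOn ℝ 1 f U := by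
  intro z hz
  exact (contDiffAt_one_iff.2 ⟨f', U, hU.mem_nhds hz, hc, h⟩).contDiffWithinAt

theorem integrable_of_tsupport_subset {n : ℕ} {F : Euc n → ℝ} {U : Set (Euc n)} (hU : IsOpen U)
    (hF : ContinuousOn F U) (hs : tsupport F ⊆ U) (hc : HasCompactSupport F) : Integrable F :=
  (hF.continuous_of_tsupport_subset hU hs).integrable_of_hasCompactSupport hc

theorem gradient_eq_toDual_symm {n : ℕ} (η : Euc n → ℝ) (z : Euc n) :
    gradient η z = (InnerProductSpace.toDual ℝ (Euc n)).symm (fderiv ℝ η z) := rfl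

theorem norm_gradient {n : ℕ} (η : Euc n → ℝ) (z : Euc n) :
    ‖gradient η z‖ = ‖fderiv ℝ η z‖ := by
  rw [gradient_eq_toDual_symm, LinearIsometryEquiv.norm_map]

theorem ContDiff.continuous_gradient {n : ℕ} {η : Euc n → ℝ} (h : ContDiff ℝ 1 η) :
    Continuous (gradient η) :=
  (InnerProductSpace.toDual ℝ (Euc n)).symm.continuous.comp (h.continuous_fderiv one_ne_zero)

theorem gradient_eq_zero_of_notMem_tsupport {n : ℕ} {η : Euc n → ℝ} {z : Euc n}
    (h : z ∉ tsupport η) : gradient η z = 0 := by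
  have : fderiv ℝ η z = 0 := by
    by_contra h0
    exact h (support_fderiv_subset ℝ h0)
  rw [gradient_eq_toDual_symm, this, map_zero]

namespace LayerSol

variable {n : ℕ} {f f' : ℝ → ℝ} {K b κ R : ℝ} {u : Euc n → ℝ} {g : Euc n → Euc n}
  {S : Euc n → Euc n →L[ℝ] Euc n}

theorem contDiffOn_grad (h : LayerSol f f' b κ R u g S) : ContDiffOn ℝ 1 g (ball 0 R) :=
  contDiffOn_one_of_hasFDerivAt isOpen_ball h.hess h.cont

theorem contDiffOn (h : LayerSol f f' b κ R u g S) : ContDiffOn ℝ 1 u (ball 0 R) :=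
  contDiffOn_one_of_hasFDerivAt (f' := fun z => InnerProductSpace.toDual ℝ (Euc n) (g z))
    isOpen_ball (fun z hz => (h.grad z hz).hasFDerivAt)
    ((InnerProductSpace.toDual ℝ (Euc n)).continuous.comp_continuousOn
      h.contDiffOn_grad.continuousOn)

theorem continuousOn_potential (h : LayerSol f f' b κ R u g S) (hf : Nonlinearity f f' K) :
    ContinuousOn (fun z => f' (u z)) (ball 0 R) :=
  hf.cont.comp h.contDiffOn.continuousOn h.range

/-- The linearized equation for `∂ₑu`, tested against smooth functions. -/
theorem linearized_smooth (h : LayerSol f f' b κ R u g S) (hf : Nonlinearity f f' K)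
    {η : Euc n → ℝ} (hη : ContDiff ℝ (⊤ : ℕ∞) η) (hc : HasCompactSupport η)
    (hs : tsupport η ⊆ ball 0 R) (e : Euc n) :
    ∫ z, (⟪S z e, gradient η z⟫ + f' (u z) * ⟪g z, e⟫ * η z) = 0 := by
  have hη1 : ContDiff ℝ 1 η := hη.of_le (by exact_mod_cast le_top)
  have hη2 : ContDiff ℝ 2 η := contDiff_infty.1 hη 2
  have hD1 : ContDiff ℝ 1 (fderiv ℝ η) := hη2.fderiv_right (by norm_num)
  have key : ∀ (A : Euc n → ℝ) (B : Euc n → ℝ), ContDiffOn ℝ 1 A (ball 0 R) →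
      ContDiff ℝ 1 B → tsupport B ⊆ tsupport η → ∀ v : Euc n,
      Integrable (fun z => fderiv ℝ (fun z => A z * B z) z v) ∧
      ∫ z, fderiv ℝ (fun z => A z * B z) z v = 0 := by
    intro A B hA hB hBs v
    have hsub : tsupport (fun z => A z * B z) ⊆ tsupport B :=
      closure_mono (fun z hz => right_ne_zero_of_mul hz)
    have hAB : ContDiff ℝ 1 (fun z => A z * B z) :=
      contDiff_of_tsupport_subset isOpen_ball (hA.mul hB.contDiffOn)
        (hsub.trans (hBs.trans hs))
    have hcs : HasCompactSupport (fun z => A z * B z) :=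
      hc.of_isClosed_subset (isClosed_tsupport _) (hsub.trans hBs)
    exact ⟨((hAB.continuous_fderiv one_ne_zero).clm_apply continuous_const
      ).integrable_of_hasCompactSupport (hcs.fderiv_apply ℝ v),
      integral_fderiv_apply_eq_zero hAB hcs v⟩
  have hDv : ∀ v, ContDiff ℝ 1 (fun z => fderiv ℝ η z v) := fun v => hD1.clm_apply contDiff_const
  have hDs : ∀ v, tsupport (fun z => fderiv ℝ η z v) ⊆ tsupport η := fun v =>
    tsupport_fderiv_apply_subset ℝ v
  have hg1 : ∀ v, ContDiffOn ℝ 1 (fun z => ⟪g z, v⟫) (ball 0 R) := fun v =>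
    h.contDiffOn_grad.inner ℝ contDiffOn_const
  have hfu : ContDiffOn ℝ 1 (fun z => f (u z)) (ball 0 R) := by
    have : ContDiffOn ℝ 1 f (Ioo (-1) 1) :=
      contDiffOn_one_of_hasFDerivAt (f' := fun t => ContinuousLinearMap.toSpanSingleton ℝ (f' t))
        isOpen_Ioo (fun t ht => (hf.deriv t ht).hasFDerivAt)
        ((ContinuousLinearMap.toSpanSingletonCLE (𝕜 := ℝ) (E := ℝ)).continuous.comp_continuousOn hf.cont)
    exact this.comp h.contDiffOn h.range
  have k1 := fun i => key _ _ (hg1 (eb n i)) (hDv e) (hDs e) (eb n i)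
  have k2 := fun i => key _ _ (hg1 (eb n i)) (hDv (eb n i)) (hDs (eb n i)) e
  have k3 := key _ _ hfu hη1 subset_rfl e
  have hpt : ∀ z, ⟪S z e, gradient η z⟫ + f' (u z) * ⟪g z, e⟫ * η z =
      fderiv ℝ (fun z => f (u z) * η z) z e
      - ∑ i, fderiv ℝ (fun z => ⟪g z, eb n i⟫ * fderiv ℝ η z e) z (eb n i)
      + ∑ i, fderiv ℝ (fun z => ⟪g z, eb n i⟫ * fderiv ℝ η z (eb n i)) z e := by
    intro z
    by_cases hz : z ∈ tsupport η
    · have hzR := hs hz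
      have dη : HasFDerivAt η (fderiv ℝ η z) z :=
        (hη1.differentiable one_ne_zero).differentiableAt.hasFDerivAt
      have dD : HasFDerivAt (fderiv ℝ η) (fderiv ℝ (fderiv ℝ η) z) z :=
        (hD1.differentiable one_ne_zero).differentiableAt.hasFDerivAt
      have dDv : ∀ v, HasFDerivAt (fun z => fderiv ℝ η z v)
          ((fderiv ℝ (fderiv ℝ η) z).flip v) z := fun v => by
        simpa using dD.clm_apply (hasFDerivAt_const v z)
      have dg : ∀ v, HasFDerivAt (fun z => ⟪g z, v⟫) ((innerSL ℝ v).comp (S z)) z := fun v => by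
        have := (innerSL ℝ v).hasFDerivAt.comp z (h.hess z hzR)
        refine this.congr_of_eventuallyEq (Eventually.of_forall fun y => ?_)
        simp [real_inner_comm]
      have dfu : HasFDerivAt (fun z => f (u z))
          (f' (u z) • InnerProductSpace.toDual ℝ (Euc n) (g z)) z :=
        (hf.deriv _ (h.range z hzR)).comp_hasFDerivAt z (h.grad z hzR).hasFDerivAt
      have e3 := (dfu.fun_mul dη).fderiv
      have e1 := fun i => ((dg (eb n i)).fun_mul (dDv e)).fderiv
      have e2 := fun i => ((dg (eb n i)).fun_mul (dDv (eb n i))).fderiv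
      have hsym : ∀ v w, fderiv ℝ (fderiv ℝ η) z v w = fderiv ℝ (fderiv ℝ η) z w v := by
        have : IsSymmSndFDerivAt ℝ η z := hη2.contDiffAt.isSymmSndFDerivAt (by simp)
        exact fun v w => this v w
      simp only [e1, e2, e3]
      simp only [add_apply, smul_apply,
        ContinuousLinearMap.comp_apply, innerSL_apply_apply, ContinuousLinearMap.flip_apply,
        smul_eq_mul, InnerProductSpace.toDual_apply_apply, Finset.sum_add_distrib]
      have hp := h.pde z hzR
      have hS : ∑ i, fderiv ℝ η z (eb n i) * ⟪eb n i, S z e⟫ = fderiv ℝ η z (S z e) := by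
        conv_rhs => rw [← (EuclideanSpace.basisFun (Fin n) ℝ).sum_repr' (S z e), map_sum]
        refine Finset.sum_congr rfl fun i _ => ?_
        rw [map_smul, smul_eq_mul, mul_comm]; rfl
      have hS2 : ∑ i, fderiv ℝ η z e * ⟪eb n i, S z (eb n i)⟫ = fderiv ℝ η z e * f (u z) := by
        rw [← Finset.mul_sum, ← hp]
        congr 1
        exact Finset.sum_congr rfl fun i _ => real_inner_comm _ _
      have hgr : ⟪S z e, gradient η z⟫ = fderiv ℝ η z (S z e) := by
        rw [real_inner_comm, inner_gradient_left]
      rw [hS, hS2, hgr]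
      have : ∑ i, ⟪g z, eb n i⟫ * fderiv ℝ (fderiv ℝ η) z (eb n i) e
          = ∑ i, ⟪g z, eb n i⟫ * fderiv ℝ (fderiv ℝ η) z e (eb n i) :=
        Finset.sum_congr rfl fun i _ => by rw [hsym]
      rw [this]
      ring
    · have hz0 : ∀ (A B : Euc n → ℝ), tsupport B ⊆ tsupport η →
          fderiv ℝ (fun z => A z * B z) z = 0 := by
        intro A B hB
        by_contra h0
        exact hz (hB ((closure_mono (fun z hz => right_ne_zero_of_mul hz))
          (support_fderiv_subset ℝ h0 : z ∈ tsupport (fun z => A z * B z))))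
      rw [hz0 _ _ subset_rfl, gradient_eq_zero_of_notMem_tsupport hz, image_eq_zero_of_notMem_tsupport hz]
      simp [hz0 _ _ (hDs _)]
  simp_rw [hpt]
  rw [integral_add, integral_sub, integral_finsetSum, integral_finsetSum]
  · simp [k1, k2, k3]
  · exact fun i _ => (k2 i).1
  · exact fun i _ => (k1 i).1
  · exact k3.1
  · exact integrable_finsetSum _ fun i _ => (k1 i).1
  · exact k3.1.sub (integrable_finsetSum _ fun i _ => (k1 i).1)
  · exact integrable_finsetSum _ fun i _ => (k2 i).1

/-- The linearized equation for `∂ₑu`, tested against `C¹` functions. -/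
theorem linearized (h : LayerSol f f' b κ R u g S) (hf : Nonlinearity f f' K)
    {η : Euc n → ℝ} (hη : ContDiff ℝ 1 η) (hc : HasCompactSupport η)
    (hs : tsupport η ⊆ ball 0 R) (e : Euc n) :
    ∫ z, (⟪S z e, gradient η z⟫ + f' (u z) * ⟪g z, e⟫ * η z) = 0 := by
  obtain ⟨T, ηk, M, hT, hTU, hsm, hsup, hbd, hlim⟩ := exists_smooth_approx hη hc isOpen_ball hs
  have hcA : ContinuousOn (fun z => ‖S z e‖ + |f' (u z) * ⟪g z, e⟫|) T := by
    refine ((h.cont.clm_apply continuousOn_const).norm.add (((h.continuousOn_potential hf).mul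
      (h.contDiffOn_grad.continuousOn.inner continuousOn_const)).abs)).mono hTU
  obtain ⟨A, hA⟩ := hT.exists_bound_of_continuousOn hcA
  have hcsk : ∀ k, HasCompactSupport (ηk k) := fun k =>
    hT.of_isClosed_subset (isClosed_tsupport _) (hsup k)
  have hk : ∀ k, ∫ z, (⟪S z e, gradient (ηk k) z⟫ + f' (u z) * ⟪g z, e⟫ * ηk k z) = 0 := fun k =>
    h.linearized_smooth hf (hsm k) (hcsk k) ((hsup k).trans hTU) e
  refine tendsto_nhds_unique (tendsto_integral_of_dominated_convergence
    (F := fun k z => ⟪S z e, gradient (ηk k) z⟫ + f' (u z) * ⟪g z, e⟫ * ηk k z)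
    (T.indicator fun _ => A * M) ?_ ?_ ?_ ?_) (by simp only [hk]; exact tendsto_const_nhds)
  · intro k
    have hk1 : ContDiff ℝ 1 (ηk k) := (hsm k).of_le (by exact_mod_cast le_top)
    refine (integrable_of_tsupport_subset isOpen_ball (U := ball 0 R) ?_ ?_ ?_).aestronglyMeasurable
    · exact ((h.cont.clm_apply continuousOn_const).inner hk1.continuous_gradient.continuousOn).add
        (((h.continuousOn_potential hf).mul
          (h.contDiffOn_grad.continuousOn.inner continuousOn_const)).mul hk1.continuous.continuousOn)
    · refine (closure_minimal (fun z hz => ?_) hT.isClosed).trans hTU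
      by_contra hzT
      have hz' : z ∉ tsupport (ηk k) := fun h' => hzT (hsup k h')
      refine hz ?_
      beta_reduce
      rw [gradient_eq_zero_of_notMem_tsupport hz', image_eq_zero_of_notMem_tsupport hz']
      simp
    · refine HasCompactSupport.intro hT fun z hzT => ?_
      have hz' : z ∉ tsupport (ηk k) := fun h' => hzT (hsup k h')
      rw [gradient_eq_zero_of_notMem_tsupport hz', image_eq_zero_of_notMem_tsupport hz']
      simp
  · exact (integrable_indicator_iff hT.measurableSet).2 (integrableOn_const hT.measure_lt_top.ne)
  · refine fun k => Eventually.of_forall fun z => ?_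
    by_cases hzT : z ∈ T
    · rw [indicator_of_mem hzT]
      have h1 := hA z hzT
      rw [Real.norm_of_nonneg (by positivity)] at h1
      obtain ⟨h2, h3⟩ := hbd k z
      rw [← norm_gradient] at h3
      have hM : 0 ≤ M := (abs_nonneg _).trans h2
      calc _ ≤ ‖S z e‖ * M + |f' (u z) * ⟪g z, e⟫| * M := by
            refine (norm_add_le _ _).trans (add_le_add ((norm_inner_le_norm _ _).trans
              (mul_le_mul_of_nonneg_left h3 (norm_nonneg _))) ?_)
            rw [Real.norm_eq_abs, abs_mul]
            exact mul_le_mul_of_nonneg_left h2 (abs_nonneg _)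
        _ ≤ A * M := by rw [← add_mul]; exact mul_le_mul_of_nonneg_right h1 hM
    · rw [indicator_of_notMem hzT]
      have hz' : z ∉ tsupport (ηk k) := fun h' => hzT (hsup k h')
      rw [gradient_eq_zero_of_notMem_tsupport hz', image_eq_zero_of_notMem_tsupport hz']
      simp
  · refine Eventually.of_forall fun z => ?_
    obtain ⟨h1, h2⟩ := hlim z
    have h3 := ((InnerProductSpace.toDual ℝ (Euc n)).symm.continuous.tendsto _).comp h2
    exact (tendsto_const_nhds.inner h3).add (h1.const_mul _)

/-- Stability tested against `C¹` functions. -/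
theorem stable_one (h : LayerSol f f' b κ R u g S) (hf : Nonlinearity f f' K)
    {η : Euc n → ℝ} (hη : ContDiff ℝ 1 η) (hc : HasCompactSupport η)
    (hs : tsupport η ⊆ ball 0 R) :
    0 ≤ ∫ z, (‖gradient η z‖ ^ 2 + f' (u z) * (η z) ^ 2) := by
  obtain ⟨T, ηk, M, hT, hTU, hsm, hsup, hbd, hlim⟩ := exists_smooth_approx hη hc isOpen_ball hs
  obtain ⟨A, hA⟩ := hT.exists_bound_of_continuousOn ((h.continuousOn_potential hf).mono hTU)
  have hcsk : ∀ k, HasCompactSupport (ηk k) := fun k =>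
    hT.of_isClosed_subset (isClosed_tsupport _) (hsup k)
  have hk : ∀ k, 0 ≤ ∫ z, (‖gradient (ηk k) z‖ ^ 2 + f' (u z) * (ηk k z) ^ 2) := fun k =>
    h.stable (ηk k) (hsm k) (hcsk k) ((hsup k).trans hTU)
  refine ge_of_tendsto (tendsto_integral_of_dominated_convergence
    (F := fun k z => ‖gradient (ηk k) z‖ ^ 2 + f' (u z) * (ηk k z) ^ 2)
    (T.indicator fun _ => M ^ 2 + A * M ^ 2) ?_ ?_ ?_ ?_) (Eventually.of_forall hk)
  · intro k
    have hk1 : ContDiff ℝ 1 (ηk k) := (hsm k).of_le (by exact_mod_cast le_top)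
    refine (integrable_of_tsupport_subset isOpen_ball (U := ball 0 R) ?_ ?_ ?_).aestronglyMeasurable
    · exact (hk1.continuous_gradient.norm.pow 2).continuousOn.add
        ((h.continuousOn_potential hf).mul (hk1.continuous.pow 2).continuousOn)
    · refine (closure_minimal (fun z hz => ?_) hT.isClosed).trans hTU
      by_contra hzT
      have hz' : z ∉ tsupport (ηk k) := fun h' => hzT (hsup k h')
      refine hz ?_
      beta_reduce
      rw [gradient_eq_zero_of_notMem_tsupport hz', image_eq_zero_of_notMem_tsupport hz']
      simp
    · refine HasCompactSupport.intro hT fun z hzT => ?_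
      have hz' : z ∉ tsupport (ηk k) := fun h' => hzT (hsup k h')
      rw [gradient_eq_zero_of_notMem_tsupport hz', image_eq_zero_of_notMem_tsupport hz']
      simp
  · exact (integrable_indicator_iff hT.measurableSet).2 (integrableOn_const hT.measure_lt_top.ne)
  · refine fun k => Eventually.of_forall fun z => ?_
    by_cases hzT : z ∈ T
    · rw [indicator_of_mem hzT]
      have h1 := hA z hzT
      obtain ⟨h2, h3⟩ := hbd k z
      rw [← norm_gradient] at h3
      rw [Real.norm_eq_abs] at h1 ⊢
      have h4 : (ηk k z) ^ 2 ≤ M ^ 2 := sq_le_sq' (abs_le.1 h2).1 (abs_le.1 h2).2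
      refine (abs_add_le _ _).trans (add_le_add ?_ ?_)
      · rw [abs_of_nonneg (by positivity)]
        exact pow_le_pow_left₀ (norm_nonneg _) h3 2
      · rw [abs_mul, abs_of_nonneg (sq_nonneg (ηk k z))]
        exact mul_le_mul h1 h4 (sq_nonneg _) ((abs_nonneg _).trans h1)
    · rw [indicator_of_notMem hzT]
      have hz' : z ∉ tsupport (ηk k) := fun h' => hzT (hsup k h')
      rw [gradient_eq_zero_of_notMem_tsupport hz', image_eq_zero_of_notMem_tsupport hz']
      simp
  · refine Eventually.of_forall fun z => ?_
    obtain ⟨h1, h2⟩ := hlim z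
    have h3 := ((InnerProductSpace.toDual ℝ (Euc n)).symm.continuous.tendsto _).comp h2
    exact (h3.norm.pow 2).add ((h1.pow 2).const_mul _)

end LayerSol

theorem second_deriv_nonpos_of_isLocalMax {p p' : ℝ → ℝ} {a c : ℝ}
    (h1 : ∀ᶠ t in nhds a, HasDerivAt p (p' t) t) (h2 : HasDerivAt p' c a)
    (hmax : IsLocalMax p a) : c ≤ 0 := by
  by_contra hc
  push Not at hc
  have hd : deriv p =ᶠ[nhds a] p' := h1.mono fun t ht => ht.deriv
  have hd2 : deriv (deriv p) a = c := by rw [hd.deriv_eq, h2.deriv]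
  have hd1 : deriv p a = 0 := hmax.deriv_eq_zero
  have hmin : IsLocalMin p a := isLocalMin_of_deriv_deriv_pos (by rw [hd2]; exact hc) hd1
    h1.self_of_nhds.continuousAt
  have hconst : p =ᶠ[nhds a] fun _ => p a := by
    filter_upwards [hmax, hmin] with t ht1 ht2 using le_antisymm ht1 ht2
  have : deriv p =ᶠ[nhds a] fun _ => 0 := by
    refine hconst.deriv.trans (Eventually.of_forall fun t => ?_)
    simp
  rw [this.deriv_eq] at hd2
  simp at hd2
  exact hc.ne hd2

theorem Nonlinearity.apply_abs_le {f f' : ℝ → ℝ} {K : ℝ} (hf : Nonlinearity f f' K) {t : ℝ}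
    (ht : t ∈ Ioo (-1:ℝ) 1) : |f t| ≤ K := by
  have hK : 0 ≤ K := (abs_nonneg _).trans (hf.bound t ht)
  have : |t| ≤ 1 := _root_.abs_le.2 ⟨ht.1.le, ht.2.le⟩
  exact (hf.growth t ht).trans (mul_le_of_le_one_right hK this)

theorem Nonlinearity.nonneg {f f' : ℝ → ℝ} {K : ℝ} (hf : Nonlinearity f f' K) : 0 ≤ K :=
  (abs_nonneg _).trans (hf.bound 0 (by simp))

theorem norm_eb {n : ℕ} (i : Fin n) : ‖eb n i‖ = 1 :=
  (EuclideanSpace.basisFun (Fin n) ℝ).orthonormal.1 i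

theorem inner_eb {n : ℕ} (i j : Fin n) : ⟪eb n i, eb n j⟫ = if i = j then 1 else 0 :=
  orthonormal_iff_ite.1 (EuclideanSpace.basisFun (Fin n) ℝ).orthonormal i j

theorem norm_sub_two_inner {E : Type*} [NormedAddCommGroup E] [InnerProductSpace ℝ E] {e : E}
    (he : ‖e‖ = 1) (z : E) : ‖z - (2 * ⟪z, e⟫) • e‖ = ‖z‖ := by
  rw [← sq_eq_sq₀ (norm_nonneg _) (norm_nonneg _), norm_sub_sq_real, norm_smul, inner_smul_right,
    he, Real.norm_eq_abs, mul_one, sq_abs]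
  ring

namespace LayerSol

variable {n : ℕ} {f f' : ℝ → ℝ} {K b κ R : ℝ} {u : Euc n → ℝ} {g : Euc n → Euc n}
  {S : Euc n → Euc n →L[ℝ] Euc n}

theorem hasDerivAt_line_grad (h : LayerSol f f' b κ R u g S) {z v : Euc n} {t : ℝ}
    (hz : z + t • v ∈ ball (0 : Euc n) R) :
    HasDerivAt (fun s : ℝ => g (z + s • v)) (S (z + t • v) v) t := by
  have h1 : HasDerivAt (fun s : ℝ => z + s • v) v t := by
    simpa using ((hasDerivAt_id t).smul_const v).const_add z
  exact (h.hess _ hz).comp_hasDerivAt t h1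

theorem hasDerivAt_line (h : LayerSol f f' b κ R u g S) {z v : Euc n} {t : ℝ}
    (hz : z + t • v ∈ ball (0 : Euc n) R) :
    HasDerivAt (fun s : ℝ => u (z + s • v)) ⟪g (z + t • v), v⟫ t := by
  have h1 : HasDerivAt (fun s : ℝ => z + s • v) v t := by
    simpa using ((hasDerivAt_id t).smul_const v).const_add z
  refine ((h.grad _ hz).hasFDerivAt.comp_hasDerivAt t h1).congr_deriv ?_
  simp

theorem hasDerivAt_line_inner (h : LayerSol f f' b κ R u g S) {z v : Euc n} {t : ℝ} (w : Euc n)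
    (hz : z + t • v ∈ ball (0 : Euc n) R) :
    HasDerivAt (fun s : ℝ => ⟪g (z + s • v), w⟫) ⟪S (z + t • v) v, w⟫ t := by
  simpa using (h.hasDerivAt_line_grad hz).inner ℝ (hasDerivAt_const t w)

theorem inner_grad_eb_le (h : LayerSol f f' b κ R u g S) (hf : Nonlinearity f f' K)
    {z0 : Euc n} {d : ℝ} (hd : 0 < d) (hz0 : closedBall z0 d ⊆ ball 0 R) (i : Fin n)
    {σ : ℝ} (hσ : |σ| = 1) :
    2 * ⟪g z0, σ • eb n i⟫ ≤ (K + n * (2 / d ^ 2) + 1) * d := by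
  set e := σ • eb n i with he
  have hen : ‖e‖ = 1 := by rw [he, norm_smul, norm_eb, Real.norm_eq_abs, hσ, one_mul]
  have hσ2 : σ * σ = 1 := by rw [← abs_mul_abs_self, hσ, one_mul]
  have hee : ⟪e, e⟫ = 1 := by rw [real_inner_self_eq_norm_sq, hen]; norm_num
  set A : ℝ := 2 / d ^ 2 with hA
  set C : ℝ := K + n * A + 1 with hC
  have hA0 : 0 < A := by positivity
  have hK := hf.nonneg
  have hC0 : 0 < C := by positivity
  let ρ : Euc n → Euc n := fun z => z - (2 * ⟪z, e⟫) • e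
  have hρn : ∀ z, ‖ρ z‖ = ‖z‖ := norm_sub_two_inner hen
  have hρl : ∀ z v (t : ℝ), ρ (z + t • v) = ρ z + t • ρ v := by
    intro z v t
    simp only [ρ, inner_add_left, inner_smul_left, smul_sub, smul_smul, mul_add, add_smul]
    simp only [conj_trivial]
    rw [show 2 * (t * ⟪v, e⟫) = t * (2 * ⟪v, e⟫) by ring]
    abel
  have hin : ∀ z, ‖z‖ ≤ d → z0 + z ∈ ball (0 : Euc n) R := fun z hz =>
    hz0 (by simpa using hz)
  let m : Euc n → ℝ := fun z => u (z0 + z) - u (z0 + ρ z) - A * ‖z‖ ^ 2 - C * d * ⟪z, e⟫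
    + C * ⟪z, e⟫ ^ 2
  have hmu : ∀ z, ‖z‖ ≤ d → ContinuousAt m z := by
    intro z hz
    have c1 : ContinuousAt u (z0 + z) := (h.grad _ (hin z hz)).continuousAt
    have c2 : ContinuousAt u (z0 + ρ z) :=
      (h.grad _ (hin _ ((hρn z).le.trans hz))).continuousAt
    have c3 : ContinuousAt (fun z => u (z0 + z)) z :=
      ContinuousAt.comp (g := u) (f := fun z => z0 + z) c1 (by fun_prop)
    have c4 : ContinuousAt (fun z => u (z0 + ρ z)) z :=
      ContinuousAt.comp (g := u) (f := fun z => z0 + ρ z) c2 (by fun_prop)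
    fun_prop
  let T : Set (Euc n) := {z | ‖z‖ ≤ d ∧ 0 ≤ ⟪z, e⟫}
  have hTc : IsCompact T := by
    have : T = closedBall 0 d ∩ {z | 0 ≤ ⟪z, e⟫} := by ext z; simp [T]
    rw [this]
    exact (isCompact_closedBall _ _).inter_right (isClosed_le continuous_const (by fun_prop))
  have hmT : ∀ z ∈ T, m z ≤ 0 := by
    obtain ⟨w, hwT, hw⟩ := hTc.exists_isMaxOn ⟨0, by simp [T, hd.le]⟩
      (f := m) (fun z hz => (hmu z hz.1).continuousWithinAt)
    intro z hz
    refine (hw hz).trans ?_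
    by_contra hpos
    push Not at hpos
    have hwe : ⟪w, e⟫ ≤ ‖w‖ := by
      simpa [hen] using real_inner_le_norm w e
    have hwd : ‖w‖ < d := by
      refine lt_of_le_of_ne hwT.1 fun hEq => ?_
      have r1 := h.range _ (hin w hwT.1)
      have r2 := h.range _ (hin (ρ w) ((hρn w).le.trans hwT.1))
      have hAd : A * d ^ 2 = 2 := by rw [hA]; field_simp
      have : C * ⟪w, e⟫ ^ 2 ≤ C * d * ⟪w, e⟫ := by
        rw [mul_assoc]
        refine mul_le_mul_of_nonneg_left ?_ hC0.le
        rw [sq]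
        exact mul_le_mul_of_nonneg_right (hwe.trans hwT.1) hwT.2
      simp only [m] at hpos
      rw [hEq, hAd] at hpos
      linarith [r1.1, r1.2, r2.1, r2.2]
    have hwp : 0 < ⟪w, e⟫ := by
      refine lt_of_le_of_ne hwT.2 fun hEq => ?_
      have : ρ w = w := by simp [ρ, ← hEq]
      simp only [m, this, ← hEq] at hpos
      nlinarith [sq_nonneg ‖w‖]
    have hloc : ∀ᶠ z in nhds w, ‖z‖ < d ∧ 0 < ⟪z, e⟫ :=
      ((continuous_norm.tendsto w).eventually_lt_const hwd).and
        ((Continuous.tendsto (by fun_prop : Continuous fun z : Euc n => ⟪z, e⟫) w).eventually_const_lt hwp)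
    have hmax : IsLocalMax m w := hloc.mono fun z hz => hw ⟨hz.1.le, hz.2.le⟩
    have hsecond : ∀ j, ⟪S (z0 + w) (eb n j), eb n j⟫ - ⟪S (z0 + ρ w) (ρ (eb n j)), ρ (eb n j)⟫
        - 2 * A + 2 * C * ⟪eb n j, e⟫ ^ 2 ≤ 0 := by
      intro j
      set q := eb n j
      have hq : ⟪q, q⟫ = 1 := by rw [real_inner_self_eq_norm_sq, norm_eb]; norm_num
      have hline : Tendsto (fun t : ℝ => w + t • q) (nhds 0) (nhds w) := by
        have : Continuous (fun t : ℝ => w + t • q) := by fun_prop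
        simpa using this.tendsto 0
      have heq : ∀ t : ℝ, m (w + t • q) = u ((z0 + w) + t • q) - u ((z0 + ρ w) + t • ρ q)
          - A * (‖w‖ ^ 2 + 2 * t * ⟪w, q⟫ + t ^ 2) - C * d * (⟪w, e⟫ + t * ⟪q, e⟫)
          + C * (⟪w, e⟫ + t * ⟪q, e⟫) ^ 2 := by
        intro t
        simp only [m, hρl, ← add_assoc, inner_add_left, inner_smul_left, conj_trivial]
        rw [norm_add_sq_real, norm_smul, norm_eb, inner_smul_right, mul_one, Real.norm_eq_abs,
          sq_abs]
        ring
      have hmax1 : IsLocalMax (fun t : ℝ => m (w + t • q)) 0 := by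
        have := hline.eventually hmax
        refine this.mono fun t ht => ?_
        simpa using ht
      refine second_deriv_nonpos_of_isLocalMax (a := 0) (p := fun t : ℝ => m (w + t • q))
        (p' := fun t => ⟪g ((z0 + w) + t • q), q⟫ - ⟪g ((z0 + ρ w) + t • ρ q), ρ q⟫
          - A * (2 * ⟪w, q⟫ + 2 * t) - C * d * ⟪q, e⟫ + C * (2 * (⟪w, e⟫ + t * ⟪q, e⟫) * ⟪q, e⟫))
        ?_ ?_ hmax1
      · filter_upwards [hline.eventually hloc] with t ht
        have b1 : (z0 + w) + t • q ∈ ball (0 : Euc n) R := by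
          rw [add_assoc]; exact hin _ ht.1.le
        have b2 : (z0 + ρ w) + t • ρ q ∈ ball (0 : Euc n) R := by
          rw [add_assoc, ← hρl]; exact hin _ ((hρn _).le.trans ht.1.le)
        simp only [heq]
        have d3 : HasDerivAt (fun t : ℝ => ‖w‖ ^ 2 + 2 * t * ⟪w, q⟫ + t ^ 2)
            (2 * ⟪w, q⟫ + 2 * t) t := by
          have := ((((hasDerivAt_id t).const_mul 2).mul_const ⟪w, q⟫).const_add (‖w‖ ^ 2)).add
            ((hasDerivAt_id t).pow 2)
          refine this.congr_deriv ?_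
          simp
        have d4 : HasDerivAt (fun t : ℝ => ⟪w, e⟫ + t * ⟪q, e⟫) ⟪q, e⟫ t := by
          simpa using ((hasDerivAt_id t).mul_const ⟪q, e⟫).const_add ⟪w, e⟫
        have d5 : HasDerivAt (fun t : ℝ => (⟪w, e⟫ + t * ⟪q, e⟫) ^ 2)
            (2 * (⟪w, e⟫ + t * ⟪q, e⟫) * ⟪q, e⟫) t := by
          refine (d4.pow 2).congr_deriv ?_
          simp
        exact ((((h.hasDerivAt_line b1).sub (h.hasDerivAt_line b2)).sub (d3.const_mul A)).sub
          (d4.const_mul (C * d))).add (d5.const_mul C)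
      · have b1 : (z0 + w) + (0:ℝ) • q ∈ ball (0 : Euc n) R := by
          simpa using hin _ hwd.le
        have b2 : (z0 + ρ w) + (0:ℝ) • ρ q ∈ ball (0 : Euc n) R := by
          simpa using hin _ ((hρn _).le.trans hwd.le)
        have d3 : HasDerivAt (fun t : ℝ => 2 * ⟪w, q⟫ + 2 * t) 2 (0:ℝ) := by
          simpa using ((hasDerivAt_id (0:ℝ)).const_mul 2).const_add (2 * ⟪w, q⟫)
        have d4 : HasDerivAt (fun t : ℝ => 2 * (⟪w, e⟫ + t * ⟪q, e⟫) * ⟪q, e⟫)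
            (2 * ⟪q, e⟫ ^ 2) (0:ℝ) := by
          refine (((((hasDerivAt_id (0:ℝ)).mul_const ⟪q, e⟫).const_add ⟪w, e⟫).const_mul
            2).mul_const ⟪q, e⟫).congr_deriv ?_
          ring
        refine ((((((h.hasDerivAt_line_inner q b1).sub (h.hasDerivAt_line_inner (ρ q) b2)).sub
          (d3.const_mul A)).sub_const (C * d * ⟪q, e⟫)).add (d4.const_mul C))).congr_deriv ?_
        simp only [zero_smul, add_zero]
        ring
    have hρe : ∀ j, ⟪S (z0 + ρ w) (ρ (eb n j)), ρ (eb n j)⟫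
        = ⟪S (z0 + ρ w) (eb n j), eb n j⟫ := by
      intro j
      by_cases hj : j = i
      · have : ρ (eb n j) = -eb n j := by
          simp only [ρ, hj, he, inner_smul_right, inner_eb, smul_smul, if_true]
          rw [show 2 * (σ * 1) * σ = 2 * (σ * σ) by ring, hσ2, mul_one, two_smul]; abel
        simp [this]
      · have : ρ (eb n j) = eb n j := by
          simp only [ρ, he, inner_smul_right, inner_eb, if_neg hj]
          simp
        rw [this]
    have hsum := Finset.sum_nonpos fun j (_ : j ∈ Finset.univ) => hsecond j
    simp only [hρe, Finset.sum_add_distrib, Finset.sum_sub_distrib, ← Finset.mul_sum] at hsum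
    rw [h.pde _ (hin _ hwd.le), h.pde _ (hin _ ((hρn _).le.trans hwd.le))] at hsum
    have hs1 : ∑ j, ⟪eb n j, e⟫ ^ 2 = 1 := by
      simp [he, inner_smul_right, inner_eb, sq, hσ2]
    rw [hs1] at hsum
    simp only [Finset.sum_const, Finset.card_univ, Fintype.card_fin, nsmul_eq_mul] at hsum
    have f1 := abs_le.1 (hf.apply_abs_le (h.range _ (hin _ hwd.le)))
    have f2 := abs_le.1 (hf.apply_abs_le (h.range _ (hin _ ((hρn w).le.trans hwd.le))))
    rw [hC] at hsum
    nlinarith [f1.1, f1.2, f2.1, f2.2]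
  have hρe0 : ρ e = -e := by
    simp only [ρ, hee]
    rw [mul_one, two_smul]; abel
  have hder : HasDerivAt (fun t : ℝ => u (z0 + t • e) - u (z0 + t • (-e)) - A * t ^ 2 - C * d * t
      + C * t ^ 2) (2 * ⟪g z0, e⟫ - C * d) 0 := by
    have b : ∀ v : Euc n, z0 + (0:ℝ) • v ∈ ball (0 : Euc n) R := fun v => by
      simpa using hin 0 (by simpa using hd.le)
    have d1 := hasDerivAt_id (0:ℝ)
    refine (((((h.hasDerivAt_line (b e)).sub (h.hasDerivAt_line (b (-e)))).sub
      ((d1.pow 2).const_mul A)).sub (d1.const_mul (C * d))).add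
      ((d1.pow 2).const_mul C)).congr_deriv ?_
    simp
    ring
  have hmax : ∀ t : ℝ, 0 ≤ t → t ≤ d → u (z0 + t • e) - u (z0 + t • (-e)) - A * t ^ 2 - C * d * t
      + C * t ^ 2 ≤ 0 := by
    intro t ht0 htd
    have hn : ‖t • e‖ = t := by rw [norm_smul, hen, mul_one, Real.norm_of_nonneg ht0]
    have hi : ⟪t • e, e⟫ = t := by rw [inner_smul_left, hee]; simp
    have := hmT (t • e) ⟨by rw [hn]; exact htd, by rw [hi]; exact ht0⟩
    have hρt : ρ (t • e) = t • (-e) := by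
      have := hρl 0 e t
      simpa [hρe0, show ρ 0 = 0 by simp [ρ]] using this
    simpa only [m, hn, hi, hρt] using this
  have hfin : 2 * ⟪g z0, e⟫ - C * d ≤ 0 := by
    by_contra hpos
    push Not at hpos
    have hs := (hasDerivAt_iff_tendsto_slope_zero.1 hder).eventually_const_lt hpos
    have hs' : ∀ᶠ t in nhdsWithin (0:ℝ) (Ioi 0), t < d :=
      (eventually_nhdsWithin_of_eventually_nhds (eventually_lt_nhds hd))
    have hs2 := hs.filter_mono (nhdsWithin_mono _ (show Ioi (0:ℝ) ⊆ {0}ᶜ from fun x hx => ne_of_gt hx))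
    obtain ⟨t, ⟨ht1, ht2⟩, ht3⟩ := ((hs2.and hs').and self_mem_nhdsWithin).exists
    have ht3' : 0 < t := ht3
    have := hmax t ht3'.le ht2.le
    simp only [zero_add, zero_smul, add_zero, sub_self, smul_eq_mul] at ht1
    have h4 := (pos_iff_pos_of_mul_pos ht1).1 (inv_pos.2 ht3')
    rw [smul_neg] at h4 this
    norm_num at h4
    linarith
  linarith

/-- Interior gradient bound. -/
theorem norm_grad_le (h : LayerSol f f' b κ R u g S) (hf : Nonlinearity f f' K)
    {z0 : Euc n} (hz0 : ‖z0‖ < R - 1) : ‖g z0‖ ≤ n * (K + n * 2 + 1) := by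
  have hsub : closedBall z0 1 ⊆ ball (0 : Euc n) R := fun z hz => by
    rw [mem_closedBall, dist_eq_norm] at hz
    rw [mem_ball_zero_iff]
    have := norm_add_le z0 (z - z0)
    rw [add_sub_cancel] at this
    linarith
  have hK := hf.nonneg
  have hc : ∀ i, ‖⟪eb n i, g z0⟫ • eb n i‖ ≤ K + n * 2 + 1 := by
    intro i
    have h1 := h.inner_grad_eb_le hf one_pos hsub i (σ := 1) (by simp)
    have h2 := h.inner_grad_eb_le hf one_pos hsub i (σ := -1) (by simp)
    simp only [inner_smul_right] at h1 h2
    norm_num at h1 h2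
    rw [norm_smul, norm_eb, mul_one, Real.norm_eq_abs, abs_le, real_inner_comm]
    have : (0:ℝ) ≤ n * 2 := by positivity
    constructor <;> linarith
  have hs := (EuclideanSpace.basisFun (Fin n) ℝ).sum_repr' (g z0)
  rw [← hs]
  refine (norm_sum_le _ _).trans ((Finset.sum_le_sum fun i _ => hc i).trans ?_)
  rw [Finset.sum_const, Finset.card_univ, Fintype.card_fin, nsmul_eq_mul]

end LayerSol

theorem hasDerivAt_max_zero_pow (m : ℕ) (x : ℝ) :
    HasDerivAt (fun x : ℝ => max x 0 ^ (m + 2)) ((m + 2) * max x 0 ^ (m + 1)) x := by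
  rcases lt_trichotomy x 0 with hx | rfl | hx
  · have h1 : (fun x : ℝ => max x 0 ^ (m + 2)) =ᶠ[nhds x] fun _ => 0 := by
      filter_upwards [eventually_lt_nhds hx] with y hy
      simp [max_eq_right hy.le]
    refine ((hasDerivAt_const x (0:ℝ)).congr_of_eventuallyEq h1).congr_deriv ?_
    simp [max_eq_right hx.le]
  · rw [hasDerivAt_iff_tendsto_slope_zero]
    simp only [zero_add, max_self, ne_eq, Nat.add_eq_zero_iff, one_ne_zero, and_false,
      not_false_eq_true, zero_pow, mul_zero, smul_eq_mul, OfNat.ofNat_ne_zero, sub_zero]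
    have h1 : Tendsto (fun t : ℝ => max t 0 ^ (m + 1)) (nhdsWithin 0 {0}ᶜ) (nhds 0) := by
      have : Continuous fun t : ℝ => max t 0 ^ (m + 1) := by fun_prop
      simpa using (this.tendsto 0).mono_left nhdsWithin_le_nhds
    refine h1.congr' ?_
    filter_upwards [self_mem_nhdsWithin] with t ht
    have ht' : t ≠ 0 := ht
    rcases le_total t 0 with h | h
    · simp [max_eq_right h]
    · rw [max_eq_left h, pow_succ t (m + 1)]
      field_simp
  · have h1 : (fun x : ℝ => max x 0 ^ (m + 2)) =ᶠ[nhds x] fun x => x ^ (m + 2) := by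
      filter_upwards [eventually_gt_nhds hx] with y hy
      simp [max_eq_left hy.le]
    refine ((hasDerivAt_pow (m + 2) x).congr_of_eventuallyEq h1).congr_deriv ?_
    simp [max_eq_left hx.le]

/-- A nonnegative compactly supported profile which is a strict subsolution of `h'' = K h` away
from `[-r, r]`. -/
theorem exists_profile {K r S : ℝ} (hK : 0 ≤ K) (hr : 0 < r) (hS : 1 ≤ S) :
    ∃ (h h1 h2 : ℝ → ℝ) (H : ℝ), 0 ≤ H ∧ (∀ t, HasDerivAt h (h1 t) t) ∧
      (∀ t, HasDerivAt h1 (h2 t) t) ∧ Continuous h2 ∧ (∀ t, 0 ≤ h t) ∧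
      (∀ t, S ≤ |t| → h t = 0 ∧ h1 t = 0 ∧ h2 t = 0) ∧ (∀ t, |t| ≤ S - 1 → 1 ≤ h t) ∧
      (∀ t, h t ≤ H ∧ |h1 t| ≤ H ∧ |h2 t| ≤ H) ∧ ∀ t, r ≤ |t| → (K + 1) * h t ≤ h2 t := by
  obtain ⟨m, hm⟩ := exists_nat_gt ((2 * S ^ 2 + (K + 1) * S ^ 4) / (4 * r ^ 2))
  rw [div_lt_iff₀ (by positivity)] at hm
  let p : ℝ → ℝ := fun t => max (S ^ 2 - t ^ 2) 0
  let h : ℝ → ℝ := fun t => p t ^ (m + 3)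
  let h1 : ℝ → ℝ := fun t => (m + 3) * p t ^ (m + 2) * (-(2 * t))
  let h2 : ℝ → ℝ := fun t => (m + 3) * ((m + 2) * p t ^ (m + 1) * (-(2 * t))) * (-(2 * t)) +
    (m + 3) * p t ^ (m + 2) * (-2)
  have hin : ∀ t : ℝ, HasDerivAt (fun t => S ^ 2 - t ^ 2) (-(2 * t)) t := fun t => by
    simpa using ((hasDerivAt_id t).pow 2).const_sub (S ^ 2)
  have hd : ∀ t, HasDerivAt h (h1 t) t := fun t => by
    have := (hasDerivAt_max_zero_pow (m + 1) (S ^ 2 - t ^ 2)).comp t (hin t)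
    refine this.congr_deriv ?_
    simp only [h1, p]
    push_cast
    ring
  have hd1 : ∀ t, HasDerivAt h1 (h2 t) t := fun t => by
    have a1 := ((hasDerivAt_max_zero_pow m (S ^ 2 - t ^ 2)).comp t (hin t)).const_mul ((m : ℝ) + 3)
    have a2 : HasDerivAt (fun t : ℝ => -(2 * t)) (-2) t := by
      exact (((hasDerivAt_id t).const_mul 2).fun_neg).congr_deriv (by norm_num)
    exact a1.mul a2
  have hpc : Continuous p := by fun_prop
  have hc2 : Continuous h2 := by fun_prop
  have hc1 : Continuous h1 := by fun_prop
  have hc : Continuous h := by fun_prop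
  have hp0 : ∀ t, S ≤ |t| → p t = 0 := fun t ht => by
    refine max_eq_right ?_
    rw [← sq_abs t]
    nlinarith
  have hz : ∀ t, S ≤ |t| → h t = 0 ∧ h1 t = 0 ∧ h2 t = 0 := fun t ht => by
    simp [h, h1, h2, hp0 t ht]
  have hbd : ∀ k : ℝ → ℝ, Continuous k → (∀ t, S ≤ |t| → k t = 0) → ∃ C, 0 ≤ C ∧ ∀ t, |k t| ≤ C := by
    intro k hk hk0
    obtain ⟨C, hC⟩ := (isCompact_Icc (a := -S) (b := S)).exists_bound_of_continuousOn hk.continuousOn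
    have hC0 : 0 ≤ C := (norm_nonneg _).trans (hC 0 ⟨by linarith, by linarith⟩)
    refine ⟨C, hC0, fun t => ?_⟩
    rcases le_total S |t| with ht | ht
    · rw [hk0 t ht]; simpa using hC0
    · exact hC t (abs_le.1 ht)
  obtain ⟨C0, hC00, hC0⟩ := hbd h hc fun t ht => (hz t ht).1
  obtain ⟨C1, hC10, hC1⟩ := hbd h1 hc1 fun t ht => (hz t ht).2.1
  obtain ⟨C2, hC20, hC2⟩ := hbd h2 hc2 fun t ht => (hz t ht).2.2
  have hpn : ∀ t, 0 ≤ p t := fun t => le_max_right _ _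
  refine ⟨h, h1, h2, C0 + C1 + C2, by positivity, hd, hd1, hc2, fun t => pow_nonneg (hpn t) _, hz,
    ?_, ?_, ?_⟩
  · intro t ht
    refine one_le_pow₀ (le_max_of_le_left ?_)
    rw [← sq_abs t]
    nlinarith [abs_nonneg t]
  · intro t
    exact ⟨(le_abs_self _).trans (by linarith [hC0 t]), by linarith [hC1 t], by linarith [hC2 t]⟩
  · intro t ht
    have hpS : p t ≤ S ^ 2 := max_le (by nlinarith [sq_nonneg t]) (sq_nonneg _)
    have ht2 : r ^ 2 ≤ t ^ 2 := by rw [← sq_abs t]; exact pow_le_pow_left₀ hr.le ht 2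
    have key : (K + 1) * p t ^ 2 ≤ (m + 3) * ((m + 2) * (4 * t ^ 2) - 2 * p t) := by
      have e1 : p t ^ 2 ≤ S ^ 4 := by nlinarith [hpn t]
      have e2 : (K + 1) * p t ^ 2 ≤ (K + 1) * S ^ 4 := mul_le_mul_of_nonneg_left e1 (by linarith)
      have e3 : (m : ℝ) * (4 * r ^ 2) ≤ (m + 2) * (4 * t ^ 2) := by
        have : (0:ℝ) ≤ m := Nat.cast_nonneg m
        nlinarith
      have e4 : (K + 1) * S ^ 4 ≤ (m + 2) * (4 * t ^ 2) - 2 * p t := by linarith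
      have e5 : 0 ≤ (K + 1) * S ^ 4 := by positivity
      have : (0:ℝ) ≤ m := Nat.cast_nonneg m
      nlinarith
    calc (K + 1) * h t = p t ^ (m + 1) * ((K + 1) * p t ^ 2) := by simp only [h]; ring
      _ ≤ p t ^ (m + 1) * ((m + 3) * ((m + 2) * (4 * t ^ 2) - 2 * p t)) :=
        mul_le_mul_of_nonneg_left key (pow_nonneg (hpn t) _)
      _ = h2 t := by simp only [h2]; ring

/-- Cutoff functions with scaled derivative bounds. -/
theorem exists_cutoff (n : ℕ) : ∃ B : ℝ, 0 ≤ B ∧ ∀ ρ : ℝ, 0 < ρ →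
    ∃ (β : Euc n → ℝ) (p : Euc n → Euc n) (D : Euc n → Euc n →L[ℝ] Euc n),
      (∀ z, HasGradientAt β (p z) z) ∧ (∀ z, HasFDerivAt p (D z) z) ∧ Continuous D ∧
      (∀ z, 0 ≤ β z ∧ β z ≤ 1) ∧ (∀ z, ‖z‖ ≤ ρ → β z = 1) ∧
      (∀ z, 2 * ρ < ‖z‖ → β z = 0 ∧ p z = 0 ∧ D z = 0) ∧
      ∀ z, ‖p z‖ ≤ B / ρ ∧ ‖D z‖ ≤ B / ρ ^ 2 := by
  let β : ContDiffBump (0 : Euc n) := ⟨1, 2, one_pos, one_lt_two⟩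
  have hβ : ContDiff ℝ 2 β := contDiff_infty.1 β.contDiff 2
  have hg : ContDiff ℝ 1 (gradient β) :=
    (InnerProductSpace.toDual ℝ (Euc n)).symm.contDiff.comp (hβ.fderiv_right (by norm_num))
  have hD : Continuous (fderiv ℝ (gradient β)) := hg.continuous_fderiv one_ne_zero
  have hcg : HasCompactSupport (gradient β) := by
    refine HasCompactSupport.intro β.hasCompactSupport (fun z hz => ?_)
    exact gradient_eq_zero_of_notMem_tsupport hz
  obtain ⟨B1, hB1⟩ := hg.continuous.bounded_above_of_compact_support hcg
  obtain ⟨B2, hB2⟩ := hD.bounded_above_of_compact_support (hcg.fderiv ℝ)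
  have hB10 : 0 ≤ B1 := (norm_nonneg _).trans (hB1 0)
  have hB20 : 0 ≤ B2 := (norm_nonneg _).trans (hB2 0)
  have hts : ∀ z : Euc n, 2 < ‖z‖ → z ∉ tsupport β := fun z hz hz' => by
    rw [β.tsupport_eq, mem_closedBall_zero_iff] at hz'
    exact absurd hz' (not_le.2 hz)
  refine ⟨B1 + B2, by positivity, fun ρ hρ => ⟨fun z => β (ρ⁻¹ • z), fun z => ρ⁻¹ • gradient β (ρ⁻¹ • z),
    fun z => ρ⁻¹ • ρ⁻¹ • fderiv ℝ (gradient β) (ρ⁻¹ • z), ?_, ?_, ?_, ?_, ?_, ?_, ?_⟩⟩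
  · intro z
    have h1 : HasGradientAt β (gradient β (ρ⁻¹ • z)) (ρ⁻¹ • z) :=
      ((hβ.differentiable two_ne_zero) _).hasGradientAt
    have h2 : HasFDerivAt (fun z : Euc n => ρ⁻¹ • z) (ρ⁻¹ • ContinuousLinearMap.id ℝ (Euc n)) z :=
      (hasFDerivAt_id z).const_smul ρ⁻¹
    rw [hasGradientAt_iff_hasFDerivAt]
    refine (h1.hasFDerivAt.comp z h2).congr_fderiv ?_
    ext v
    simp
  · intro z
    have h2 : HasFDerivAt (fun z : Euc n => ρ⁻¹ • z) (ρ⁻¹ • ContinuousLinearMap.id ℝ (Euc n)) z :=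
      (hasFDerivAt_id z).const_smul ρ⁻¹
    have h1 := ((hg.differentiable one_ne_zero) (ρ⁻¹ • z)).hasFDerivAt
    refine ((h1.comp z h2).const_smul ρ⁻¹).congr_fderiv ?_
    ext v
    simp
  · fun_prop
  · exact fun z => ⟨β.nonneg, β.le_one⟩
  · intro z hz
    refine β.one_of_mem_closedBall ?_
    rw [mem_closedBall_zero_iff, norm_smul, norm_inv, Real.norm_of_nonneg hρ.le,
      inv_mul_le_iff₀ hρ]
    simpa [β] using hz
  · intro z hz
    have : ρ⁻¹ • z ∉ tsupport β := by
      refine hts _ ?_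
      rw [norm_smul, norm_inv, Real.norm_of_nonneg hρ.le, lt_inv_mul_iff₀ hρ]
      linarith
    refine ⟨image_eq_zero_of_notMem_tsupport this, ?_, ?_⟩
    · simp only [gradient_eq_zero_of_notMem_tsupport this, smul_zero]
    · have h0 : fderiv ℝ (gradient β) (ρ⁻¹ • z) = 0 := by
        by_contra h0
        refine this ?_
        have h1 : tsupport (gradient β) ⊆ tsupport β := by
          refine closure_minimal (fun y hy => ?_) (isClosed_tsupport _)
          by_contra hy'
          exact hy (gradient_eq_zero_of_notMem_tsupport hy')
        exact h1 (support_fderiv_subset ℝ h0)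
      ext1 v
      simp [h0]
  · intro z
    have e1 := hB1 (ρ⁻¹ • z)
    have e2 := hB2 (ρ⁻¹ • z)
    rw [norm_smul, norm_smul, norm_smul, norm_inv, Real.norm_of_nonneg hρ.le]
    constructor
    · rw [div_eq_inv_mul]
      exact mul_le_mul_of_nonneg_left (by linarith) (by positivity)
    · rw [div_eq_inv_mul, ← mul_assoc, ← mul_inv, ← sq]
      exact mul_le_mul_of_nonneg_left (by linarith) (by positivity)

/-- A smooth positive approximation of the positive part. -/
def softPlus (δ t : ℝ) : ℝ := (t + Real.sqrt (t ^ 2 + δ ^ 2)) / 2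

section SoftPlus

variable {δ : ℝ}

theorem sqrt_softPlus_pos (hδ : 0 < δ) (t : ℝ) : 0 < Real.sqrt (t ^ 2 + δ ^ 2) :=
  Real.sqrt_pos.2 (by positivity)

theorem abs_le_sqrt_softPlus (t : ℝ) : |t| ≤ Real.sqrt (t ^ 2 + δ ^ 2) :=
  Real.abs_le_sqrt (by nlinarith [sq_nonneg δ])

theorem sqrt_softPlus_le (hδ : 0 < δ) (t : ℝ) : Real.sqrt (t ^ 2 + δ ^ 2) ≤ |t| + δ := by
  rw [Real.sqrt_le_left (by positivity), ← sq_abs t]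
  nlinarith [abs_nonneg t]

theorem hasDerivAt_softPlus (hδ : 0 < δ) (t : ℝ) :
    HasDerivAt (softPlus δ) (softPlus δ t / Real.sqrt (t ^ 2 + δ ^ 2)) t := by
  have hs := sqrt_softPlus_pos hδ t
  have h1 : HasDerivAt (fun t : ℝ => t ^ 2 + δ ^ 2) (2 * t) t := by
    simpa using ((hasDerivAt_id t).pow 2).add_const (δ ^ 2)
  have h2 := ((hasDerivAt_id t).add (h1.sqrt (by positivity))).div_const 2
  refine h2.congr_deriv ?_
  rw [softPlus]
  field_simp
  ring

theorem contDiff_softPlus (hδ : 0 < δ) : ContDiff ℝ 1 (softPlus δ) := by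
  have : ContDiff ℝ 1 fun t : ℝ => Real.sqrt (t ^ 2 + δ ^ 2) :=
    ContDiff.sqrt (by fun_prop) fun t => by positivity
  exact (contDiff_id.add this).div_const 2

theorem softPlus_nonneg (t : ℝ) : 0 ≤ softPlus δ t := by
  have := abs_le_sqrt_softPlus (δ := δ) t
  have := neg_abs_le t
  rw [softPlus]; linarith

theorem le_softPlus (t : ℝ) : t ≤ softPlus δ t := by
  have := abs_le_sqrt_softPlus (δ := δ) t
  have := le_abs_self t
  rw [softPlus]; linarith

theorem softPlus_le (hδ : 0 < δ) (t : ℝ) : softPlus δ t ≤ |t| + δ := by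
  have := sqrt_softPlus_le hδ t
  have := le_abs_self t
  rw [softPlus]; linarith

theorem softPlus_le_of_nonpos (hδ : 0 < δ) {t : ℝ} (ht : t ≤ 0) : softPlus δ t ≤ δ := by
  have := sqrt_softPlus_le hδ t
  rw [abs_of_nonpos ht] at this
  rw [softPlus]; linarith

/-- The product `F F'` for `F = softPlus δ`. -/
def softPlusFlux (δ t : ℝ) : ℝ := softPlus δ t ^ 2 / Real.sqrt (t ^ 2 + δ ^ 2)

theorem contDiff_softPlusFlux (hδ : 0 < δ) : ContDiff ℝ 1 (softPlusFlux δ) := by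
  have : ContDiff ℝ 1 fun t : ℝ => Real.sqrt (t ^ 2 + δ ^ 2) :=
    ContDiff.sqrt (by fun_prop) fun t => by positivity
  exact ((contDiff_softPlus hδ).pow 2).div this fun t => (sqrt_softPlus_pos hδ t).ne'

theorem exists_hasDerivAt_softPlusFlux (hδ : 0 < δ) (t : ℝ) :
    ∃ G' : ℝ, HasDerivAt (softPlusFlux δ) G' t ∧
      (softPlus δ t / Real.sqrt (t ^ 2 + δ ^ 2)) ^ 2 ≤ G' := by
  have hs := sqrt_softPlus_pos hδ t
  have h1 : HasDerivAt (fun t : ℝ => t ^ 2 + δ ^ 2) (2 * t) t := by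
    simpa using ((hasDerivAt_id t).pow 2).add_const (δ ^ 2)
  have h2 := ((hasDerivAt_softPlus hδ t).pow 2).div (h1.sqrt (by positivity)) hs.ne'
  refine ⟨_, h2, ?_⟩
  have hst : t ≤ Real.sqrt (t ^ 2 + δ ^ 2) := (le_abs_self t).trans (abs_le_sqrt_softPlus t)
  set s := Real.sqrt (t ^ 2 + δ ^ 2)
  have hF := softPlus_nonneg (δ := δ) t
  set F := softPlus δ t
  rw [div_pow, div_le_div_iff_of_pos_right (by positivity)]
  norm_num
  have e1 : 2 * F * (F / s) * s - F ^ 2 * (2 * t / (2 * s)) = F ^ 2 * (2 - t / s) := by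
    field_simp
  have e2 : t / s ≤ 1 := (div_le_one hs).2 hst
  show F ^ 2 ≤ 2 * F * (F / s) * s - F ^ 2 * (2 * t / (2 * s))
  rw [e1]
  nlinarith [sq_nonneg F]

theorem abs_mul_softPlusFlux_sub_le (hδ : 0 < δ) (t : ℝ) :
    |t * softPlusFlux δ t - softPlus δ t ^ 2| ≤ δ * softPlus δ t := by
  have hs := sqrt_softPlus_pos hδ t
  have hss : Real.sqrt (t ^ 2 + δ ^ 2) ^ 2 = t ^ 2 + δ ^ 2 := Real.sq_sqrt (by positivity)
  have hF := softPlus_nonneg (δ := δ) t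
  have hδs : δ ≤ Real.sqrt (t ^ 2 + δ ^ 2) := Real.le_sqrt_of_sq_le (by nlinarith)
  rw [softPlusFlux]
  have hFd : softPlus δ t = (t + Real.sqrt (t ^ 2 + δ ^ 2)) / 2 := rfl
  set s := Real.sqrt (t ^ 2 + δ ^ 2)
  set F := softPlus δ t
  have : t * (F ^ 2 / s) - F ^ 2 = -(F * (δ ^ 2 / (2 * s))) := by
    field_simp
    have : F * (s - t) * 2 = δ ^ 2 := by rw [hFd]; nlinarith
    nlinarith
  rw [this, abs_neg, abs_of_nonneg (by positivity), mul_comm δ]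
  refine mul_le_mul_of_nonneg_left ?_ hF
  rw [div_le_iff₀ (by positivity)]
  nlinarith

end SoftPlus

/-- The part of the ball of radius `ρ` at distance at most `r` from the hyperplane `e^⊥`. -/
def slab {n : ℕ} (e : Euc n) (ρ r : ℝ) : Set (Euc n) := {z | ‖z‖ ≤ ρ ∧ |⟪z, e⟫| ≤ r}

section Slab

variable {n : ℕ} {e : Euc n} {ρ r : ℝ}

theorem isCompact_slab : IsCompact (slab e ρ r) := by
  have : slab e ρ r = closedBall 0 ρ ∩ {z | |⟪z, e⟫| ≤ r} := by ext z; simp [slab]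
  rw [this]
  exact (isCompact_closedBall _ _).inter_right (isClosed_le (by fun_prop) continuous_const)

theorem abs_inner_le_norm_of_unit (he : ‖e‖ = 1) (z : Euc n) : |⟪z, e⟫| ≤ ‖z‖ := by
  simpa [he] using abs_real_inner_le_norm z e

theorem slab_mono {ρ' r' : ℝ} (h1 : ρ ≤ ρ') (h2 : r ≤ r') : slab e ρ r ⊆ slab e ρ' r' :=
  fun _ hz => ⟨hz.1.trans h1, hz.2.trans h2⟩

theorem volume_slab_pos (he : ‖e‖ = 1) (hρ : 0 < ρ) (hr : 0 < r) :
    0 < volume.real (slab e ρ r) := by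
  have h1 : ball (0 : Euc n) (min ρ r) ⊆ slab e ρ r := fun z hz => by
    rw [mem_ball_zero_iff] at hz
    exact ⟨hz.le.trans (min_le_left _ _),
      (abs_inner_le_norm_of_unit he z).trans (hz.le.trans (min_le_right _ _))⟩
  have h2 : 0 < volume (ball (0 : Euc n) (min ρ r)) := measure_ball_pos _ _ (lt_min hρ hr)
  exact ENNReal.toReal_pos (h2.trans_le (measure_mono h1)).ne' isCompact_slab.measure_lt_top.ne

open scoped Pointwise in
theorem volume_slab_mul {t : ℝ} (ht : 0 < t) :
    volume.real (slab e (t * ρ) (t * r)) = t ^ n * volume.real (slab e ρ r) := by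
  have h1 : slab e (t * ρ) (t * r) = t • slab e ρ r := by
    ext z
    rw [mem_smul_set_iff_inv_smul_mem₀ ht.ne']
    simp only [slab, mem_ofPred_eq, norm_smul, inner_smul_left, norm_inv, Real.norm_of_nonneg ht.le,
      conj_trivial, abs_mul, abs_inv, abs_of_pos ht]
    rw [inv_mul_le_iff₀ ht, inv_mul_le_iff₀ ht]
  rw [h1, Measure.real, Measure.addHaar_smul, finrank_euclideanSpace_fin,
    abs_of_pos (by positivity), ENNReal.toReal_mul, ENNReal.toReal_ofReal (by positivity)]
  rfl

theorem closedBall_eq_slab (he : ‖e‖ = 1) : closedBall (0 : Euc n) ρ = slab e ρ ρ := by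
  ext z
  simp only [slab, mem_closedBall_zero_iff, mem_ofPred_eq]
  exact ⟨fun h => ⟨h, (abs_inner_le_norm_of_unit he z).trans h⟩, fun h => h.1⟩

theorem volume_half_ball_le (he : ‖e‖ = 1) (hr : 0 < r) {N : ℕ} (hN : 2 ≤ N) :
    volume.real (slab e (N * r / 2) (N * r / 2)) ≤ (2 * N + 1) * volume.real (slab e (N * r) r) := by
  have hN' : (2:ℝ) ≤ N := by exact_mod_cast hN
  have hcov : slab e (N * r / 2) (N * r / 2) ⊆
      ⋃ j ∈ Finset.Icc (-(N:ℤ)) N, (fun z => (2 * r * j) • e + z) '' slab e (N * r) r := by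
    intro z hz
    have hj := abs_sub_round (⟪z, e⟫ / (2 * r))
    set j := round (⟪z, e⟫ / (2 * r)) with hjd
    have hj2 : |⟪z, e⟫ - 2 * r * j| ≤ r := by
      have : ⟪z, e⟫ - 2 * r * j = (⟪z, e⟫ / (2 * r) - j) * (2 * r) := by field_simp
      rw [this, abs_mul, abs_of_pos (by positivity : 0 < 2 * r)]
      nlinarith
    have hee : ⟪e, e⟫ = 1 := by rw [real_inner_self_eq_norm_sq, he]; norm_num
    have hjN : |(j:ℝ)| ≤ N := by
      have e1 : |2 * r * (j:ℝ)| ≤ r + N * r / 2 := by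
        have := abs_sub_abs_le_abs_sub (2 * r * (j:ℝ)) ⟪z, e⟫
        rw [abs_sub_comm] at this
        linarith [hz.2]
      rw [abs_mul, abs_of_pos (by positivity : 0 < 2 * r)] at e1
      by_contra hcon
      push Not at hcon
      nlinarith
    rw [mem_iUnion₂]
    refine ⟨j, ?_, z - (2 * r * j) • e, ⟨?_, ?_⟩, by simp⟩
    · rw [Finset.mem_Icc, ← abs_le]
      exact_mod_cast hjN
    · have hp : ‖z - ⟪z, e⟫ • e‖ ≤ ‖z‖ := by
        rw [← sq_le_sq₀ (norm_nonneg _) (norm_nonneg _), norm_sub_sq_real, norm_smul,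
          inner_smul_right, he, Real.norm_eq_abs, mul_one, sq_abs]
        nlinarith [sq_nonneg ⟪z, e⟫]
      have : z - (2 * r * j) • e = (z - ⟪z, e⟫ • e) + (⟪z, e⟫ - 2 * r * j) • e := by
        rw [sub_smul]; abel
      rw [this]
      refine (norm_add_le _ _).trans ?_
      rw [norm_smul, he, mul_one, Real.norm_eq_abs]
      have := hz.1
      nlinarith
    · rw [inner_sub_left, inner_smul_left, hee]
      simpa using hj2
  have hfin : volume (⋃ j ∈ Finset.Icc (-(N:ℤ)) N,
      (fun z => (2 * r * j) • e + z) '' slab e (N * r) r) ≠ ⊤ := by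
    refine (Finset.isCompact_biUnion _ fun j _ => ?_).measure_lt_top.ne
    exact isCompact_slab.image (by fun_prop)
  refine (measureReal_mono hcov hfin).trans ((measureReal_biUnion_finset_le _ _).trans ?_)
  have hv : ∀ j : ℤ, volume.real ((fun z => (2 * r * j) • e + z) '' slab e (N * r) r)
      = volume.real (slab e (N * r) r) := fun j => by
    rw [Measure.real, image_add_left, measure_preimage_add]; rfl
  simp only [hv, Finset.sum_const, Int.card_Icc, nsmul_eq_mul]
  refine mul_le_mul_of_nonneg_right (le_of_eq ?_) measureReal_nonneg
  have : ((N:ℤ) + 1 - -N).toNat = 2 * N + 1 := by omega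
  rw [this]; push_cast; ring

theorem volume_ball_le (he : ‖e‖ = 1) (hr : 0 < r) {N : ℕ} (hN : 2 ≤ N) :
    volume.real (closedBall (0 : Euc n) (4 * (N * r))) ≤
      8 ^ n * ((2 * N + 1) * volume.real (slab e (N * r) r)) := by
  rw [closedBall_eq_slab he, show 4 * (N * r) = 8 * (N * r / 2) by ring, volume_slab_mul (by norm_num)]
  exact mul_le_mul_of_nonneg_left (volume_half_ball_le he hr hN) (by positivity)

end Slab

/-- A weak solution `φ` of `Δφ = Vφ` in `B_R(0)`, with gradient `p`, where `-Δ + V` is nonnegative. -/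
structure StableField {n : ℕ} (K R : ℝ) (V φ : Euc n → ℝ) (p : Euc n → Euc n) : Prop where
  contV : ContinuousOn V (ball 0 R)
  boundV : ∀ z ∈ ball (0 : Euc n) R, |V z| ≤ K
  grad : ∀ z ∈ ball (0 : Euc n) R, HasGradientAt φ (p z) z
  cont : ContinuousOn p (ball 0 R)
  weak : ∀ η : Euc n → ℝ, ContDiff ℝ 1 η → HasCompactSupport η → tsupport η ⊆ ball 0 R →
    ∫ z, (⟪p z, gradient η z⟫ + V z * φ z * η z) = 0
  stable : ∀ η : Euc n → ℝ, ContDiff ℝ 1 η → HasCompactSupport η → tsupport η ⊆ ball 0 R →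
    0 ≤ ∫ z, (‖gradient η z‖ ^ 2 + V z * (η z) ^ 2)

section Tools

variable {n : ℕ} {R : ℝ}

theorem contDiffOn_of_hasGradientAt {φ : Euc n → ℝ} {p : Euc n → Euc n} {U : Set (Euc n)}
    (hU : IsOpen U) (h : ∀ z ∈ U, HasGradientAt φ (p z) z) (hp : ContinuousOn p U) :
    ContDiffOn ℝ 1 φ U :=
  contDiffOn_one_of_hasFDerivAt (f' := fun z => InnerProductSpace.toDual ℝ (Euc n) (p z))
    hU (fun z hz => (h z hz).hasFDerivAt)
    ((InnerProductSpace.toDual ℝ (Euc n)).continuous.comp_continuousOn hp)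

theorem HasGradientAt.mul' {A B : Euc n → ℝ} {a b z : Euc n} (hA : HasGradientAt A a z)
    (hB : HasGradientAt B b z) : HasGradientAt (fun z => A z * B z) (B z • a + A z • b) z := by
  rw [hasGradientAt_iff_hasFDerivAt] at *
  refine (hA.fun_mul hB).congr_fderiv ?_
  ext v
  simp
  ring

theorem HasDerivAt.comp_hasGradientAt' {F : ℝ → ℝ} {F' : ℝ} {A : Euc n → ℝ} {a z : Euc n}
    (hF : HasDerivAt F F' (A z)) (hA : HasGradientAt A a z) :
    HasGradientAt (fun z => F (A z)) (F' • a) z := by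
  rw [hasGradientAt_iff_hasFDerivAt] at *
  refine (hF.comp_hasFDerivAt z hA).congr_fderiv ?_
  ext v
  simp

theorem tsupport_subset_of_forall {F : Euc n → ℝ} {T : Set (Euc n)} (hT : IsClosed T)
    (h : ∀ z, z ∉ T → F z = 0) : tsupport F ⊆ T :=
  closure_minimal (fun z hz => by by_contra hzT; exact hz (h z hzT)) hT

theorem integrable_of_forall {F : Euc n → ℝ} {T U : Set (Euc n)} (hT : IsCompact T)
    (hU : IsOpen U) (hTU : T ⊆ U) (hF : ContinuousOn F U) (h : ∀ z, z ∉ T → F z = 0) :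
    Integrable F :=
  integrable_of_tsupport_subset hU hF ((tsupport_subset_of_forall hT.isClosed h).trans hTU)
    (HasCompactSupport.intro hT h)

theorem integrable_indicator_const {T : Set (Euc n)} (hT : IsCompact T) (c : ℝ) :
    Integrable (T.indicator fun _ => c) :=
  (integrable_indicator_iff hT.measurableSet).2 (integrableOn_const hT.measure_lt_top.ne)

theorem integral_indicator_const' {T : Set (Euc n)} (hT : IsCompact T) (c : ℝ) :
    ∫ z, T.indicator (fun _ => c) z = c * volume.real T := by
  rw [integral_indicator_const _ hT.measurableSet, smul_eq_mul, mul_comm]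

/-- The divergence theorem for a compactly supported multiple of a vector field. -/
theorem integral_inner_add_div_eq_zero {a : Euc n → ℝ} (ha : ContDiff ℝ 1 a)
    (hc : HasCompactSupport a) {Ψ : Euc n → Euc n} {D : Euc n → Euc n →L[ℝ] Euc n}
    (hΨ : ∀ z, HasFDerivAt Ψ (D z) z) (hD : Continuous D) :
    ∫ z, (⟪gradient a z, Ψ z⟫ + a z * ∑ i, ⟪D z (eb n i), eb n i⟫) = 0 := by
  have hΨ1 : ContDiff ℝ 1 Ψ := contDiff_one_iff_fderiv.2
    ⟨fun z => (hΨ z).differentiableAt, by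
      rwa [show fderiv ℝ Ψ = D from funext fun z => (hΨ z).fderiv]⟩
  have hH : ∀ i, ContDiff ℝ 1 fun z => a z * ⟪Ψ z, eb n i⟫ := fun i =>
    ha.mul (hΨ1.inner ℝ contDiff_const)
  have hHc : ∀ i, HasCompactSupport fun z => a z * ⟪Ψ z, eb n i⟫ := fun i => hc.mul_right
  have h0 := fun i => integral_fderiv_apply_eq_zero (hH i) (hHc i) (eb n i)
  have hfd : ∀ i z, fderiv ℝ (fun z => a z * ⟪Ψ z, eb n i⟫) z (eb n i) =
      ⟪eb n i, Ψ z⟫ * ⟪gradient a z, eb n i⟫ + a z * ⟪D z (eb n i), eb n i⟫ := by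
    intro i z
    have d1 : HasFDerivAt (fun z => ⟪Ψ z, eb n i⟫) ((innerSL ℝ (eb n i)).comp (D z)) z := by
      have := (innerSL ℝ (eb n i)).hasFDerivAt.comp z (hΨ z)
      refine this.congr_of_eventuallyEq (Eventually.of_forall fun y => ?_)
      simp [real_inner_comm]
    rw [(((ha.differentiable one_ne_zero) z).hasFDerivAt.fun_mul d1).fderiv]
    simp only [add_apply, smul_apply, ContinuousLinearMap.comp_apply, innerSL_apply_apply,
      smul_eq_mul, inner_gradient_left]
    rw [real_inner_comm (eb n i) (D z (eb n i)), real_inner_comm (eb n i) (Ψ z)]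
    ring
  have hpt : ∀ z, ⟪gradient a z, Ψ z⟫ + a z * ∑ i, ⟪D z (eb n i), eb n i⟫ =
      ∑ i, fderiv ℝ (fun z => a z * ⟪Ψ z, eb n i⟫) z (eb n i) := by
    intro z
    simp only [hfd, Finset.sum_add_distrib, ← Finset.mul_sum]
    congr 1
    conv_lhs => rw [← (EuclideanSpace.basisFun (Fin n) ℝ).sum_repr' (Ψ z), inner_sum]
    refine Finset.sum_congr rfl fun i _ => ?_
    rw [inner_smul_right]; rfl
  simp_rw [hpt]
  rw [integral_finsetSum]
  · simp [h0]
  · exact fun i _ => (((hH i).continuous_fderiv one_ne_zero).clm_apply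
      continuous_const).integrable_of_hasCompactSupport ((hHc i).fderiv_apply ℝ _)

end Tools

namespace StableField

variable {n : ℕ} {K R P δ B ρ : ℝ} {V φ ζ : Euc n → ℝ} {p q : Euc n → Euc n}

theorem contDiffOn (h : StableField K R V φ p) : ContDiffOn ℝ 1 φ (ball 0 R) :=
  contDiffOn_of_hasGradientAt isOpen_ball h.grad h.cont

theorem contDiff_mul_cutoff (h : StableField K R V φ p) {F : ℝ → ℝ} (hF : ContDiff ℝ 1 F)
    (hρ : closedBall (0 : Euc n) ρ ⊆ ball 0 R) (hζ : ContDiff ℝ 1 ζ)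
    (hζ0 : ∀ z, ρ < ‖z‖ → ζ z = 0) : ContDiff ℝ 1 fun z => F (φ z) * ζ z := by
  refine contDiff_of_tsupport_subset isOpen_ball ((hF.comp_contDiffOn h.contDiffOn).mul
    hζ.contDiffOn) ((tsupport_subset_of_forall isClosed_closedBall fun z hz => ?_).trans hρ)
  rw [mem_closedBall_zero_iff, not_le] at hz
  simp [hζ0 z hz]

theorem energy_softPlus_le (h : StableField K R V φ p) (hK : 0 ≤ K) (hδ : 0 < δ)
    (hδ1 : δ ≤ 1) (hρ : closedBall (0 : Euc n) ρ ⊆ ball 0 R)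
    (hφ : ∀ z ∈ closedBall (0 : Euc n) ρ, |φ z| ≤ P) (hζ : ∀ z, HasGradientAt ζ (q z) z)
    (hq : Continuous q) (hζ1 : ∀ z, 0 ≤ ζ z ∧ ζ z ≤ 1) (hqB : ∀ z, ‖q z‖ ≤ B)
    (hζ0 : ∀ z, ρ < ‖z‖ → ζ z = 0) :
    ∫ z, (‖gradient (fun z => softPlus δ (φ z) * ζ z) z‖ ^ 2 + V z * (softPlus δ (φ z) * ζ z) ^ 2) ≤
      ((P + 1) ^ 2 * B ^ 2 + K * (δ * (P + 1))) * volume.real (closedBall (0 : Euc n) ρ) := by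
  have hζC : ContDiff ℝ 1 ζ := contDiffOn_univ.1
    (contDiffOn_of_hasGradientAt isOpen_univ (fun z _ => hζ z) hq.continuousOn)
  have hT : IsCompact (closedBall (0 : Euc n) ρ) := isCompact_closedBall _ _
  have hnot : ∀ z : Euc n, z ∉ closedBall (0 : Euc n) ρ → ζ z = 0 := fun z hz => by
    rw [mem_closedBall_zero_iff, not_le] at hz
    exact hζ0 z hz
  set a : Euc n → ℝ := fun z => softPlus δ (φ z) * ζ z with ha
  set η : Euc n → ℝ := fun z => softPlusFlux δ (φ z) * (ζ z * ζ z) with hη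
  have haC : ContDiff ℝ 1 a := h.contDiff_mul_cutoff (contDiff_softPlus hδ) hρ hζC hζ0
  have hηC : ContDiff ℝ 1 η := h.contDiff_mul_cutoff (contDiff_softPlusFlux hδ) hρ (hζC.mul hζC)
    fun z hz => by simp [hζ0 z hz]
  have hat : tsupport a ⊆ closedBall 0 ρ :=
    tsupport_subset_of_forall hT.isClosed fun z hz => by simp [ha, hnot z hz]
  have hηt : tsupport η ⊆ closedBall 0 ρ :=
    tsupport_subset_of_forall hT.isClosed fun z hz => by simp [hη, hnot z hz]
  have hηc : HasCompactSupport η := hT.of_isClosed_subset (isClosed_tsupport _) hηt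
  have hga0 : ∀ z, z ∉ closedBall (0 : Euc n) ρ → gradient a z = 0 ∧ a z = 0 := fun z hz =>
    ⟨gradient_eq_zero_of_notMem_tsupport fun h' => hz (hat h'),
      image_eq_zero_of_notMem_tsupport fun h' => hz (hat h')⟩
  have hgη0 : ∀ z, z ∉ closedBall (0 : Euc n) ρ → gradient η z = 0 ∧ η z = 0 := fun z hz =>
    ⟨gradient_eq_zero_of_notMem_tsupport fun h' => hz (hηt h'),
      image_eq_zero_of_notMem_tsupport fun h' => hz (hηt h')⟩
  have hIE : Integrable fun z => ‖gradient a z‖ ^ 2 + V z * (a z) ^ 2 := by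
    refine integrable_of_forall hT isOpen_ball hρ ?_ fun z hz => ?_
    · exact (haC.continuous_gradient.norm.pow 2).continuousOn.add
        (h.contV.mul (haC.continuous.pow 2).continuousOn)
    · rw [(hga0 z hz).1, (hga0 z hz).2]; simp
  have hIL : Integrable fun z => ⟪p z, gradient η z⟫ + V z * φ z * η z := by
    refine integrable_of_forall hT isOpen_ball hρ ?_ fun z hz => ?_
    · exact (h.cont.inner hηC.continuous_gradient.continuousOn).add
        ((h.contV.mul h.contDiffOn.continuousOn).mul hηC.continuous.continuousOn)
    · rw [(hgη0 z hz).1, (hgη0 z hz).2]; simp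
  have hz0 := h.weak η hηC hηc (hηt.trans hρ)
  rw [← sub_zero (∫ z, (‖gradient a z‖ ^ 2 + V z * (a z) ^ 2)), ← hz0, ← integral_sub hIE hIL,
    ← integral_indicator_const' hT]
  refine integral_mono (hIE.sub hIL) (integrable_indicator_const hT _) fun z => ?_
  by_cases hz : z ∈ closedBall (0 : Euc n) ρ
  · rw [indicator_of_mem hz]
    have hzR := hρ hz
    obtain ⟨G', hG', hG'le⟩ := exists_hasDerivAt_softPlusFlux hδ (φ z)
    have ga : gradient a z = _ :=
      (((hasDerivAt_softPlus hδ (φ z)).comp_hasGradientAt' (h.grad z hzR)).mul' (hζ z)).gradient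
    have gη : gradient η z = _ :=
      ((hG'.comp_hasGradientAt' (h.grad z hzR)).mul' ((hζ z).mul' (hζ z))).gradient
    have hs := sqrt_softPlus_pos hδ (φ z)
    have hF0 := softPlus_nonneg (δ := δ) (φ z)
    have hFP : softPlus δ (φ z) ≤ P + 1 := (softPlus_le hδ _).trans (add_le_add (hφ z hz) hδ1)
    have hGd : softPlusFlux δ (φ z) = softPlus δ (φ z) ^ 2 / Real.sqrt ((φ z) ^ 2 + δ ^ 2) := rfl
    have herr := abs_mul_softPlusFlux_sub_le hδ (φ z)
    have hV := h.boundV z hzR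
    obtain ⟨hζ0', hζ1'⟩ := hζ1 z
    have hqz := hqB z
    rw [ga, gη]
    simp only [ha, hη]
    have hFs : softPlus δ (φ z) * (softPlus δ (φ z) / Real.sqrt ((φ z) ^ 2 + δ ^ 2)) =
        softPlusFlux δ (φ z) := by rw [hGd]; ring
    set F := softPlus δ (φ z)
    set F' := F / Real.sqrt ((φ z) ^ 2 + δ ^ 2)
    set G := softPlusFlux δ (φ z)
    set t := ζ z
    rw [norm_add_sq_real]
    simp only [inner_add_right, inner_smul_left, inner_smul_right, conj_trivial, norm_smul,
      real_inner_self_eq_norm_sq, Real.norm_eq_abs, mul_pow, sq_abs]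
    have hVt : |V z * (t ^ 2 * (F ^ 2 - φ z * G))| ≤ K * (δ * (P + 1)) := by
      rw [abs_mul, abs_mul, abs_sub_comm, abs_of_nonneg (sq_nonneg t)]
      refine mul_le_mul hV ?_ (by positivity) hK
      calc t ^ 2 * |φ z * G - F ^ 2| ≤ 1 * |φ z * G - F ^ 2| :=
            mul_le_mul_of_nonneg_right (pow_le_one₀ hζ0' hζ1') (abs_nonneg _)
        _ ≤ δ * F := by rw [one_mul]; exact herr
        _ ≤ δ * (P + 1) := mul_le_mul_of_nonneg_left hFP hδ.le
    have hVt' := (abs_le.1 hVt).2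
    have hFq : F ^ 2 * ‖q z‖ ^ 2 ≤ (P + 1) ^ 2 * B ^ 2 :=
      mul_le_mul (pow_le_pow_left₀ hF0 hFP 2) (pow_le_pow_left₀ (norm_nonneg _) hqz 2)
        (sq_nonneg _) (sq_nonneg _)
    have hGp : 0 ≤ (G' - F' ^ 2) * (t ^ 2 * ‖p z‖ ^ 2) :=
      mul_nonneg (sub_nonneg.2 hG'le) (by positivity)
    rw [← hFs] at hVt' ⊢
    nlinarith
  · rw [indicator_of_notMem hz, (hga0 z hz).1, (hga0 z hz).2, (hgη0 z hz).1, (hgη0 z hz).2]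
    simp

end StableField

theorem abs_sum_inner_le {n : ℕ} (T : Euc n →L[ℝ] Euc n) :
    |∑ i, ⟪T (eb n i), eb n i⟫| ≤ n * ‖T‖ := by
  refine (Finset.abs_sum_le_sum_abs _ _).trans ?_
  calc ∑ i, |⟪T (eb n i), eb n i⟫| ≤ ∑ _i : Fin n, ‖T‖ := by
        refine Finset.sum_le_sum fun i _ => (abs_real_inner_le_norm _ _).trans ?_
        have := T.le_opNorm (eb n i)
        rw [norm_eb, mul_one] at this
        rwa [norm_eb, mul_one]
    _ = n * ‖T‖ := by simp

theorem sum_inner_mul_inner {n : ℕ} (x y : Euc n) : ∑ i, ⟪x, eb n i⟫ * ⟪y, eb n i⟫ = ⟪x, y⟫ := by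
  have := (EuclideanSpace.basisFun (Fin n) ℝ).sum_inner_mul_inner x y
  rw [← this]
  exact Finset.sum_congr rfl fun i _ => by rw [real_inner_comm y]; rfl

/-- A nonnegative quadratic polynomial has nonpositive discriminant (a quantitative form). -/
theorem false_of_quadratic_nonneg {A Bq C v ε c M : ℝ} (hv : 0 < v) (hc : 0 < c) (hM : 0 < M)
    (hA : A ≤ ε * v) (hB : Bq ≤ -(c / 2) * v) (hC : C ≤ M * v) (hε : ε < c ^ 2 / (4 * M))
    (hq : ∀ t : ℝ, 0 ≤ A + 2 * t * Bq + t ^ 2 * C) : False := by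
  have h := hq (c / (2 * M))
  have ht : 0 < c / (2 * M) := by positivity
  have e1 : 2 * (c / (2 * M)) * Bq ≤ 2 * (c / (2 * M)) * (-(c / 2) * v) :=
    mul_le_mul_of_nonneg_left hB (by positivity)
  have e2 : (c / (2 * M)) ^ 2 * C ≤ (c / (2 * M)) ^ 2 * (M * v) :=
    mul_le_mul_of_nonneg_left hC (by positivity)
  have e3 : 2 * (c / (2 * M)) * (-(c / 2) * v) + (c / (2 * M)) ^ 2 * (M * v) =
      -(c ^ 2 / (4 * M)) * v := by
    field_simp
    ring
  have e4 : ε * v < c ^ 2 / (4 * M) * v := mul_lt_mul_of_pos_right hε hv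
  linarith

namespace StableField

set_option maxHeartbeats 4000000 in
/-- A stable field cannot be positive on a large slab and nonpositive on a nearby parallel one. -/
theorem false_of_opposite_slabs (n : ℕ) {K P c r L : ℝ} (hK : 0 ≤ K) (hP : 0 ≤ P) (hc : 0 < c)
    (hr : 0 < r) (hL : 0 ≤ L) : ∃ ρ > 0, ∀ (R : ℝ) (V φ : Euc n → ℝ) (p : Euc n → Euc n),
      StableField K R V φ p → closedBall (0 : Euc n) (4 * ρ) ⊆ ball 0 R →
      (∀ z ∈ closedBall (0 : Euc n) (4 * ρ), |φ z| ≤ P) → ∀ (e : Euc n) (s : ℝ), ‖e‖ = 1 →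
      |s| ≤ L → (∀ z, ‖z‖ ≤ ρ → |⟪z, e⟫| ≤ r → c ≤ φ z) →
      (∀ z, ‖z‖ ≤ 2 * ρ → |⟪z, e⟫ - s| ≤ r → φ z ≤ 0) → False := by
  set S : ℝ := r + L + 1 with hS
  obtain ⟨h, h1, h2, H, hH0, hdh, hdh1, hch2, hhn, hhz, hh1, hhb, hhsub⟩ :=
    exists_profile hK hr (show (1:ℝ) ≤ S by linarith)
  obtain ⟨B, hB0, hcut⟩ := exists_cutoff n
  set lam : ℝ := max 2 ((S + L) / r) with hlam
  have hlam0 : 0 < lam := lt_of_lt_of_le two_pos (le_max_left _ _)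
  set C3 : ℝ := (1 + K) * H + (P + 1) * (2 * H * B + H * (n * B)) with hC3
  have hC30 : 0 ≤ C3 := by positivity
  set M : ℝ := ((H + H * B) ^ 2 + K * H ^ 2 + 1) * lam ^ n with hM
  have hM0 : 0 < M := by positivity
  set C1 : ℝ := (P + 1) ^ 2 * B ^ 2 + K * (P + 1) with hC1
  have hC10 : 0 ≤ C1 := by positivity
  obtain ⟨N, hN⟩ := exists_nat_gt (max (max 2 (1 / r)) (max (2 * (C3 * lam ^ n) / (c * r))
    (12 * M * (C1 * 8 ^ n) / (c ^ 2 * r ^ 2))))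
  simp only [max_lt_iff] at hN
  obtain ⟨⟨hN2, hN1⟩, hN3, hN4⟩ := hN
  have hNpos : (0:ℝ) < N := by linarith
  rw [div_lt_iff₀ hr] at hN1
  rw [div_lt_iff₀ (by positivity)] at hN3 hN4
  set ρ : ℝ := N * r with hρ
  have hρ1 : 1 ≤ ρ := hN1.le
  have hρ0 : 0 < ρ := by linarith
  refine ⟨ρ, hρ0, fun R V φ p hst hsub hφ e s he hs hpos hneg => ?_⟩
  obtain ⟨β, qβ, Dβ, hβ, hqβ, hDβ, hβ01, hβ1, hβ0, hβB⟩ := hcut ρ hρ0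
  obtain ⟨ζ, qζ, Dζ, hζ, hqζ, hDζ, hζ01, hζ1, hζ0, hζB⟩ := hcut (2 * ρ) (by positivity)
  set δ : ℝ := 1 / ρ ^ 2 with hδ
  have hδ0 : 0 < δ := by positivity
  have hδ1 : δ ≤ 1 / ρ := by
    rw [hδ]
    exact one_div_le_one_div_of_le hρ0 (by nlinarith)
  have hδ1' : δ ≤ 1 := hδ1.trans ((div_le_one hρ0).2 hρ1)
  have hqζc : Continuous qζ := continuous_iff_continuousAt.2 fun z => (hqζ z).continuousAt
  have hqβc : Continuous qβ := continuous_iff_continuousAt.2 fun z => (hqβ z).continuousAt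
  have hζC : ContDiff ℝ 1 ζ := contDiffOn_univ.1
    (contDiffOn_of_hasGradientAt isOpen_univ (fun z _ => hζ z) hqζc.continuousOn)
  have hζ04 : ∀ z, 4 * ρ < ‖z‖ → ζ z = 0 := fun z hz => (hζ0 z (by linarith)).1
  set a : Euc n → ℝ := fun z => softPlus δ (φ z) * ζ z with ha
  have haC : ContDiff ℝ 1 a := hst.contDiff_mul_cutoff (contDiff_softPlus hδ0) hsub hζC hζ04
  have hT : IsCompact (closedBall (0 : Euc n) (4 * ρ)) := isCompact_closedBall _ _
  have hat : tsupport a ⊆ closedBall 0 (4 * ρ) :=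
    tsupport_subset_of_forall hT.isClosed fun z hz => by
      rw [mem_closedBall_zero_iff, not_le] at hz
      simp [ha, hζ04 z hz]
  have hac : HasCompactSupport a := hT.of_isClosed_subset (isClosed_tsupport _) hat
  set v : ℝ := volume.real (slab e ρ r) with hv
  have hv0 : 0 < v := volume_slab_pos he hρ0 hr
  have hQa := hst.energy_softPlus_le hK hδ0 hδ1' hsub hφ hζ hqζc hζ01 (fun z => (hζB z).1) hζ04
  have hQa' : ∫ z, (‖gradient a z‖ ^ 2 + V z * (a z) ^ 2) ≤ (C1 * 8 ^ n * 3 / (N * r ^ 2)) * v := by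
    refine hQa.trans ?_
    have e1 := volume_ball_le he hr (N := N) (by exact_mod_cast hN2.le)
    have e2 : (P + 1) ^ 2 * (B / (2 * ρ)) ^ 2 + K * (δ * (P + 1)) ≤ C1 / ρ ^ 2 := by
      have : (B / (2 * ρ)) ^ 2 ≤ B ^ 2 / ρ ^ 2 := by
        rw [div_pow]
        exact div_le_div_of_nonneg_left (sq_nonneg _) (by positivity) (by nlinarith)
      calc _ ≤ (P + 1) ^ 2 * (B ^ 2 / ρ ^ 2) + K * (δ * (P + 1)) := by gcongr
        _ = C1 / ρ ^ 2 := by rw [hδ, hC1]; ring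
    calc _ ≤ C1 / ρ ^ 2 * (8 ^ n * ((2 * N + 1) * v)) :=
          mul_le_mul e2 e1 measureReal_nonneg (by positivity)
      _ ≤ C1 / ρ ^ 2 * (8 ^ n * ((3 * N) * v)) := by gcongr; linarith
      _ = _ := by rw [hρ]; field_simp
  set ψ : Euc n → ℝ := fun z => h (⟪z, e⟫ - s) * β z with hψ
  set Ψ : Euc n → Euc n := fun z => β z • h1 (⟪z, e⟫ - s) • e + h (⟪z, e⟫ - s) • qβ z with hΨ
  have hσ : ∀ z, HasFDerivAt (fun z : Euc n => ⟪z, e⟫ - s) (innerSL ℝ e) z := fun z => by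
    refine ((innerSL ℝ e).hasFDerivAt.sub_const s).congr_of_eventuallyEq
      (Eventually.of_forall fun y => ?_)
    simp [real_inner_comm]
  have hσg : ∀ z, HasGradientAt (fun z : Euc n => ⟪z, e⟫ - s) e z := fun z => by
    rw [hasGradientAt_iff_hasFDerivAt]
    exact (hσ z).congr_fderiv (by ext v; simp)
  have hψg : ∀ z, HasGradientAt ψ (Ψ z) z := fun z =>
    ((hdh (⟪z, e⟫ - s)).comp_hasGradientAt' (hσg z)).mul' (hβ z)
  set D : Euc n → Euc n →L[ℝ] Euc n := fun z =>
    (h2 (⟪z, e⟫ - s) * β z) • (innerSL ℝ e).smulRight e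
      + h1 (⟪z, e⟫ - s) • ((innerSL ℝ (qβ z)).smulRight e + (innerSL ℝ e).smulRight (qβ z))
      + h (⟪z, e⟫ - s) • Dβ z with hD
  have hΨD : ∀ z, HasFDerivAt Ψ (D z) z := fun z => by
    have d1 := (hβ z).hasFDerivAt.fun_smul
      (((hdh1 (⟪z, e⟫ - s)).comp_hasFDerivAt z (hσ z)).smul_const e)
    have d2 := ((hdh (⟪z, e⟫ - s)).comp_hasFDerivAt z (hσ z)).fun_smul (hqβ z)
    refine (d1.fun_add d2).congr_fderiv ?_
    ext1 v
    simp [hD, smul_smul, mul_comm, mul_left_comm]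
    module
  have hch : Continuous h := continuous_iff_continuousAt.2 fun t => (hdh t).continuousAt
  have hch1 : Continuous h1 := continuous_iff_continuousAt.2 fun t => (hdh1 t).continuousAt
  have hcβ : Continuous β := continuous_iff_continuousAt.2 fun z => (hβ z).continuousAt
  have hσc : Continuous fun z : Euc n => ⟪z, e⟫ - s := by fun_prop
  have hDc : Continuous D := by
    have c1 : Continuous fun z => h2 (⟪z, e⟫ - s) := hch2.comp hσc
    have c2 : Continuous fun z => h1 (⟪z, e⟫ - s) := hch1.comp hσc
    have c3 : Continuous fun z => h (⟪z, e⟫ - s) := hch.comp hσc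
    have c4 : Continuous fun z => (innerSL ℝ (qβ z)).smulRight e :=
      ((ContinuousLinearMap.smulRightL ℝ (Euc n) (Euc n)).flip e).continuous.comp
        ((innerSL ℝ (E := Euc n)).continuous.comp hqβc)
    have c5 : Continuous fun z => (innerSL ℝ e).smulRight (qβ z) :=
      (ContinuousLinearMap.smulRightL ℝ (Euc n) (Euc n) (innerSL ℝ e)).continuous.comp hqβc
    exact (((c1.mul hcβ).smul continuous_const).add (c2.smul (c4.add c5))).add (c3.smul hDβ)
  have hΨc : Continuous Ψ := continuous_iff_continuousAt.2 fun z => (hΨD z).continuousAt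
  have hψC : ContDiff ℝ 1 ψ := contDiffOn_univ.1
    (contDiffOn_of_hasGradientAt isOpen_univ (fun z _ => hψg z) hΨc.continuousOn)
  set T2 : Set (Euc n) := slab e (2 * ρ) (S + L) with hT2
  have hT2c : IsCompact T2 := isCompact_slab
  have hT2R : T2 ⊆ ball 0 R := fun z hz => hsub (by
    rw [mem_closedBall_zero_iff]; exact hz.1.trans (by linarith))
  have hout : ∀ z, z ∉ T2 → ψ z = 0 ∧ Ψ z = 0 ∧ D z = 0 := by
    intro z hz
    by_cases hzρ : ‖z‖ ≤ 2 * ρ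
    · have hσS : S ≤ |⟪z, e⟫ - s| := by
        by_contra hcon
        push Not at hcon
        refine hz ⟨hzρ, ?_⟩
        have := abs_sub_abs_le_abs_sub ⟪z, e⟫ s
        linarith
      obtain ⟨k0, k1, k2⟩ := hhz _ hσS
      refine ⟨by simp [hψ, k0], by simp [hΨ, k0, k1], ?_⟩
      ext1 v
      simp [hD, k0, k1, k2]
    · push Not at hzρ
      obtain ⟨k0, k1, k2⟩ := hβ0 z hzρ
      refine ⟨by simp [hψ, k0], by simp [hΨ, k0, k1], ?_⟩
      ext1 v
      simp [hD, k0, k1, k2]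
  have hψc : HasCompactSupport ψ := HasCompactSupport.intro hT2c fun z hz => (hout z hz).1
  have hψt : tsupport ψ ⊆ T2 := tsupport_subset_of_forall hT2c.isClosed fun z hz => (hout z hz).1
  have hψgr : ∀ z, gradient ψ z = Ψ z := fun z => (hψg z).gradient
  have hv2 : volume.real T2 ≤ lam ^ n * v := by
    rw [hv, ← volume_slab_mul hlam0]
    refine measureReal_mono (slab_mono ?_ ?_) isCompact_slab.measure_lt_top.ne
    · exact mul_le_mul_of_nonneg_right (le_max_left _ _) hρ0.le
    · rw [← div_le_iff₀ hr]; exact le_max_right _ _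
  have hBρ : B / ρ ≤ B := div_le_self hB0 hρ1
  have hBρ2 : B / ρ ^ 2 ≤ B / ρ := div_le_div_of_nonneg_left hB0 hρ0 (by nlinarith)
  have hIψ : Integrable fun z => ‖gradient ψ z‖ ^ 2 + V z * (ψ z) ^ 2 := by
    refine integrable_of_forall hT2c isOpen_ball hT2R ?_ fun z hz => ?_
    · exact (hψC.continuous_gradient.norm.pow 2).continuousOn.add
        (hst.contV.mul (hψC.continuous.pow 2).continuousOn)
    · rw [hψgr, (hout z hz).1, (hout z hz).2.1]; simp
  have hQψ : ∫ z, (‖gradient ψ z‖ ^ 2 + V z * (ψ z) ^ 2) ≤ M * v := by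
    have : ∫ z, (‖gradient ψ z‖ ^ 2 + V z * (ψ z) ^ 2) ≤
        ((H + H * B) ^ 2 + K * H ^ 2 + 1) * volume.real T2 := by
      rw [← integral_indicator_const' hT2c]
      refine integral_mono hIψ (integrable_indicator_const hT2c _) fun z => ?_
      by_cases hz : z ∈ T2
      · rw [indicator_of_mem hz, hψgr]
        obtain ⟨b0, b1, b2⟩ := hhb (⟪z, e⟫ - s)
        have hΨn : ‖Ψ z‖ ≤ H + H * B := by
          refine (norm_add_le _ _).trans (add_le_add ?_ ?_)
          · rw [norm_smul, norm_smul, he, mul_one, Real.norm_of_nonneg (hβ01 z).1]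
            exact (mul_le_of_le_one_left (norm_nonneg _) (hβ01 z).2).trans b1
          · rw [norm_smul, Real.norm_of_nonneg (hhn _)]
            exact mul_le_mul b0 ((hβB z).1.trans hBρ) (norm_nonneg _) hH0
        have hψn : (ψ z) ^ 2 ≤ H ^ 2 := by
          refine pow_le_pow_left₀ (mul_nonneg (hhn _) (hβ01 z).1) ?_ 2
          exact (mul_le_of_le_one_right (hhn _) (hβ01 z).2).trans b0
        have hVψ : V z * (ψ z) ^ 2 ≤ K * H ^ 2 :=
          mul_le_mul ((le_abs_self _).trans (hst.boundV z (hT2R hz))) hψn (sq_nonneg _) hK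
        have := pow_le_pow_left₀ (norm_nonneg _) hΨn 2
        linarith
      · rw [indicator_of_notMem hz, hψgr, (hout z hz).1, (hout z hz).2.1]; simp
    refine this.trans ?_
    rw [hM, mul_assoc]
    exact mul_le_mul_of_nonneg_left hv2 (by positivity)
  have hIq : Integrable fun z => ⟪gradient a z, Ψ z⟫ + V z * a z * ψ z := by
    refine integrable_of_forall hT2c isOpen_ball hT2R ?_ fun z hz => ?_
    · exact (haC.continuous_gradient.inner hΨc).continuousOn.add
        ((hst.contV.mul haC.continuous.continuousOn).mul hψC.continuous.continuousOn)
    · rw [(hout z hz).1, (hout z hz).2.1]; simp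
  have hI0 : Integrable fun z => ⟪gradient a z, Ψ z⟫ + a z * ∑ i, ⟪D z (eb n i), eb n i⟫ := by
    refine integrable_of_forall hT2c isOpen_ball hT2R (Continuous.continuousOn ?_) fun z hz => ?_
    · exact (haC.continuous_gradient.inner hΨc).add (haC.continuous.mul
        (continuous_finsetSum _ fun i _ => (hDc.clm_apply continuous_const).inner continuous_const))
    · rw [(hout z hz).2.1, (hout z hz).2.2]; simp
  have hdiv : ∀ z, ∑ i, ⟪D z (eb n i), eb n i⟫ = h2 (⟪z, e⟫ - s) * β z +
      2 * h1 (⟪z, e⟫ - s) * ⟪qβ z, e⟫ + h (⟪z, e⟫ - s) * ∑ i, ⟪Dβ z (eb n i), eb n i⟫ := by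
    intro z
    have hee : ⟪e, e⟫ = 1 := by rw [real_inner_self_eq_norm_sq, he]; norm_num
    have e1 := sum_inner_mul_inner e e
    have e2 := sum_inner_mul_inner (qβ z) e
    have e3 := sum_inner_mul_inner e (qβ z)
    simp only [hD, add_apply, smul_apply, ContinuousLinearMap.smulRight_apply,
      innerSL_apply_apply, inner_add_left, inner_smul_left, conj_trivial]
    simp only [Finset.sum_add_distrib, ← Finset.mul_sum, mul_add, e1, e2, e3, hee]
    rw [real_inner_comm e (qβ z)]
    ring
  have hQq : ∫ z, (⟪gradient a z, Ψ z⟫ + V z * a z * ψ z) ≤ -(c / 2) * v := by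
    have hz0 := integral_inner_add_div_eq_zero haC hac hΨD hDc
    have hle : ∫ z, (⟪gradient a z, Ψ z⟫ + V z * a z * ψ z) ≤
        -c * v + C3 / ρ * volume.real T2 := by
      rw [← sub_zero (∫ z, (⟪gradient a z, Ψ z⟫ + V z * a z * ψ z)), ← hz0, ← integral_sub hIq hI0,
        hv, ← integral_indicator_const' isCompact_slab, ← integral_indicator_const' hT2c,
        ← integral_add (integrable_indicator_const isCompact_slab _)
          (integrable_indicator_const hT2c _)]
      refine integral_mono (hIq.sub hI0) ((integrable_indicator_const isCompact_slab _).add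
          (integrable_indicator_const hT2c _)) fun z => ?_
      have hslab : z ∈ slab e ρ r → z ∈ T2 := fun hz => slab_mono (by linarith) (by linarith) hz
      by_cases hz : z ∈ T2
      swap
      · have hz' : z ∉ slab e ρ r := fun h' => hz (hslab h')
        rw [indicator_of_notMem hz, indicator_of_notMem hz', (hout z hz).1, (hout z hz).2.1,
          (hout z hz).2.2]
        simp
      rw [indicator_of_mem hz]
      beta_reduce
      rw [hdiv]
      have hz4 : z ∈ closedBall (0 : Euc n) (4 * ρ) := by
        rw [mem_closedBall_zero_iff]; exact hz.1.trans (by linarith)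
      have hζz : ζ z = 1 := hζ1 z hz.1
      have haz : a z = softPlus δ (φ z) := by simp [ha, hζz]
      have ha0 : 0 ≤ a z := by rw [haz]; exact softPlus_nonneg _
      have haP : a z ≤ P + 1 := by
        rw [haz]; exact (softPlus_le hδ0 _).trans (add_le_add (hφ z hz4) hδ1')
      obtain ⟨b0, b1, b2⟩ := hhb (⟪z, e⟫ - s)
      have hn0 := hhn (⟪z, e⟫ - s)
      have hqe : |⟪qβ z, e⟫| ≤ B / ρ := by
        have := abs_inner_le_norm_of_unit he (qβ z)
        exact this.trans (hβB z).1
      have hDe : |∑ i, ⟪Dβ z (eb n i), eb n i⟫| ≤ n * (B / ρ) :=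
        (abs_sum_inner_le _).trans (mul_le_mul_of_nonneg_left ((hβB z).2.trans hBρ2)
          (Nat.cast_nonneg n))
      have herr : |a z * (2 * h1 (⟪z, e⟫ - s) * ⟪qβ z, e⟫ +
          h (⟪z, e⟫ - s) * ∑ i, ⟪Dβ z (eb n i), eb n i⟫)| ≤
          (P + 1) * (2 * H * B + H * (n * B)) / ρ := by
        rw [abs_mul, abs_of_nonneg ha0, mul_div_assoc]
        refine mul_le_mul haP ((abs_add_le _ _).trans ?_) (abs_nonneg _) (by linarith)
        rw [abs_mul, abs_mul, abs_mul, abs_two, abs_of_nonneg hn0]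
        calc _ ≤ 2 * H * (B / ρ) + H * (n * (B / ρ)) := by gcongr
          _ = _ := by ring
      have herr' := (abs_le.1 herr).1
      have hVb := abs_le.1 (hst.boundV z (hT2R hz))
      obtain ⟨hβz0, hβz1⟩ := hβ01 z
      have hK1 : 0 ≤ (1 + K) * H / ρ := by positivity
      have hC3e : C3 / ρ = (1 + K) * H / ρ + (P + 1) * (2 * H * B + H * (n * B)) / ρ := by
        rw [hC3, add_div]
      have hgoal : ∀ X : ℝ, X - (1 + K) * H / ρ ≤
            a z * (β z * (h2 (⟪z, e⟫ - s) - V z * h (⟪z, e⟫ - s))) →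
          ⟪gradient a z, Ψ z⟫ + V z * a z * ψ z - (⟪gradient a z, Ψ z⟫ + a z * (h2 (⟪z, e⟫ - s) * β z +
          2 * h1 (⟪z, e⟫ - s) * ⟪qβ z, e⟫ + h (⟪z, e⟫ - s) * ∑ i, ⟪Dβ z (eb n i), eb n i⟫))
            ≤ -X + C3 / ρ := by
        intro X hX
        rw [hC3e]
        have : ⟪gradient a z, Ψ z⟫ + V z * a z * ψ z - (⟪gradient a z, Ψ z⟫ + a z *
          (h2 (⟪z, e⟫ - s) * β z + 2 * h1 (⟪z, e⟫ - s) * ⟪qβ z, e⟫ +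
            h (⟪z, e⟫ - s) * ∑ i, ⟪Dβ z (eb n i), eb n i⟫)) =
          -(a z * (β z * (h2 (⟪z, e⟫ - s) - V z * h (⟪z, e⟫ - s)))) -
          a z * (2 * h1 (⟪z, e⟫ - s) * ⟪qβ z, e⟫ +
            h (⟪z, e⟫ - s) * ∑ i, ⟪Dβ z (eb n i), eb n i⟫) := by
          simp only [hψ]; ring
        rw [this]
        linarith
      by_cases hzr : |⟪z, e⟫ - s| ≤ r
      · have hφz := hneg z hz.1 hzr
        have hnot : z ∉ slab e ρ r := fun h' => by
          have := hpos z h'.1 h'.2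
          linarith
        rw [indicator_of_notMem hnot]
        have haδ : a z ≤ 1 / ρ := by
          rw [haz]; exact (softPlus_le_of_nonpos hδ0 hφz).trans hδ1
        have := hgoal 0 ?_
        · simpa using this
        have hX : |a z * (β z * (h2 (⟪z, e⟫ - s) - V z * h (⟪z, e⟫ - s)))| ≤ (1 + K) * H / ρ := by
          rw [abs_mul (a z), abs_mul (β z), abs_of_nonneg ha0, abs_of_nonneg hβz0]
          have e1 : |h2 (⟪z, e⟫ - s) - V z * h (⟪z, e⟫ - s)| ≤ H + K * H := by
            refine (abs_sub _ _).trans (add_le_add b2 ?_)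
            rw [abs_mul, abs_of_nonneg hn0]
            exact mul_le_mul (hst.boundV z (hT2R hz)) b0 hn0 hK
          calc _ ≤ 1 / ρ * (1 * (H + K * H)) := by gcongr
            _ = _ := by ring
        have := (abs_le.1 hX).1
        linarith
      · push Not at hzr
        have hsb := hhsub _ hzr.le
        have hge : h (⟪z, e⟫ - s) ≤ h2 (⟪z, e⟫ - s) - V z * h (⟪z, e⟫ - s) := by
          nlinarith [hVb.2]
        by_cases hzs : z ∈ slab e ρ r
        · rw [indicator_of_mem hzs]
          refine hgoal c ?_
          have hac' : c ≤ a z := by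
            rw [haz]; exact (hpos z hzs.1 hzs.2).trans (le_softPlus _)
          have hβz : β z = 1 := hβ1 z hzs.1
          have h1h : 1 ≤ h (⟪z, e⟫ - s) := by
            refine hh1 _ ?_
            have := abs_sub ⟪z, e⟫ s
            have := hzs.2
            linarith
          rw [hβz, one_mul]
          have : c * 1 ≤ a z * (h2 (⟪z, e⟫ - s) - V z * h (⟪z, e⟫ - s)) :=
            mul_le_mul hac' (h1h.trans hge) zero_le_one ha0
          linarith
        · rw [indicator_of_notMem hzs]
          have := hgoal 0 ?_
          · simpa using this
          have : 0 ≤ a z * (β z * (h2 (⟪z, e⟫ - s) - V z * h (⟪z, e⟫ - s))) :=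
            mul_nonneg ha0 (mul_nonneg hβz0 (hn0.trans hge))
          linarith
    refine hle.trans ?_
    have e1 : C3 / ρ * volume.real T2 ≤ C3 / ρ * (lam ^ n * v) :=
      mul_le_mul_of_nonneg_left hv2 (by positivity)
    have e2 : C3 / ρ * lam ^ n ≤ c / 2 := by
      rw [div_mul_eq_mul_div, div_le_iff₀ hρ0, hρ]
      linarith
    have e3 : C3 / ρ * (lam ^ n * v) ≤ c / 2 * v := by
      rw [← mul_assoc]; exact mul_le_mul_of_nonneg_right e2 hv0.le
    linarith
  refine false_of_quadratic_nonneg (ε := C1 * 8 ^ n * 3 / (N * r ^ 2)) hv0 hc hM0 hQa' hQq hQψ ?_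
    fun t => ?_
  · rw [div_lt_div_iff₀ (by positivity) (by positivity)]
    linarith
  · have hηC : ContDiff ℝ 1 fun z => a z + t * ψ z := haC.add (contDiff_const.mul hψC)
    have hηc : HasCompactSupport fun z => a z + t * ψ z := hac.add (hψc.mul_left)
    have hηt : tsupport (fun z => a z + t * ψ z) ⊆ ball 0 R := by
      refine (tsupport_subset_of_forall (hT.isClosed.union hT2c.isClosed) fun z hz => ?_).trans
        (union_subset hsub hT2R)
      rw [mem_union, not_or] at hz
      rw [image_eq_zero_of_notMem_tsupport fun h' => hz.1 (hat h'), (hout z hz.2).1]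
      simp
    have hge := hst.stable _ hηC hηc hηt
    have hgr : ∀ z, gradient (fun z => a z + t * ψ z) z = gradient a z + t • Ψ z := by
      intro z
      have d1 := ((haC.differentiable one_ne_zero) z).hasGradientAt.hasFDerivAt
      have d2 := (hψg z).hasFDerivAt.const_mul t
      have : HasGradientAt (fun z => a z + t * ψ z) (gradient a z + t • Ψ z) z := by
        rw [hasGradientAt_iff_hasFDerivAt]
        refine (d1.fun_add d2).congr_fderiv ?_
        ext v
        simp
      exact this.gradient
    have hIa : Integrable fun z => ‖gradient a z‖ ^ 2 + V z * (a z) ^ 2 := by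
      refine integrable_of_forall hT isOpen_ball hsub ?_ fun z hz => ?_
      · exact (haC.continuous_gradient.norm.pow 2).continuousOn.add
          (hst.contV.mul (haC.continuous.pow 2).continuousOn)
      · rw [gradient_eq_zero_of_notMem_tsupport fun h' => hz (hat h'),
          image_eq_zero_of_notMem_tsupport fun h' => hz (hat h')]
        simp
    have hexp : ∀ z, ‖gradient (fun z => a z + t * ψ z) z‖ ^ 2 + V z * (a z + t * ψ z) ^ 2 =
        (‖gradient a z‖ ^ 2 + V z * (a z) ^ 2) + (2 * t) * (⟪gradient a z, Ψ z⟫ + V z * a z * ψ z)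
        + t ^ 2 * (‖gradient ψ z‖ ^ 2 + V z * (ψ z) ^ 2) := by
      intro z
      rw [hgr, hψgr, norm_add_sq_real, inner_smul_right, norm_smul, mul_pow, Real.norm_eq_abs, sq_abs]
      ring
    simp only [hexp] at hge
    have i1 := integral_add (hIa.add (hIq.const_mul (2 * t))) (hIψ.const_mul (t ^ 2))
    have i2 := integral_add hIa (hIq.const_mul (2 * t))
    rw [integral_const_mul] at i1 i2
    simp only [Pi.add_apply] at i1 i2
    rw [i1, i2] at hge
    exact hge

end StableField

theorem abs_le_of_bootstrap {F : ℝ → ℝ} {m c : ℝ} (hF : ContinuousOn F (Icc 0 1)) (hmc : m < c)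
    (h : ∀ t ∈ Icc (0:ℝ) 1, (∀ s ∈ Ico 0 t, |F s| ≤ c) → |F t| ≤ m) :
    ∀ t ∈ Icc (0:ℝ) 1, |F t| ≤ m := by
  have key : ∀ t ∈ Icc (0:ℝ) 1, |F t| ≤ c := by
    by_contra hne
    push Not at hne
    obtain ⟨t0, ht0, hFt0⟩ := hne
    let A : Set ℝ := Icc 0 1 ∩ (fun t => |F t|) ⁻¹' Ici c
    have hA : IsCompact A :=
      isCompact_Icc.of_isClosed_subset (hF.abs.preimage_isClosed_of_isClosed isClosed_Icc isClosed_Ici)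
        inter_subset_left
    obtain ⟨a, haA, ha⟩ := hA.exists_isLeast ⟨t0, ht0, hFt0.le⟩
    have : |F a| ≤ m := h a haA.1 fun s hs => by
      by_contra hc
      push Not at hc
      exact absurd (ha ⟨⟨hs.1, hs.2.le.trans haA.1.2⟩, hc.le⟩) (not_le.2 hs.2)
    exact absurd (haA.2 : c ≤ |F a|) (not_le.2 (this.trans_lt hmc))
  exact fun t ht => h t ht fun s hs => key s ⟨hs.1, hs.2.le.trans ht.2⟩

theorem exists_zero_deriv_nonpos {v v' : ℝ → ℝ} {a b : ℝ} (hab : a ≤ b)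
    (hv : ∀ t ∈ Icc a b, HasDerivAt v (v' t) t) (ha : 0 < v a) (hb : v b = 0) :
    ∃ s ∈ Icc a b, v s = 0 ∧ v' s ≤ 0 := by
  have hc : ContinuousOn v (Icc a b) := fun t ht => (hv t ht).continuousAt.continuousWithinAt
  let A : Set ℝ := Icc a b ∩ v ⁻¹' Iic 0
  have hA : IsCompact A := isCompact_Icc.of_isClosed_subset
    (hc.preimage_isClosed_of_isClosed isClosed_Icc isClosed_Iic) inter_subset_left
  obtain ⟨s, hsA, hs⟩ := hA.exists_isLeast ⟨b, right_mem_Icc.2 hab, hb.le⟩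
  have has : a < s := lt_of_le_of_ne hsA.1.1 fun hEq => by
    have : v s ≤ 0 := hsA.2
    rw [← hEq] at this
    linarith
  have hpos : ∀ t ∈ Ico a s, 0 < v t := fun t ht => by
    by_contra hn
    push Not at hn
    exact absurd (hs ⟨⟨ht.1, ht.2.le.trans hsA.1.2⟩, hn⟩) (not_le.2 ht.2)
  have hfr : ∃ᶠ t in nhdsWithin s (Iio s), 0 < v t := by
    refine Eventually.frequently ?_
    filter_upwards [Ico_mem_nhdsLT has] with t ht using hpos t ht
  have hd := hv s hsA.1
  have h0 : v s = 0 := by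
    refine le_antisymm hsA.2 ?_
    refine ge_of_tendsto (hd.continuousAt.tendsto.mono_left (nhdsWithin_le_nhds (s := Iio s))) ?_
    filter_upwards [Ico_mem_nhdsLT has] with t ht using (hpos t ht).le
  refine ⟨s, hsA.1, h0, ?_⟩
  have hslope := hd.hasDerivWithinAt (s := Iio s)
  rw [hasDerivWithinAt_iff_tendsto_slope' (by simp)] at hslope
  refine le_of_tendsto hslope ?_
  filter_upwards [Ico_mem_nhdsLT has] with t ht
  rw [slope_def_field, h0]
  exact div_nonpos_of_nonneg_of_nonpos (by linarith [hpos t ht]) (by linarith [ht.2]) 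

theorem isPreconnected_zeros_of_strictMonoOn {U : ℝ × ℝ → ℝ} {r : ℝ} (hr : 0 < r)
    (hU : ContinuousOn U (Icc 0 1 ×ˢ Icc (-r) r))
    (hmono : ∀ t ∈ Icc (0:ℝ) 1, StrictMonoOn (fun s => U (t, s)) (Icc (-r) r))
    (hneg : ∀ t ∈ Icc (0:ℝ) 1, U (t, -r) ≤ 0) (hpos : ∀ t ∈ Icc (0:ℝ) 1, 0 ≤ U (t, r)) :
    IsPreconnected ((Icc 0 1 ×ˢ Icc (-r) r) ∩ U ⁻¹' {0}) := by
  set C : Set (ℝ × ℝ) := (Icc 0 1 ×ˢ Icc (-r) r) ∩ U ⁻¹' {0} with hC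
  have hCc : IsCompact C := (isCompact_Icc.prod isCompact_Icc).of_isClosed_subset
    (hU.preimage_isClosed_of_isClosed (isClosed_Icc.prod isClosed_Icc) isClosed_singleton)
    inter_subset_left
  have : CompactSpace C := isCompact_iff_compactSpace.1 hCc
  let π : C → ℝ := fun p => p.1.1
  have hπ : Continuous π := continuous_fst.comp continuous_subtype_val
  have hinj : Function.Injective π := by
    rintro ⟨⟨t, s⟩, ⟨h1, h2⟩, h3⟩ ⟨⟨t', s'⟩, ⟨h1', h2'⟩, h3'⟩ h
    change t = t' at h
    subst h
    have : s = s' := (hmono t h1).injOn h2 h2' (by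
      change U (t, s) = U (t, s')
      rw [show U (t, s) = 0 from h3, show U (t, s') = 0 from h3'])
    subst this
    rfl
  have hrange : Icc (0:ℝ) 1 ⊆ range π := by
    intro t ht
    have hc : ContinuousOn (fun s => U (t, s)) (Icc (-r) r) :=
      hU.comp (by fun_prop) fun s hs => ⟨ht, hs⟩
    obtain ⟨s, hs, hs0⟩ := intermediate_value_Icc (by linarith) hc ⟨hneg t ht, hpos t ht⟩
    exact ⟨⟨(t, s), ⟨ht, hs⟩, hs0⟩, rfl⟩
  have := isPreconnected_Icc.preimage_of_isClosedMap hinj hπ.isClosedMap hrange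
  have huniv : π ⁻¹' Icc 0 1 = univ := eq_univ_of_forall fun p => p.2.1.1
  rw [huniv] at this
  have := this.image _ continuous_subtype_val.continuousOn
  simpa using this

namespace LayerSol

variable {n : ℕ} {f f' : ℝ → ℝ} {K b κ R : ℝ} {u : Euc n → ℝ} {g : Euc n → Euc n}
  {S : Euc n → Euc n →L[ℝ] Euc n}

theorem stableField (h : LayerSol f f' b κ R u g S) (hf : Nonlinearity f f' K) (e : Euc n) :
    StableField K R (fun z => f' (u z)) (fun z => ⟪g z, e⟫) (fun z => S z e) where
  contV := h.continuousOn_potential hf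
  boundV z hz := hf.bound _ (h.range z hz)
  grad z hz := by
    rw [hasGradientAt_iff_hasFDerivAt]
    have := (innerSL ℝ e).hasFDerivAt.comp z (h.hess z hz)
    refine (this.congr_of_eventuallyEq (Eventually.of_forall fun y => ?_)).congr_fderiv ?_
    · simp [real_inner_comm]
    · ext v
      simp [h.symm z hz]
  cont := h.cont.clm_apply continuousOn_const
  weak η hη hc hs := h.linearized hf hη hc hs e
  stable η hη hc hs := h.stable_one hf hη hc hs

theorem norm_hess_apply_le (h : LayerSol f f' b κ R u g S) {z : Euc n} (hz : z ∈ ball 0 R)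
    (hu : |u z| ≤ 1 - b) (q : Euc n) :
    ‖S z q‖ ≤ |f (u z)| * |⟪‖g z‖⁻¹ • g z, q⟫| + κ * ‖g z‖ * ‖q‖ := by
  have hg := norm_pos_iff.2 (h.pos z hz hu)
  have h1 := h.curv z hz hu q
  have h2 : ‖(f (u z) * ⟪g z, q⟫ / ‖g z‖ ^ 2) • g z‖ = |f (u z)| * |⟪‖g z‖⁻¹ • g z, q⟫| := by
    rw [norm_smul, inner_smul_left, Real.norm_eq_abs, abs_div, abs_mul, abs_mul]
    simp only [conj_trivial, abs_inv, abs_norm, abs_pow]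
    field_simp
  rw [← h2]
  calc ‖S z q‖ = ‖(f (u z) * ⟪g z, q⟫ / ‖g z‖ ^ 2) • g z
        + (S z q - (f (u z) * ⟪g z, q⟫ / ‖g z‖ ^ 2) • g z)‖ := by congr 1; abel
    _ ≤ _ := (norm_add_le _ _).trans (by gcongr)

theorem hasDerivAt_normal (h : LayerSol f f' b κ R u g S) {z v : Euc n} {t : ℝ}
    (hz : z + t • v ∈ ball (0 : Euc n) R) (hu : |u (z + t • v)| ≤ 1 - b) :
    ∃ N : Euc n, HasDerivAt (fun s : ℝ => ‖g (z + s • v)‖⁻¹ • g (z + s • v)) N t ∧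
      ‖N‖ ≤ 2 * κ * ‖v‖ := by
  have hg0 := h.pos _ hz hu
  have hg := norm_pos_iff.2 hg0
  have h1 := h.hasDerivAt_line_grad hz
  have h2 : HasDerivAt (fun s : ℝ => ‖g (z + s • v)‖)
      (⟪g (z + t • v), S (z + t • v) v⟫ / ‖g (z + t • v)‖) t := by
    have h3 := (h1.norm_sq.sqrt (by positivity))
    simp only [Real.sqrt_sq (norm_nonneg _)] at h3
    refine h3.congr_deriv ?_
    field_simp
  have h4 := (h2.fun_inv hg.ne').fun_smul h1
  refine ⟨_, h4, ?_⟩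
  have hc := h.curv _ hz hu v
  set G := g (z + t • v)
  set X := S (z + t • v) v
  set a := f (u (z + t • v)) * ⟪G, v⟫ / ‖G‖ ^ 2
  set E := X - a • G with hE
  have hX : X = a • G + E := by rw [hE]; abel
  have hN : ‖G‖⁻¹ • X + (-(⟪G, X⟫ / ‖G‖) / ‖G‖ ^ 2) • G =
      ‖G‖⁻¹ • E - (⟪G, E⟫ / ‖G‖ ^ 3) • G := by
    rw [hX, inner_add_right, inner_smul_right, real_inner_self_eq_norm_sq]
    have : -((a * ‖G‖ ^ 2 + ⟪G, E⟫) / ‖G‖) / ‖G‖ ^ 2 = -(‖G‖⁻¹ * a) - ⟪G, E⟫ / ‖G‖ ^ 3 := by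
      field_simp
      ring
    rw [this, smul_add, sub_smul, neg_smul, smul_smul]
    abel
  rw [hN]
  have e1 : ‖‖G‖⁻¹ • E‖ ≤ κ * ‖v‖ := by
    rw [norm_smul, norm_inv, norm_norm]
    rw [inv_mul_le_iff₀ hg]
    linarith
  have e2 : ‖(⟪G, E⟫ / ‖G‖ ^ 3) • G‖ ≤ κ * ‖v‖ := by
    rw [norm_smul, Real.norm_eq_abs, abs_div, abs_of_pos (pow_pos hg 3)]
    have : |⟪G, E⟫| ≤ ‖G‖ * ‖E‖ := abs_real_inner_le_norm _ _
    calc _ ≤ ‖G‖ * ‖E‖ / ‖G‖ ^ 3 * ‖G‖ := by gcongr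
      _ = ‖G‖⁻¹ * ‖E‖ := by field_simp
      _ ≤ _ := by rw [inv_mul_le_iff₀ hg]; linarith
  calc _ ≤ _ := norm_sub_le _ _
    _ ≤ _ := by linarith

/-- The normal direction is almost constant along segments contained in `{|u| ≤ 1 - b}`. -/
theorem norm_normal_sub_le (h : LayerSol f f' b κ R u g S) {z q : Euc n} {t : ℝ} (ht : 0 ≤ t)
    (hz : ∀ s ∈ Icc 0 t, z + s • q ∈ ball (0 : Euc n) R)
    (hu : ∀ s ∈ Icc 0 t, |u (z + s • q)| ≤ 1 - b) :
    ‖‖g (z + t • q)‖⁻¹ • g (z + t • q) - ‖g z‖⁻¹ • g z‖ ≤ 2 * κ * ‖q‖ * t := by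
  choose! N hN using fun s (hs : s ∈ Icc 0 t) => h.hasDerivAt_normal (hz s hs) (hu s hs)
  have := norm_image_sub_le_of_norm_deriv_le_segment' (f := fun s : ℝ =>
    ‖g (z + s • q)‖⁻¹ • g (z + s • q)) (f' := N) (C := 2 * κ * ‖q‖) (a := 0) (b := t)
    (fun s hs => (hN s hs).1.hasDerivWithinAt) (fun s hs => (hN s ⟨hs.1, hs.2.le⟩).2) t
    ⟨ht, le_rfl⟩
  simpa using this

end LayerSol

theorem inner_eq_norm_mul_inner_normal {n : ℕ} (x q : Euc n) :
    ⟪x, q⟫ = ‖x‖ * ⟪‖x‖⁻¹ • x, q⟫ := by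
  rcases eq_or_ne x 0 with rfl | hx
  · simp
  · rw [inner_smul_left, conj_trivial, mul_inv_cancel_left₀ (norm_ne_zero_iff.2 hx)]

theorem norm_normal {n : ℕ} {x : Euc n} (hx : x ≠ 0) : ‖‖x‖⁻¹ • x‖ = 1 := by
  rw [norm_smul, norm_inv, norm_norm, inv_mul_cancel₀ (norm_ne_zero_iff.2 hx)]

theorem abs_inner_le_of_near {n : ℕ} {x e q : Euc n} {r θ ρ : ℝ} (hx : ‖x - e‖ ≤ θ)
    (hr : |⟪e, q⟫| ≤ r) (hq : ‖q‖ ≤ ρ) : |⟪x, q⟫| ≤ r + θ * ρ := by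
  have hθ : 0 ≤ θ := (norm_nonneg _).trans hx
  have h1 : ⟪x, q⟫ = ⟪e, q⟫ + ⟪x - e, q⟫ := by rw [inner_sub_left]; ring
  rw [h1]
  refine (abs_add_le _ _).trans (add_le_add hr ((abs_real_inner_le_norm _ _).trans ?_))
  exact mul_le_mul hx hq (norm_nonneg _) hθ

theorem segment_mem_ball {n : ℕ} {R : ℝ} {z q : Euc n} (hz : z ∈ ball (0 : Euc n) R)
    (hzq : z + q ∈ ball (0 : Euc n) R) {t : ℝ} (ht : t ∈ Icc (0:ℝ) 1) :
    z + t • q ∈ ball (0 : Euc n) R :=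
  (convex_ball _ _).add_smul_mem hz hzq ht

namespace LayerSol

variable {n : ℕ} {f f' : ℝ → ℝ} {K b κ R : ℝ} {u : Euc n → ℝ} {g : Euc n → Euc n}
  {S : Euc n → Euc n →L[ℝ] Euc n}

/-- Near a zero, `u` stays in the transition region along flat slabs orthogonal to the normal. -/
theorem tube (h : LayerSol f f' b κ R u g S) (hκ : 0 ≤ κ) {P R' : ℝ} (hP0 : 0 ≤ P) (hR' : R' ≤ R)
    (hP : ∀ z ∈ ball (0 : Euc n) R', ‖g z‖ ≤ P) {z q e : Euc n} (hz : z ∈ ball (0 : Euc n) R')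
    (hzq : z + q ∈ ball (0 : Euc n) R') (hu : u z = 0) {θ r ρ : ℝ}
    (hθ : ‖‖g z‖⁻¹ • g z - e‖ ≤ θ) (hr : |⟪e, q⟫| ≤ r) (hq : ‖q‖ ≤ ρ)
    (hsm : P * (r + (θ + 2 * κ * ρ) * ρ) < 1 - b) :
    ∀ t ∈ Icc (0:ℝ) 1, |u (z + t • q)| ≤ 1 - b ∧
      ‖‖g (z + t • q)‖⁻¹ • g (z + t • q) - e‖ ≤ θ + 2 * κ * ρ := by
  have hin : ∀ t ∈ Icc (0:ℝ) 1, z + t • q ∈ ball (0 : Euc n) R' := fun t ht =>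
    segment_mem_ball hz hzq ht
  have hinR : ∀ t ∈ Icc (0:ℝ) 1, z + t • q ∈ ball (0 : Euc n) R := fun t ht =>
    ball_subset_ball hR' (hin t ht)
  have hρ0 : 0 ≤ ρ := (norm_nonneg _).trans hq
  have hθ0 : 0 ≤ θ := (norm_nonneg _).trans hθ
  have hr0 : 0 ≤ r := (abs_nonneg _).trans hr
  have hν : ∀ t ∈ Icc (0:ℝ) 1, (∀ s ∈ Icc 0 t, |u (z + s • q)| ≤ 1 - b) →
      ‖‖g (z + t • q)‖⁻¹ • g (z + t • q) - e‖ ≤ θ + 2 * κ * ρ := by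
    intro t ht hs
    have h1 := h.norm_normal_sub_le ht.1 (fun s hs => hinR s ⟨hs.1, hs.2.trans ht.2⟩) hs
    have h2 : 2 * κ * ‖q‖ * t ≤ 2 * κ * ρ := by
      calc 2 * κ * ‖q‖ * t ≤ 2 * κ * ρ * 1 := by
            have := ht.2
            have := ht.1
            gcongr
        _ = _ := mul_one _
    calc _ = ‖(‖g (z + t • q)‖⁻¹ • g (z + t • q) - ‖g z‖⁻¹ • g z) + (‖g z‖⁻¹ • g z - e)‖ := by
          congr 1; abel
      _ ≤ _ := (norm_add_le _ _).trans (by linarith)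
  have hub : ∀ t ∈ Icc (0:ℝ) 1, |u (z + t • q)| ≤ P * (r + (θ + 2 * κ * ρ) * ρ) := by
    refine abs_le_of_bootstrap (fun t ht =>
      (h.hasDerivAt_line (hinR t ht)).continuousAt.continuousWithinAt) hsm fun t ht hs => ?_
    have := norm_image_sub_le_of_norm_deriv_le_segment' (f := fun s : ℝ => u (z + s • q))
      (f' := fun s => ⟪g (z + s • q), q⟫) (C := P * (r + (θ + 2 * κ * ρ) * ρ)) (a := 0) (b := t)
      (fun s hs => (h.hasDerivAt_line (hinR s ⟨hs.1, hs.2.trans ht.2⟩)).hasDerivWithinAt)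
      (fun s hs' => ?_) t ⟨ht.1, le_rfl⟩
    · simp only [zero_smul, add_zero, hu, sub_zero, Real.norm_eq_abs] at this
      refine this.trans (mul_le_of_le_one_right (by positivity) ht.2)
    · have hs1 : s ∈ Icc (0:ℝ) 1 := ⟨hs'.1, hs'.2.le.trans ht.2⟩
      have := hν s hs1 fun s2 hs2 => hs s2 ⟨hs2.1, hs2.2.trans_lt hs'.2⟩
      rw [inner_eq_norm_mul_inner_normal, norm_mul, norm_norm, Real.norm_eq_abs]
      exact mul_le_mul (hP _ (hin s hs1)) (abs_inner_le_of_near this hr hq) (abs_nonneg _) hP0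
  have hub' : ∀ t ∈ Icc (0:ℝ) 1, |u (z + t • q)| ≤ 1 - b := fun t ht => (hub t ht).trans hsm.le
  exact fun t ht => ⟨hub' t ht, hν t ht fun s hs => hub' s ⟨hs.1, hs.2.trans ht.2⟩⟩

theorem le_inner_grad (h : LayerSol f f' b κ R u g S) (hf : Nonlinearity f f' K) (hκ : 0 ≤ κ)
    {P R' : ℝ} (hP0 : 0 ≤ P) (hR' : R' ≤ R)
    (hP : ∀ z ∈ ball (0 : Euc n) R', ‖g z‖ ≤ P) {q e : Euc n} (h0 : (0 : Euc n) ∈ ball (0 : Euc n) R')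
    (hq' : q ∈ ball (0 : Euc n) R') (hu : u 0 = 0) {r ρ c : ℝ} (he : ‖g 0‖⁻¹ • g 0 = e)
    (hen : ‖e‖ = 1) (hr : |⟪e, q⟫| ≤ r) (hq : ‖q‖ ≤ ρ)
    (hsm : P * (r + (2 * κ * ρ) * ρ) < 1 - b)
    (hc : K * (r + (2 * κ * ρ) * ρ) + κ * P * ρ ≤ c) : ‖g 0‖ - c ≤ ⟪g q, e⟫ := by
  have hρ0 : 0 ≤ ρ := (norm_nonneg _).trans hq
  have hr0 : 0 ≤ r := (abs_nonneg _).trans hr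
  have ht := h.tube hκ hP0 hR' hP h0 (by rwa [zero_add]) hu (e := e) (θ := 0) (by simp [he]) hr hq
    (by rwa [zero_add])
  have hin : ∀ t ∈ Icc (0:ℝ) 1, (0 : Euc n) + t • q ∈ ball (0 : Euc n) R' := fun t ht =>
    segment_mem_ball h0 (by rwa [zero_add]) ht
  have hinR := fun t ht => ball_subset_ball hR' (hin t ht)
  have := norm_image_sub_le_of_norm_deriv_le_segment' (f := fun s : ℝ => ⟪g (0 + s • q), e⟫)
      (f' := fun s => ⟪S (0 + s • q) q, e⟫) (C := c) (a := 0) (b := 1)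
      (fun s hs => (h.hasDerivAt_line_inner e (hinR s hs)).hasDerivWithinAt)
      (fun s hs' => ?_) 1 ⟨zero_le_one, le_rfl⟩
  · simp only [zero_smul, one_smul, zero_add, sub_zero, Real.norm_eq_abs, mul_one] at this
    have h1 : ⟪g 0, e⟫ = ‖g 0‖ := by
      rw [inner_eq_norm_mul_inner_normal, he, real_inner_self_eq_norm_sq, hen]; ring
    rw [h1] at this
    linarith [(abs_le.1 this).1]
  · have hs1 : s ∈ Icc (0:ℝ) 1 := ⟨hs'.1, hs'.2.le⟩
    obtain ⟨h1, h2⟩ := ht s hs1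
    rw [zero_add (2 * κ * ρ)] at h2
    have h3 := abs_inner_le_of_near h2 hr hq
    refine (norm_inner_le_norm _ _).trans ?_
    rw [hen, mul_one]
    refine (h.norm_hess_apply_le (hinR s hs1) h1 q).trans (le_trans (add_le_add ?_ ?_) hc)
    · exact mul_le_mul (hf.apply_abs_le (h.range _ (hinR s hs1))) h3 (abs_nonneg _) hf.nonneg
    · exact mul_le_mul (mul_le_mul_of_nonneg_left (hP _ (hin s hs1)) hκ) hq (norm_nonneg _)
        (by positivity)

/-- If the gradient at a zero is tiny, then a whole ball lies in the transition region. -/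
theorem abs_le_of_norm_grad_le (h : LayerSol f f' b κ R u g S) (hf : Nonlinearity f f' K)
    (hκ1 : κ ≤ 1) {ρ c : ℝ} (hb : b < 1) (hu : u 0 = 0) (hg : ‖g 0‖ ≤ c)
    (hc : c * Real.exp ((K + 2) * ρ) ≤ (1 - b) / 2) {q : Euc n} (hq : q ∈ ball (0 : Euc n) R)
    (hqρ : ‖q‖ ≤ ρ) : ∀ t ∈ Icc (0:ℝ) 1, |u (t • q)| ≤ 1 - b := by
  have h0 : (0 : Euc n) ∈ ball (0 : Euc n) R := by
    simp only [mem_ball, dist_self]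
    exact pos_of_mem_ball hq
  have hin : ∀ t ∈ Icc (0:ℝ) 1, (0 : Euc n) + t • q ∈ ball (0 : Euc n) R := fun t ht =>
    segment_mem_ball h0 (by rwa [zero_add]) ht
  have hK := hf.nonneg
  have hρ0 : 0 ≤ ρ := (norm_nonneg _).trans hqρ
  have hc0 : 0 ≤ c := (norm_nonneg _).trans hg
  have key : ∀ t ∈ Icc (0:ℝ) 1, |u (0 + t • q)| ≤ (1 - b) / 2 := by
    refine abs_le_of_bootstrap (c := 1 - b) (fun t ht =>
      (h.hasDerivAt_line (hin t ht)).continuousAt.continuousWithinAt) (by linarith)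
      fun t ht hs => ?_
    have hd : ∀ s ∈ Icc (0:ℝ) t, HasDerivAt (fun s : ℝ => (u (0 + s • q), g (0 + s • q)))
        (⟪g (0 + s • q), q⟫, S (0 + s • q) q) s := fun s hs =>
      (h.hasDerivAt_line (hin s ⟨hs.1, hs.2.trans ht.2⟩)).prodMk
        (h.hasDerivAt_line_grad (hin s ⟨hs.1, hs.2.trans ht.2⟩))
    have := norm_le_gronwallBound_of_norm_deriv_right_le (δ := c) (K := (K + 2) * ρ) (ε := 0)
      (fun s hs => (hd s hs).continuousAt.continuousWithinAt)
      (fun s hs => (hd s ⟨hs.1, hs.2.le⟩).hasDerivWithinAt) ?_ ?_ t ⟨ht.1, le_rfl⟩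
    · rw [gronwallBound_ε0, sub_zero] at this
      calc |u (0 + t • q)| ≤ ‖(u (0 + t • q), g (0 + t • q))‖ := by
            rw [← Real.norm_eq_abs]; exact norm_fst_le (u (0 + t • q), g (0 + t • q))
        _ ≤ c * Real.exp ((K + 2) * ρ * t) := this
        _ ≤ c * Real.exp ((K + 2) * ρ) := by
            have : (K + 2) * ρ * t ≤ (K + 2) * ρ := mul_le_of_le_one_right (by positivity) ht.2
            gcongr
        _ ≤ _ := hc
    · simp [hu, hg, Prod.norm_def]
    · intro s hs'
      have hs1 : s ∈ Icc (0:ℝ) 1 := ⟨hs'.1, hs'.2.le.trans ht.2⟩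
      have hus := hs s hs'
      have hz := hin s hs1
      set z := (0 : Euc n) + s • q
      have hn1 : ‖u z‖ ≤ ‖(u z, g z)‖ := norm_fst_le (u z, g z)
      have hn2 : ‖g z‖ ≤ ‖(u z, g z)‖ := norm_snd_le (u z, g z)
      have hν := norm_normal (h.pos z hz hus)
      rw [add_zero, Prod.norm_def]
      set X := ‖(u z, g z)‖
      have hX : 0 ≤ X := norm_nonneg _
      refine max_le ?_ ?_
      · calc _ ≤ ‖g z‖ * ‖q‖ := norm_inner_le_norm _ _
          _ ≤ X * ρ := by gcongr
          _ = 1 * ρ * X := by ring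
          _ ≤ (K + 2) * ρ * X := by gcongr; linarith
      · refine (h.norm_hess_apply_le hz hus q).trans ?_
        have i1 : |⟪‖g z‖⁻¹ • g z, q⟫| ≤ ρ := by
          refine (abs_real_inner_le_norm _ _).trans ?_
          rw [hν, one_mul]; exact hqρ
        have i2 : |f (u z)| ≤ K * X := (hf.growth _ (h.range z hz)).trans (by
          rw [← Real.norm_eq_abs]; gcongr)
        calc _ ≤ K * X * ρ + 1 * X * ρ := by gcongr
          _ = (K + 1) * ρ * X := by ring
          _ ≤ (K + 2) * ρ * X := by gcongr; linarith
  intro t ht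
  have := key t ht
  rw [zero_add] at this
  linarith

/-- Zeros in a cylinder foliated by almost flat level sets lie in one connected component. -/
theorem exists_isPreconnected_of_cylinder (h : LayerSol f f' b κ R u g S) {e y : Euc n}
    {r L θ : ℝ} (hr : 0 < r) (hL : 0 ≤ L) (hθ : θ < 1) (hθr : θ * (L + r) ≤ r / 2) (he : ‖e‖ = 1)
    (hcyl : ∀ w : Euc n, ∀ s : ℝ, ⟪w, e⟫ = 0 → ‖w‖ ≤ L → |s| ≤ r → w + s • e ∈ ball (0 : Euc n) R ∧
      |u (w + s • e)| ≤ 1 - b ∧ ‖‖g (w + s • e)‖⁻¹ • g (w + s • e) - e‖ ≤ θ)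
    (h0 : u 0 = 0) :
    (∀ w : Euc n, ⟪w, e⟫ = 0 → ‖w‖ ≤ L → 0 < u (w + r • e) ∧ u (w + (-r) • e) < 0) ∧
    (u y = 0 → ‖y - ⟪y, e⟫ • e‖ ≤ L → |⟪y, e⟫| ≤ r →
      ∃ C : Set (Euc n), IsPreconnected C ∧ C ⊆ {z | u z = 0} ∧ 0 ∈ C ∧ y ∈ C) := by
  have hee : ⟪e, e⟫ = 1 := by rw [real_inner_self_eq_norm_sq, he]; norm_num
  have hθ0 : 0 ≤ θ := (norm_nonneg _).trans (hcyl 0 0 (by simp) (by simpa using hL)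
    (by simpa using hr.le)).2.2
  have hsign : ∀ w : Euc n, ⟪w, e⟫ = 0 → ‖w‖ ≤ L → ∀ σ : ℝ, |σ| = 1 →
      0 < σ * u (w + (σ * r) • e) := by
    intro w hwe hw σ hσ
    have hσ2 : σ * σ = 1 := by rw [← abs_mul_abs_self, hσ, one_mul]
    set q := w + (σ * r) • e with hq
    have hpt : ∀ t : ℝ, (0 : Euc n) + t • q = t • w + (t * (σ * r)) • e := fun t => by
      rw [zero_add, hq, smul_add, smul_smul]
    have hin : ∀ t ∈ Icc (0:ℝ) 1, (0 : Euc n) + t • q ∈ ball (0 : Euc n) R ∧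
        |u (0 + t • q)| ≤ 1 - b ∧ ‖‖g (0 + t • q)‖⁻¹ • g (0 + t • q) - e‖ ≤ θ := by
      intro t ht
      rw [hpt]
      refine hcyl _ _ (by rw [inner_smul_left, hwe, mul_zero]) ?_ ?_
      · rw [norm_smul, Real.norm_of_nonneg ht.1]
        exact (mul_le_of_le_one_left (norm_nonneg _) ht.2).trans hw
      · rw [abs_mul, abs_mul, hσ, one_mul, abs_of_nonneg ht.1, abs_of_pos hr]
        exact mul_le_of_le_one_left hr.le ht.2
    have hqn : ‖q‖ ≤ L + r := by
      refine (norm_add_le _ _).trans (add_le_add hw ?_)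
      rw [norm_smul, he, Real.norm_eq_abs, abs_mul, hσ, one_mul, mul_one, abs_of_pos hr]
    have hmono : StrictMonoOn (fun t : ℝ => σ * u (0 + t • q)) (Icc 0 1) := by
      refine strictMonoOn_of_deriv_pos (convex_Icc _ _) (fun t ht =>
        ((h.hasDerivAt_line (hin t ht).1).const_mul σ).continuousAt.continuousWithinAt)
        fun t ht => ?_
      rw [interior_Icc] at ht
      have ht' := Ioo_subset_Icc_self ht
      obtain ⟨i1, i2, i3⟩ := hin t ht'
      rw [((h.hasDerivAt_line i1).const_mul σ).deriv, inner_eq_norm_mul_inner_normal]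
      have hg := norm_pos_iff.2 (h.pos _ i1 i2)
      set ν := ‖g (0 + t • q)‖⁻¹ • g (0 + t • q)
      have j1 : ⟪ν, q⟫ = σ * r + ⟪ν - e, q⟫ := by
        have : ⟪e, q⟫ = σ * r := by
          rw [hq, inner_add_right, inner_smul_right, real_inner_comm, hwe, hee]; ring
        rw [inner_sub_left, this]; ring
      have j2 : |⟪ν - e, q⟫| ≤ r / 2 := by
        refine (abs_real_inner_le_norm _ _).trans (le_trans ?_ hθr)
        exact mul_le_mul i3 hqn (norm_nonneg _) hθ0
      have j3 : |σ * ⟪ν - e, q⟫| ≤ r / 2 := by rwa [abs_mul, hσ, one_mul]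
      have : 0 < σ * ⟪ν, q⟫ := by
        rw [j1, mul_add, ← mul_assoc, hσ2]
        linarith [(abs_le.1 j3).1]
      calc 0 < ‖g (0 + t • q)‖ * (σ * ⟪ν, q⟫) := by positivity
        _ = _ := by ring
    have := hmono (left_mem_Icc.2 zero_le_one) (right_mem_Icc.2 zero_le_one) zero_lt_one
    simpa [h0] using this
  refine ⟨fun w hwe hw => ⟨by simpa using hsign w hwe hw 1 (by simp), ?_⟩, fun hy hyL hyr => ?_⟩
  · have := hsign w hwe hw (-1) (by simp)
    rw [neg_one_mul] at this
    simpa using this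
  set w := y - ⟪y, e⟫ • e with hw
  have hwe : ⟪w, e⟫ = 0 := by rw [hw, inner_sub_left, inner_smul_left, hee]; simp
  have htw : ∀ t ∈ Icc (0:ℝ) 1, ⟪t • w, e⟫ = 0 ∧ ‖t • w‖ ≤ L := fun t ht => by
    refine ⟨by rw [inner_smul_left, hwe, mul_zero], ?_⟩
    rw [norm_smul, Real.norm_of_nonneg ht.1]
    exact (mul_le_of_le_one_left (norm_nonneg _) ht.2).trans hyL
  have hpre := isPreconnected_zeros_of_strictMonoOn (U := fun p => u (p.1 • w + p.2 • e)) hr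
    ?_ ?_ ?_ ?_
  · have hcont : Continuous fun p : ℝ × ℝ => p.1 • w + p.2 • e := by fun_prop
    refine ⟨_, hpre.image _ hcont.continuousOn, ?_, ⟨(0, 0), ?_, by simp⟩,
      ⟨(1, ⟪y, e⟫), ?_, by simp [hw]⟩⟩
    · rintro _ ⟨p, hp, rfl⟩
      exact hp.2
    · exact ⟨⟨by simp, by simp [hr.le]⟩, by simp [h0]⟩
    · exact ⟨⟨by simp, abs_le.1 hyr⟩, by simp [hw, hy]⟩
  · rintro ⟨t, s⟩ ⟨ht, hs⟩
    have := (hcyl (t • w) s (htw t ht).1 (htw t ht).2 (abs_le.2 hs)).1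
    have hc : ContinuousAt (fun p : ℝ × ℝ => p.1 • w + p.2 • e) (t, s) := by fun_prop
    exact (ContinuousAt.comp (f := fun p : ℝ × ℝ => p.1 • w + p.2 • e) (g := u)
      (h.grad _ this).continuousAt hc).continuousWithinAt
  · intro t ht
    have hc := fun s hs => hcyl (t • w) s (htw t ht).1 (htw t ht).2 (abs_le.2 hs)
    refine strictMonoOn_of_deriv_pos (convex_Icc _ _) (fun s hs =>
        (h.hasDerivAt_line (hc s hs).1).continuousAt.continuousWithinAt) fun s hs => ?_
    rw [interior_Icc] at hs
    obtain ⟨i1, i2, i3⟩ := hc s (Ioo_subset_Icc_self hs)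
    rw [(h.hasDerivAt_line i1).deriv, inner_eq_norm_mul_inner_normal]
    have hg := norm_pos_iff.2 (h.pos _ i1 i2)
    set ν := ‖g (t • w + s • e)‖⁻¹ • g (t • w + s • e)
    have j1 : ⟪ν, e⟫ = 1 + ⟪ν - e, e⟫ := by rw [inner_sub_left, hee]; ring
    have j2 : |⟪ν - e, e⟫| ≤ θ := by
      refine (abs_real_inner_le_norm _ _).trans ?_
      rw [he, mul_one]; exact i3
    have : 0 < ⟪ν, e⟫ := by rw [j1]; linarith [(abs_le.1 j2).1]
    positivity
  · intro t ht
    have := hsign _ (htw t ht).1 (htw t ht).2 (-1) (by simp)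
    rw [neg_one_mul, neg_one_mul] at this
    simpa using this.le
  · intro t ht
    simpa using (hsign _ (htw t ht).1 (htw t ht).2 1 (by simp)).le

end LayerSol

theorem norm_sub_proj_sq {n : ℕ} {e : Euc n} (he : ‖e‖ = 1) (y : Euc n) :
    ‖y - ⟪y, e⟫ • e‖ ^ 2 = ‖y‖ ^ 2 - ⟪y, e⟫ ^ 2 := by
  rw [norm_sub_sq_real, norm_smul, inner_smul_right, he, Real.norm_eq_abs, mul_one, sq_abs]
  ring

theorem inner_sub_proj {n : ℕ} {e : Euc n} (he : ‖e‖ = 1) (y : Euc n) :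
    ⟪y - ⟪y, e⟫ • e, e⟫ = 0 := by
  rw [inner_sub_left, inner_smul_left, real_inner_self_eq_norm_sq, he]
  simp

theorem norm_add_smul_sq_of_inner_eq_zero {n : ℕ} {e w : Euc n} (he : ‖e‖ = 1) (hw : ⟪w, e⟫ = 0)
    (s : ℝ) : ‖w + s • e‖ ^ 2 = ‖w‖ ^ 2 + s ^ 2 := by
  rw [norm_add_sq_real, norm_smul, inner_smul_right, hw, he, Real.norm_eq_abs, mul_one, sq_abs]
  ring

namespace LayerSol

variable {n : ℕ} {f f' : ℝ → ℝ} {K b κ R : ℝ} {u : Euc n → ℝ} {g : Euc n → Euc n}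
  {S : Euc n → Euc n →L[ℝ] Euc n}

theorem exists_isPreconnected_of_norm_grad_le (h : LayerSol f f' b κ R u g S)
    (hf : Nonlinearity f f' K) (hκ : 0 ≤ κ) (hκ1 : κ ≤ 1) {L c : ℝ} (hb : b < 1) (hL : 0 < L)
    (hu : u 0 = 0) (hg : ‖g 0‖ ≤ c) (hc : c * Real.exp ((K + 2) * (2 * L)) ≤ (1 - b) / 2)
    (hR : 2 * L < R) (hκL : 16 * (κ * L) ≤ 1) {y : Euc n} (hy : u y = 0) (hyL : ‖y‖ ≤ L) :
    ∃ C : Set (Euc n), IsPreconnected C ∧ C ⊆ {z | u z = 0} ∧ 0 ∈ C ∧ y ∈ C := by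
  have h0R : (0 : Euc n) ∈ ball (0 : Euc n) R := by simp; linarith
  have hg0 := h.pos 0 h0R (by rw [hu, abs_zero]; linarith)
  set e := ‖g 0‖⁻¹ • g 0 with he
  have hen : ‖e‖ = 1 := norm_normal hg0
  have hye : |⟪y, e⟫| ≤ L := by
    refine (abs_real_inner_le_norm _ _).trans ?_
    rw [hen, mul_one]; exact hyL
  have hyw : ‖y - ⟪y, e⟫ • e‖ ≤ L := by
    refine le_trans ?_ hyL
    rw [← sq_le_sq₀ (norm_nonneg _) (norm_nonneg _), norm_sub_proj_sq hen]
    nlinarith [sq_nonneg ⟪y, e⟫]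
  refine (h.exists_isPreconnected_of_cylinder (θ := 2 * κ * (2 * L)) hL hL.le (by linarith)
    (by nlinarith) hen (fun w s hwe hw hs => ?_) hu).2 hy hyw hye
  have hq : ‖w + s • e‖ ≤ 2 * L := by
    refine (norm_add_le _ _).trans ?_
    rw [norm_smul, hen, Real.norm_eq_abs]
    linarith
  have hqR : w + s • e ∈ ball (0 : Euc n) R := by
    rw [mem_ball_zero_iff]; linarith
  have key := h.abs_le_of_norm_grad_le hf hκ1 hb hu hg hc hqR hq
  have hν := h.norm_normal_sub_le (z := 0) (q := w + s • e) zero_le_one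
    (fun t ht => segment_mem_ball h0R (by rwa [zero_add]) ht)
    (fun t ht => by rw [zero_add]; exact key t ht)
  rw [one_smul, zero_add, mul_one] at hν
  refine ⟨hqR, by simpa using key 1 (by simp), hν.trans ?_⟩
  gcongr

theorem exists_isPreconnected_or_reversed_zero (h : LayerSol f f' b κ R u g S) (hκ : 0 ≤ κ)
    {P R' : ℝ} (hP0 : 0 ≤ P) (hR' : R' ≤ R) (hP : ∀ z ∈ ball (0 : Euc n) R', ‖g z‖ ≤ P)
    {L r ρ : ℝ} (hL : 0 < L) (hr : 0 < r) (hρ : L + r ≤ ρ) (hρR : ρ < R')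
    (hsm : P * (r + (2 * κ * ρ) * ρ) < 1 - b) (hκr : 2 * κ * ρ * (L + r) ≤ r / 2)
    (hκρ : 2 * κ * ρ < 1) (hu : u 0 = 0) {e : Euc n} (he : ‖g 0‖⁻¹ • g 0 = e) (hen : ‖e‖ = 1)
    {y : Euc n} (hy : u y = 0) (hyL : ‖y‖ ≤ L) :
    (∃ C : Set (Euc n), IsPreconnected C ∧ C ⊆ {z | u z = 0} ∧ 0 ∈ C ∧ y ∈ C) ∨
    ∃ z, u z = 0 ∧ ‖z‖ ≤ L ∧ ⟪g z, e⟫ ≤ 0 := by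
  set w := y - ⟪y, e⟫ • e with hw
  have hwe : ⟪w, e⟫ = 0 := inner_sub_proj hen y
  have hw2 : ‖w‖ ^ 2 = ‖y‖ ^ 2 - ⟪y, e⟫ ^ 2 := norm_sub_proj_sq hen y
  have hwy : ‖w‖ ≤ ‖y‖ := by
    rw [← sq_le_sq₀ (norm_nonneg _) (norm_nonneg _), hw2]
    nlinarith [sq_nonneg ⟪y, e⟫]
  have hcyl := h.exists_isPreconnected_of_cylinder (θ := 2 * κ * ρ) (y := y) hr hL.le hκρ
    hκr hen (fun w s hwe hw hs => ?_) hu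
  · by_cases hyr : |⟪y, e⟫| ≤ r
    · exact Or.inl (hcyl.2 hy (hwy.trans hyL) hyr)
    push Not at hyr
    right
    have hsgn := hcyl.1 w hwe (hwy.trans hyL)
    obtain ⟨σ, hσ, hσy, hσr⟩ : ∃ σ : ℝ, |σ| = 1 ∧ ⟪y, e⟫ = σ * |⟪y, e⟫| ∧
        0 < σ * u (w + (σ * r) • e) := by
      rcases le_total 0 ⟪y, e⟫ with hs | hs
      · exact ⟨1, by simp, by rw [abs_of_nonneg hs, one_mul], by simpa using hsgn.1⟩
      · exact ⟨-1, by simp, by rw [abs_of_nonpos hs]; ring, by simpa using hsgn.2⟩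
    have hσ2 : σ * σ = 1 := by rw [← abs_mul_abs_self, hσ, one_mul]
    have hnorm : ∀ s ∈ Icc r |⟪y, e⟫|, ‖w + s • σ • e‖ ≤ L := by
      intro s hs
      refine le_trans ?_ hyL
      rw [← sq_le_sq₀ (norm_nonneg _) (norm_nonneg _), smul_smul,
        norm_add_smul_sq_of_inner_eq_zero hen hwe, hw2, mul_pow, sq σ, hσ2, mul_one]
      have : s ^ 2 ≤ |⟪y, e⟫| ^ 2 := pow_le_pow_left₀ (hr.le.trans hs.1) hs.2 2
      rw [sq_abs] at this
      linarith
    have hin : ∀ s ∈ Icc r |⟪y, e⟫|, w + s • σ • e ∈ ball (0 : Euc n) R := fun s hs => by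
      rw [mem_ball_zero_iff]
      linarith [hnorm s hs]
    have hd : ∀ s ∈ Icc r |⟪y, e⟫|, HasDerivAt (fun s : ℝ => σ * u (w + s • σ • e))
        ⟪g (w + s • σ • e), e⟫ s := fun s hs => by
      refine ((h.hasDerivAt_line (hin s hs)).const_mul σ).congr_deriv ?_
      rw [inner_smul_right, ← mul_assoc, hσ2, one_mul]
    have hend : σ * u (w + |⟪y, e⟫| • σ • e) = 0 := by
      rw [smul_smul, mul_comm _ σ, ← hσy, hw, sub_add_cancel, hy, mul_zero]
    have hstart : 0 < σ * u (w + r • σ • e) := by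
      rw [smul_smul, mul_comm r]
      exact hσr
    obtain ⟨s, hs, hs0, hs1⟩ := exists_zero_deriv_nonpos hyr.le hd hstart hend
    have hσ0 : σ ≠ 0 := fun h0 => by rw [h0] at hσ; simp at hσ
    exact ⟨_, (mul_eq_zero.1 hs0).resolve_left hσ0, hnorm s hs, hs1⟩
  · have hq : ‖w + s • e‖ ≤ ρ := by
      refine (norm_add_le _ _).trans (le_trans ?_ hρ)
      rw [norm_smul, hen, Real.norm_eq_abs]
      linarith
    have hqR : w + s • e ∈ ball (0 : Euc n) R' := by
      rw [mem_ball_zero_iff]; linarith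
    have h0R : (0 : Euc n) ∈ ball (0 : Euc n) R' := by
      rw [mem_ball_zero_iff, norm_zero]; linarith
    have := h.tube hκ hP0 hR' hP h0R (by rwa [zero_add]) hu (e := e) (θ := 0) (r := r) (ρ := ρ)
      (by simp [he]) (by
        rw [inner_add_right, inner_smul_right, real_inner_comm, hwe, real_inner_self_eq_norm_sq,
          hen]
        simpa using hs) hq (by rwa [zero_add]) 1 (by simp)
    simp only [one_smul, zero_add] at this
    exact ⟨ball_subset_ball hR' hqR, this⟩

/-- At a zero where the normal points backwards, the normal is almost opposite: otherwise the two
tangent planes would meet at a controlled distance. -/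
theorem norm_normal_add_le (h : LayerSol f f' b κ R u g S) (hκ : 0 ≤ κ)
    {P R' : ℝ} (hP0 : 0 ≤ P) (hR' : R' ≤ R) (hP : ∀ z ∈ ball (0 : Euc n) R', ‖g z‖ ≤ P)
    {L θ ρ : ℝ} (hL : 0 < L) (hb : b < 1) (hθ : 0 < θ) (hρ : L + L / θ ≤ ρ) (hρR : ρ < R')
    (hsm : P * ((2 * κ * ρ) * ρ) < 1 - b) (hκρ : 4 * κ * ρ < 1) (hu : u 0 = 0) {e : Euc n}
    (he : ‖g 0‖⁻¹ • g 0 = e) (hen : ‖e‖ = 1)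
    {y : Euc n} (hy : u y = 0) (hyL : ‖y‖ ≤ L) (hye : ⟪g y, e⟫ ≤ 0) :
    ‖‖g y‖⁻¹ • g y + e‖ ≤ 2 * θ := by
  have hLθ : 0 < L / θ := by positivity
  have hyR' : y ∈ ball (0 : Euc n) R' := by rw [mem_ball_zero_iff]; linarith
  have hgy := h.pos y (ball_subset_ball hR' hyR') (by rw [hy, abs_zero]; linarith)
  have hgyp := norm_pos_iff.2 hgy
  set e' := ‖g y‖⁻¹ • g y with he'
  have hen' : ‖e'‖ = 1 := norm_normal hgy
  have hc0 : ⟪e, e'⟫ ≤ 0 := by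
    rw [he', inner_smul_right, real_inner_comm]
    exact mul_nonpos_of_nonneg_of_nonpos (by positivity) hye
  have hc1 : -1 ≤ ⟪e, e'⟫ := by
    have := abs_real_inner_le_norm e e'
    rw [hen, hen', one_mul] at this
    exact (abs_le.1 this).1
  have hee : ⟪e, e⟫ = 1 := by rw [real_inner_self_eq_norm_sq, hen]; norm_num
  have hee' : ⟪e', e'⟫ = 1 := by rw [real_inner_self_eq_norm_sq, hen']; norm_num
  have hcomm : ⟪e', e⟫ = ⟪e, e'⟫ := real_inner_comm _ _
  set c := ⟪e, e'⟫ with hc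
  by_cases hθc : θ ^ 2 ≤ 1 - c ^ 2
  · exfalso
    have hpos : 0 < 1 - c ^ 2 := lt_of_lt_of_le (by positivity) hθc
    set a := ⟪y, e'⟫ with ha
    have haL : |a| ≤ L := by
      refine (abs_real_inner_le_norm _ _).trans ?_
      rw [hen', mul_one]; exact hyL
    set m := (a / (1 - c ^ 2)) • (e' - c • e) with hm
    have hme : ⟪e, m⟫ = 0 := by
      rw [hm, inner_smul_right, inner_sub_right, inner_smul_right e e, hee, ← hc]; ring
    have hme' : ⟪e', m - y⟫ = 0 := by
      rw [inner_sub_right, hm, inner_smul_right, inner_sub_right, inner_smul_right e' e, hee', hcomm,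
        real_inner_comm, ← ha]
      field_simp
      ring
    have hmn : ‖m‖ ≤ L / θ := by
      have h1 : ‖e' - c • e‖ ^ 2 = 1 - c ^ 2 := by
        have := norm_sub_proj_sq hen e'
        rwa [hcomm, hen', one_pow] at this
      rw [← sq_le_sq₀ (norm_nonneg _) hLθ.le, hm, norm_smul, mul_pow, h1, Real.norm_eq_abs, sq_abs,
        div_pow, div_pow]
      calc a ^ 2 / (1 - c ^ 2) ^ 2 * (1 - c ^ 2) = a ^ 2 / (1 - c ^ 2) := by field_simp
        _ ≤ L ^ 2 / θ ^ 2 := by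
            have : a ^ 2 ≤ L ^ 2 := sq_le_sq' (abs_le.1 haL).1 (abs_le.1 haL).2
            gcongr
    have hmR : m ∈ ball (0 : Euc n) R' := by rw [mem_ball_zero_iff]; linarith
    have h0R : (0 : Euc n) ∈ ball (0 : Euc n) R' := by
      rw [mem_ball_zero_iff, norm_zero]; linarith
    have t1 := h.tube hκ hP0 hR' hP h0R (q := m) (by rwa [zero_add]) hu (e := e) (θ := 0) (r := 0) (ρ := ρ)
      (by simp [he]) (by rw [hme]; simp) (by linarith) (by simpa using hsm) 1 (by simp)
    have t2 := h.tube hκ hP0 hR' hP hyR' (q := m - y) (by rwa [add_sub_cancel]) hy (e := e')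
      (θ := 0) (r := 0) (ρ := ρ) (by simp [he']) (by rw [hme']; simp)
      ((norm_sub_le _ _).trans (by linarith)) (by simpa using hsm) 1 (by simp)
    simp only [one_smul, zero_add, add_sub_cancel] at t1 t2
    have hdist : ‖e' - e‖ ≤ 4 * κ * ρ := by
      calc ‖e' - e‖ = ‖(‖g m‖⁻¹ • g m - e) - (‖g m‖⁻¹ • g m - e')‖ := by congr 1; abel
        _ ≤ _ := (norm_sub_le _ _).trans (by linarith [t1.2, t2.2])
    have h2 : ‖e' - e‖ ^ 2 = 2 - 2 * c := by
      rw [norm_sub_sq_real, hen, hen', hcomm]; ring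
    nlinarith [norm_nonneg (e' - e)]
  · push Not at hθc
    rw [← sq_le_sq₀ (norm_nonneg _) (by positivity), norm_add_sq_real, hen, hen', hcomm]
    nlinarith

end LayerSol

namespace LayerSol

set_option maxHeartbeats 4000000 in
/-- Nearby zeros of a stable layer solution with almost flat level sets lie in one connected
component of the zero set. -/
theorem exists_isPreconnected_zeros (n : ℕ) {K b L : ℝ} (hb : b ∈ Ioo (0:ℝ) 1) (hK : 0 ≤ K)
    (hL : 0 < L) : ∃ R₀ > 0, ∃ κ₀ > 0, ∀ (f f' : ℝ → ℝ) (κ R : ℝ) (u : Euc n → ℝ)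
      (g : Euc n → Euc n) (S : Euc n → Euc n →L[ℝ] Euc n), Nonlinearity f f' K →
      LayerSol f f' b κ R u g S → 0 ≤ κ → κ ≤ κ₀ → R₀ ≤ R → u 0 = 0 → ∀ y, u y = 0 → ‖y‖ ≤ L →
      ∃ C : Set (Euc n), IsPreconnected C ∧ C ⊆ {z | u z = 0} ∧ 0 ∈ C ∧ y ∈ C := by
  obtain ⟨hb0, hb1⟩ := hb
  have h1b : 0 < 1 - b := by linarith
  obtain ⟨P, hPdef, hP1⟩ : ∃ P : ℝ, n * (K + n * 2 + 1) ≤ P ∧ 1 ≤ P :=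
    ⟨n * (K + n * 2 + 1) + 1, by linarith, by
      have : (0:ℝ) ≤ n * (K + n * 2 + 1) := by positivity
      linarith⟩
  have hP0 : 0 < P := by linarith
  obtain ⟨c, hc0, hc⟩ : ∃ c : ℝ, 0 < c ∧ c * Real.exp ((K + 2) * (2 * L)) ≤ (1 - b) / 2 :=
    ⟨(1 - b) / 2 * Real.exp (-((K + 2) * (2 * L))), by positivity, by
      rw [mul_assoc, ← Real.exp_add]; simp⟩
  obtain ⟨r, hr0, hrP, hrK⟩ : ∃ r : ℝ, 0 < r ∧ P * r ≤ (1 - b) / 4 ∧ (K + 1) * r ≤ c / 4 := by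
    refine ⟨min ((1 - b) / (4 * P)) (c / (4 * (K + 1))), by positivity, ?_, ?_⟩
    · refine (mul_le_mul_of_nonneg_left (min_le_left _ _) hP0.le).trans (le_of_eq ?_)
      field_simp
    · refine (mul_le_mul_of_nonneg_left (min_le_right _ _) (by positivity)).trans (le_of_eq ?_)
      field_simp
  obtain ⟨ρs, hρs, hslab⟩ := StableField.false_of_opposite_slabs n hK hP0.le (half_pos hc0) hr0 hL.le
  obtain ⟨ρ2, hρ2⟩ : ∃ ρ2 : ℝ, ρ2 = 2 * ρs + L + 1 := ⟨_, rfl⟩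
  have hρ21 : 1 ≤ ρ2 := by linarith
  obtain ⟨θ, hθ0, hθP, hθ1⟩ : ∃ θ : ℝ, 0 < θ ∧ P * (2 * θ * ρ2) ≤ (1 - b) / 4 ∧ θ ≤ 1 / 8 := by
    refine ⟨(1 - b) / (8 * P * ρ2), by positivity, le_of_eq ?_, ?_⟩
    · field_simp; norm_num
    · rw [div_le_iff₀ (by positivity)]
      have : 1 ≤ P * ρ2 := one_le_mul_of_one_le_of_one_le hP1 hρ21
      nlinarith
  have hLθ : 0 < L / θ := by positivity
  obtain ⟨ρ, hρ⟩ : ∃ ρ : ℝ, ρ = ρ2 + L / θ + r + 2 * L := ⟨_, rfl⟩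
  have hρ0 : 0 < ρ := by linarith
  obtain ⟨κ₀, hκ₀, hk⟩ : ∃ κ₀ : ℝ, 0 < κ₀ ∧ κ₀ * (8 * P * ρ * ρ) ≤ 1 - b ∧ κ₀ * (16 * ρ) ≤ 1 ∧
      κ₀ * (4 * ρ * (L + r)) ≤ r ∧ κ₀ * (4 * (2 * K * ρ * ρ + P * ρ)) ≤ c ∧ κ₀ * 1 ≤ 1 := by
    have key : ∀ a d : ℝ, 0 < a → 0 < d → ∀ k, k ≤ d / a → k * a ≤ d := fun a d ha hd k hk =>
      (le_div_iff₀ ha).1 hk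
    refine ⟨min ((1 - b) / (8 * P * ρ * ρ)) (min (1 / (16 * ρ)) (min (r / (4 * ρ * (L + r)))
      (min (c / (4 * (2 * K * ρ * ρ + P * ρ))) (1 / 1)))), by positivity, ?_, ?_, ?_, ?_, ?_⟩
    · exact key _ _ (by positivity) h1b _ (min_le_left _ _)
    · exact key _ _ (by positivity) one_pos _ ((min_le_right _ _).trans (min_le_left _ _))
    · exact key _ _ (by positivity) hr0 _
        ((min_le_right _ _).trans ((min_le_right _ _).trans (min_le_left _ _)))
    · exact key _ _ (by positivity) hc0 _ ((min_le_right _ _).trans ((min_le_right _ _).trans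
        ((min_le_right _ _).trans (min_le_left _ _))))
    · exact key _ _ one_pos one_pos _ ((min_le_right _ _).trans ((min_le_right _ _).trans
        ((min_le_right _ _).trans (min_le_right _ _))))
  refine ⟨ρ + 4 * ρs + 2, by positivity, κ₀, hκ₀, ?_⟩
  intro f f' κ R u g S hf h hκ hκκ hR hu y hy hyL
  have mono : ∀ a d : ℝ, 0 ≤ a → κ₀ * a ≤ d → κ * a ≤ d := fun a d ha hd =>
    (mul_le_mul_of_nonneg_right hκκ ha).trans hd
  obtain ⟨k1, k2, k3, k4, k5⟩ := hk
  replace k1 := mono _ _ (by positivity) k1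
  replace k2 := mono _ _ (by positivity) k2
  replace k3 := mono _ _ (by positivity) k3
  replace k4 := mono _ _ (by positivity) k4
  replace k5 := mono _ _ (by positivity) k5
  have hPb : ∀ z ∈ ball (0 : Euc n) (R - 1), ‖g z‖ ≤ P := fun z hz =>
    (h.norm_grad_le hf (mem_ball_zero_iff.1 hz)).trans hPdef
  by_cases hg : ‖g 0‖ ≤ c
  · refine h.exists_isPreconnected_of_norm_grad_le hf hκ (by linarith) hb1 hL hu hg hc (by linarith)
      ?_ hy hyL
    have : κ * L ≤ κ * ρ := mul_le_mul_of_nonneg_left (by linarith) hκ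
    linarith
  push Not at hg
  have hgne : g 0 ≠ 0 := fun h0 => by rw [h0, norm_zero] at hg; linarith
  obtain ⟨e, he⟩ : ∃ e, ‖g 0‖⁻¹ • g 0 = e := ⟨_, rfl⟩
  have hen : ‖e‖ = 1 := by rw [← he]; exact norm_normal hgne
  have hee : ⟪e, e⟫ = 1 := by rw [real_inner_self_eq_norm_sq, hen]; norm_num
  have hsm : P * (r + (2 * κ * ρ) * ρ) < 1 - b := by nlinarith
  rcases h.exists_isPreconnected_or_reversed_zero hκ hP0.le (by linarith) hPb hL hr0
    (by linarith : L + r ≤ ρ) (by linarith) hsm (by linarith) (by linarith) hu he hen hy hyL with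
    hC | ⟨z, hz0, hzL, hze⟩
  · exact hC
  exfalso
  have hνz := h.norm_normal_add_le hκ hP0.le (by linarith) hPb hL hb1 hθ0 (ρ := ρ) (by linarith)
    (by linarith) (by nlinarith) (by linarith) hu he hen hz0 hzL hze
  have hzR : z ∈ ball (0 : Euc n) (R - 1) := by rw [mem_ball_zero_iff]; linarith
  refine hslab R _ _ _ (h.stableField hf e) (closedBall_subset_ball (by linarith)) (fun x hx => ?_)
    e ⟪z, e⟫ hen ?_ (fun x hx hxe => ?_) (fun x hx hxe => ?_)
  · have hx' := hPb x (closedBall_subset_ball (by linarith) hx)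
    refine (abs_real_inner_le_norm _ _).trans ?_
    rw [hen, mul_one]; exact hx'
  · refine (abs_real_inner_le_norm _ _).trans ?_
    rw [hen, mul_one]; exact hzL
  · have hx' : x ∈ ball (0 : Euc n) (R - 1) := by rw [mem_ball_zero_iff]; linarith
    have h0R : (0 : Euc n) ∈ ball (0 : Euc n) (R - 1) := by
      rw [mem_ball_zero_iff, norm_zero]; linarith
    have := h.le_inner_grad hf hκ hP0.le (by linarith) hPb h0R hx' hu (r := r) (ρ := ρ) (c := c / 2)
      he hen (by rw [real_inner_comm]; exact hxe) (by linarith) hsm (by nlinarith)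
    linarith
  · have hx' : x ∈ ball (0 : Euc n) (R - 1) := by rw [mem_ball_zero_iff]; linarith
    have hκ2 : κ * ρ2 ≤ κ * ρ := mul_le_mul_of_nonneg_left (by linarith) hκ
    have hκ3 : κ * ρ2 * ρ2 ≤ κ * ρ * ρ := mul_le_mul hκ2 (by linarith) (by linarith) (by positivity)
    have hκ4 : P * (κ * ρ2 * ρ2) ≤ P * (κ * ρ * ρ) := mul_le_mul_of_nonneg_left hκ3 hP0.le
    have ht := h.tube hκ hP0.le (by linarith) hPb hzR (q := x - z) (by rwa [add_sub_cancel]) hz0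
      (e := -e) (θ := 2 * θ) (r := r) (ρ := ρ2) (by rwa [sub_neg_eq_add])
      (by rw [inner_neg_left, abs_neg, real_inner_comm, inner_sub_left]; exact hxe)
      ((norm_sub_le _ _).trans (by linarith)) (by nlinarith) 1 (by simp)
    rw [one_smul, add_sub_cancel, sub_neg_eq_add] at ht
    rw [inner_eq_norm_mul_inner_normal]
    refine mul_nonpos_of_nonneg_of_nonpos (norm_nonneg _) ?_
    have h1 := abs_real_inner_le_norm (‖g x‖⁻¹ • g x + e) e
    rw [hen, mul_one, inner_add_left, hee] at h1
    linarith [(abs_le.1 h1).2, ht.2]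

end LayerSol

/-- The derivative of a double-well potential is a nonlinearity. -/
theorem IsDoubleWell.exists_nonlinearity {W : ℝ → ℝ} (hW : IsDoubleWell W) :
    ∃ K, Nonlinearity (_root_.deriv W) (iteratedDeriv 2 W) K := by
  obtain ⟨hC, -, -, -, -, -, -, -, h0, -⟩ := hW
  have hat : ∀ t ∈ Ioo (-1:ℝ) 1, ContDiffAt ℝ 3 W t := fun t ht =>
    (hC t (Ioo_subset_Icc_self ht)).contDiffAt (Icc_mem_nhds ht.1 ht.2)
  have hu : UniqueDiffOn ℝ (Icc (-1:ℝ) 1) := uniqueDiffOn_Icc (by norm_num)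
  have hc := hC.continuousOn_iteratedDerivWithin (m := 2) (by norm_num) hu
  have heq : ∀ t ∈ Ioo (-1:ℝ) 1, iteratedDerivWithin 2 W (Icc (-1) 1) t = iteratedDeriv 2 W t :=
    fun t ht => iteratedDerivWithin_eq_iteratedDeriv hu ((hat t ht).of_le (by norm_num))
      (Ioo_subset_Icc_self ht)
  obtain ⟨K, hK⟩ := isCompact_Icc.exists_bound_of_continuousOn hc
  have hder : ∀ t ∈ Ioo (-1:ℝ) 1, HasDerivAt (_root_.deriv W) (iteratedDeriv 2 W t) t := by
    intro t ht
    have h1 : ContDiffOn ℝ 2 (_root_.deriv W) (Ioo (-1:ℝ) 1) :=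
      (hC.mono Ioo_subset_Icc_self).deriv_of_isOpen isOpen_Ioo (by norm_num)
    have h2 := ((h1.differentiableOn (by norm_num)) t ht).differentiableAt
      (isOpen_Ioo.mem_nhds ht)
    have h3 : iteratedDeriv 2 W = _root_.deriv (_root_.deriv W) := by
      rw [iteratedDeriv_succ, iteratedDeriv_one]
    rw [h3]
    exact h2.hasDerivAt
  have hbd : ∀ t ∈ Ioo (-1:ℝ) 1, |iteratedDeriv 2 W t| ≤ K := fun t ht => by
    rw [← heq t ht]; exact hK t (Ioo_subset_Icc_self ht)
  refine ⟨K, hder, (hc.mono Ioo_subset_Icc_self).congr fun t ht => (heq t ht).symm, hbd,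
    fun t ht => ?_⟩
  have := (convex_Ioo (-1:ℝ) 1).norm_image_sub_le_of_norm_hasDerivWithin_le
    (fun s hs => (hder s hs).hasDerivWithinAt) hbd (by norm_num : (0:ℝ) ∈ Ioo (-1:ℝ) 1) ht
  simpa [h0] using this

theorem sum_inner_sq {n : ℕ} (x : Euc n) : ∑ i, ⟪x, eb n i⟫ ^ 2 = ‖x‖ ^ 2 := by
  rw [← real_inner_self_eq_norm_sq, ← sum_inner_mul_inner x x]
  simp only [sq]

theorem sum_inner_smul_eb {n : ℕ} (x : Euc n) : ∑ i, ⟪x, eb n i⟫ • eb n i = x := by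
  have := (EuclideanSpace.basisFun (Fin n) ℝ).sum_repr' x
  simpa only [real_inner_comm, eb] using this

theorem norm_apply_sq_le {n : ℕ} (T : Euc n →L[ℝ] Euc n) (x : Euc n) :
    ‖T x‖ ^ 2 ≤ (∑ i, ‖T (eb n i)‖ ^ 2) * ‖x‖ ^ 2 := by
  have h1 : ‖T x‖ ≤ ∑ i, ‖T (eb n i)‖ * |⟪x, eb n i⟫| := by
    conv_lhs => rw [← sum_inner_smul_eb x, map_sum]
    refine (norm_sum_le _ _).trans (Finset.sum_le_sum fun i _ => ?_)
    rw [map_smul, norm_smul, Real.norm_eq_abs, mul_comm]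
  have h2 := Finset.sum_mul_sq_le_sq_mul_sq Finset.univ (fun i => ‖T (eb n i)‖)
    (fun i => |⟪x, eb n i⟫|)
  simp only [sq_abs, sum_inner_sq] at h2
  exact (pow_le_pow_left₀ (norm_nonneg _) h1 2).trans h2

/-- If the part of a symmetric operator `T` orthogonal to `T ν` is small, then `T` is close to
`tr T` times the projection onto `ν`. -/
theorem norm_sub_trace_smul_le {n : ℕ} (T : Euc n →L[ℝ] Euc n) (hT : ∀ X Y, ⟪T X, Y⟫ = ⟪X, T Y⟫)
    {ν : Euc n} (hν : ‖ν‖ = 1) {M : ℝ} (hM : 0 ≤ M)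
    (h : ∑ i, ‖T (eb n i)‖ ^ 2 - ‖T ν‖ ^ 2 ≤ M ^ 2) (X : Euc n) :
    ‖T X - ((∑ i, ⟪T (eb n i), eb n i⟫) * ⟪ν, X⟫) • ν‖ ≤ (n + 2) * M * ‖X‖ := by
  have hνν : ⟪ν, ν⟫ = 1 := by rw [real_inner_self_eq_norm_sq, hν]; norm_num
  let E : Euc n →L[ℝ] Euc n := T - (innerSL ℝ ν).smulRight (T ν)
  have hE : ∀ Y, E Y = T Y - ⟪ν, Y⟫ • T ν := fun Y => rfl
  have hEsum : ∑ i, ‖E (eb n i)‖ ^ 2 ≤ M ^ 2 := by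
    have h1 : ∀ i, ‖E (eb n i)‖ ^ 2 = ‖T (eb n i)‖ ^ 2
        - 2 * (⟪T (T ν), eb n i⟫ * ⟪ν, eb n i⟫) + ⟪ν, eb n i⟫ ^ 2 * ‖T ν‖ ^ 2 := by
      intro i
      rw [hE, norm_sub_sq_real, inner_smul_right (T (eb n i)) (T ν) ⟪ν, eb n i⟫, norm_smul, mul_pow,
        Real.norm_eq_abs, sq_abs, hT (T ν) (eb n i), real_inner_comm (T (eb n i))]
      ring
    simp only [h1]
    rw [Finset.sum_add_distrib, Finset.sum_sub_distrib, ← Finset.mul_sum, ← Finset.sum_mul,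
      sum_inner_mul_inner, sum_inner_sq, hν, hT (T ν) ν, real_inner_self_eq_norm_sq]
    linarith
  have hEle : ∀ Y, ‖E Y‖ ≤ M * ‖Y‖ := by
    intro Y
    refine abs_le_of_sq_le_sq' ?_ (by positivity) |>.2
    rw [mul_pow]
    exact (norm_apply_sq_le E Y).trans (mul_le_mul_of_nonneg_right hEsum (sq_nonneg _))
  set w : Euc n := T ν - ⟪T ν, ν⟫ • ν with hw
  have hwM : ‖w‖ ≤ M := by
    have h1 : ‖w‖ ^ 2 = ⟪E w, ν⟫ := by
      rw [hE, inner_sub_left, inner_smul_left, hT w ν, ← real_inner_self_eq_norm_sq,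
        real_inner_comm w ν]
      conv_lhs => rw [hw]
      rw [← hw, inner_sub_right, inner_smul_right w ν]
      simp
      ring
    have h2 : ‖w‖ ^ 2 ≤ M * ‖w‖ := by
      rw [h1]
      refine (real_inner_le_norm _ _).trans ?_
      rw [hν, mul_one]; exact hEle w
    by_contra! h3
    nlinarith [norm_nonneg w]
  have htr : |⟪T ν, ν⟫ - ∑ i, ⟪T (eb n i), eb n i⟫| ≤ n * M := by
    have h1 : ∑ i, ⟪E (eb n i), eb n i⟫ = ∑ i, ⟪T (eb n i), eb n i⟫ - ⟪T ν, ν⟫ := by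
      rw [← sum_inner_mul_inner (T ν) ν, ← Finset.sum_sub_distrib]
      refine Finset.sum_congr rfl fun i _ => ?_
      rw [hE, inner_sub_left, inner_smul_left]
      simp [mul_comm]
    rw [abs_sub_comm, ← h1]
    refine (Finset.abs_sum_le_sum_abs _ _).trans ?_
    refine (Finset.sum_le_sum fun i _ => (?_ : _ ≤ M)).trans (by simp)
    refine (abs_real_inner_le_norm _ _).trans ?_
    have := hEle (eb n i)
    rw [norm_eb, mul_one] at this ⊢
    exact this
  have hdec : T X - ((∑ i, ⟪T (eb n i), eb n i⟫) * ⟪ν, X⟫) • ν = E X + ⟪ν, X⟫ •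
      (w + (⟪T ν, ν⟫ - ∑ i, ⟪T (eb n i), eb n i⟫) • ν) := by
    rw [hE, hw]; module
  rw [hdec]
  have h1 : |⟪ν, X⟫| ≤ ‖X‖ := by
    have := abs_real_inner_le_norm ν X
    rwa [hν, one_mul] at this
  have h2 : ‖w + (⟪T ν, ν⟫ - ∑ i, ⟪T (eb n i), eb n i⟫) • ν‖ ≤ M + n * M := by
    refine (norm_add_le _ _).trans (add_le_add hwM ?_)
    rwa [norm_smul, hν, mul_one, Real.norm_eq_abs]
  refine (norm_add_le _ _).trans ?_
  rw [norm_smul, Real.norm_eq_abs]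
  have h3 := mul_le_mul h1 h2 (norm_nonneg _) (norm_nonneg _)
  linarith [hEle X]

section Hessian

variable {n : ℕ} {u : Euc n → ℝ} {z : Euc n}

theorem fderiv_gradient_apply (h : ContDiffAt ℝ 2 u z) :
    DifferentiableAt ℝ (gradient u) z ∧ ∀ X Y, ⟪fderiv ℝ (gradient u) z X, Y⟫ =
      fderiv ℝ (fderiv ℝ u) z X Y := by
  have h1 : DifferentiableAt ℝ (fderiv ℝ u) z :=
    (h.fderiv_right (m := 1) (by norm_num)).differentiableAt (by norm_num)
  have h2 : HasFDerivAt (gradient u) _ z :=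
    ((InnerProductSpace.toDual ℝ (Euc n)).symm.toContinuousLinearEquiv.toContinuousLinearMap
      ).hasFDerivAt.comp z h1.hasFDerivAt
  refine ⟨h2.differentiableAt, fun X Y => ?_⟩
  rw [h2.fderiv]
  exact InnerProductSpace.toDual_symm_apply

theorem iteratedFDeriv_two_eq_inner (h : ContDiffAt ℝ 2 u z) (X Y : Euc n) :
    iteratedFDeriv ℝ 2 u z ![X, Y] = ⟪fderiv ℝ (gradient u) z X, Y⟫ := by
  rw [iteratedFDeriv_two_apply, (fderiv_gradient_apply h).2]
  rfl

theorem inner_fderiv_gradient_comm (h : ContDiffAt ℝ 2 u z) (X Y : Euc n) :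
    ⟪fderiv ℝ (gradient u) z X, Y⟫ = ⟪X, fderiv ℝ (gradient u) z Y⟫ := by
  rw [(fderiv_gradient_apply h).2, real_inner_comm, (fderiv_gradient_apply h).2]
  exact h.isSymmSndFDerivAt (by simp) X Y

theorem gradient_norm_gradient (h : ContDiffAt ℝ 2 u z) (h0 : gradient u z ≠ 0) :
    gradient (fun y => ‖gradient u y‖) z =
      fderiv ℝ (gradient u) z (‖gradient u z‖⁻¹ • gradient u z) := by
  have h1 := (fderiv_gradient_apply h).1.hasFDerivAt
  have hn : 0 < ‖gradient u z‖ := norm_pos_iff.2 h0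
  have h2 := (h1.norm_sq.sqrt (by positivity))
  simp only [Real.sqrt_sq (norm_nonneg _)] at h2
  refine HasGradientAt.gradient ?_
  rw [hasGradientAt_iff_hasFDerivAt]
  refine h2.congr_fderiv ?_
  ext X
  rw [InnerProductSpace.toDual_apply_apply, inner_fderiv_gradient_comm h, inner_smul_left]
  simp
  field_simp

/-- A bound on `|B(u)|` controls the distance of the Hessian to that of a one-variable
function. -/
theorem norm_hess_sub_le_of_Bnorm_le (h : ContDiffAt ℝ 2 u z) (h0 : gradient u z ≠ 0) {Λ : ℝ}
    (hB : Bnorm u z ≤ Λ) (X : Euc n) :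
    ‖fderiv ℝ (gradient u) z X - (lap u z * ⟪gradient u z, X⟫ / ‖gradient u z‖ ^ 2) •
      gradient u z‖ ≤ (n + 2) * Λ * ‖gradient u z‖ * ‖X‖ := by
  have hn : 0 < ‖gradient u z‖ := norm_pos_iff.2 h0
  rw [Bnorm, if_neg h0, Real.sqrt_le_iff] at hB
  have h1 := norm_sub_trace_smul_le (fderiv ℝ (gradient u) z) (inner_fderiv_gradient_comm h)
    (norm_normal h0) (M := Λ * ‖gradient u z‖) (mul_nonneg hB.1 hn.le) (by
      rw [← gradient_norm_gradient h h0]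
      have h2 := (div_le_iff₀ (by positivity)).1 hB.2
      rw [hessSq] at h2
      simp only [iteratedFDeriv_two_eq_inner h, sum_inner_sq] at h2
      rw [mul_pow]; exact h2) X
  have h3 : lap u z = ∑ i, ⟪fderiv ℝ (gradient u) z (eb n i), eb n i⟫ := by
    simp only [lap, iteratedFDeriv_two_eq_inner h]
  rw [h3]
  rw [inner_smul_left, smul_smul] at h1
  have h4 : (∑ i, ⟪fderiv ℝ (gradient u) z (eb n i), eb n i⟫) * ⟪gradient u z, X⟫ /
      ‖gradient u z‖ ^ 2 = (∑ i, ⟪fderiv ℝ (gradient u) z (eb n i), eb n i⟫) *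
        ((starRingEnd ℝ) ‖gradient u z‖⁻¹ * ⟪gradient u z, X⟫) * ‖gradient u z‖⁻¹ := by
    simp only [conj_trivial]
    field_simp
  rw [h4]
  exact h1.trans_eq (by ring)

end Hessian

section Rescaling

variable {n : ℕ} {W : ℝ → ℝ} {ε : ℝ} {u : Euc n → ℝ} {x : Euc n} {R : ℝ}

theorem add_smul_mem_ball (hε : 0 < ε) (hx : x ∈ ball (0 : Euc n) (7 / 8)) (hR : ε * R ≤ 1 / 8)
    {z : Euc n} (hz : z ∈ ball (0 : Euc n) R) : x + ε • z ∈ ball (0 : Euc n) 1 := by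
  rw [mem_ball_zero_iff] at hx hz ⊢
  have h1 : ‖ε • z‖ < 1 / 8 := by
    rw [norm_smul, Real.norm_of_nonneg hε.le]
    exact (mul_lt_mul_of_pos_left hz hε).trans_le hR
  linarith [norm_add_le x (ε • z)]

theorem StableAC.rescale (hs : StableAC W ε u (ball 0 1)) (hε : 0 < ε)
    (hx : x ∈ ball (0 : Euc n) (7 / 8)) (hR : ε * R ≤ 1 / 8) {η : Euc n → ℝ}
    (hη : ContDiff ℝ (⊤ : ℕ∞) η) (hηc : HasCompactSupport η) (hηs : tsupport η ⊆ ball 0 R) :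
    0 ≤ ∫ z, (‖gradient η z‖ ^ 2 + iteratedDeriv 2 W (u (x + ε • z)) * (η z) ^ 2) := by
  let A : Euc n → Euc n := fun y => ε⁻¹ • (y - x)
  let ζ : Euc n → ℝ := fun y => η (A y)
  have hAd : ∀ y, HasFDerivAt A (ε⁻¹ • ContinuousLinearMap.id ℝ (Euc n)) y := fun y =>
    ((hasFDerivAt_id y).sub_const x).const_smul ε⁻¹
  have hAinv : ∀ y, x + ε • A y = y := fun y => by
    simp only [A]
    rw [smul_smul, mul_inv_cancel₀ hε.ne', one_smul, add_sub_cancel]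
  have hAc : Continuous A := by fun_prop
  have hBc : Continuous fun z : Euc n => x + ε • z := by fun_prop
  have hsub : tsupport ζ ⊆ (fun z => x + ε • z) '' tsupport η := by
    refine closure_minimal (fun y hy => ⟨A y, subset_tsupport _ hy, hAinv y⟩) ?_
    exact (hηc.isCompact.image hBc).isClosed
  have hζ : ContDiff ℝ (⊤ : ℕ∞) ζ := hη.comp (by fun_prop)
  have hζc : HasCompactSupport ζ :=
    (hηc.isCompact.image hBc).of_isClosed_subset (isClosed_tsupport ζ) hsub
  have hζs : tsupport ζ ⊆ ball 0 1 := by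
    intro y hy
    obtain ⟨z, hz, rfl⟩ := hsub hy
    exact add_smul_mem_ball hε hx hR (hηs hz)
  have h0 := hs ζ hζ hζc hζs
  have hgrad : ∀ y, ε ^ 2 * ‖gradient ζ y‖ ^ 2 = ‖gradient η (A y)‖ ^ 2 := by
    intro y
    have h1 : HasFDerivAt ζ _ y :=
      ((hη.differentiable (by simp)) (A y)).hasFDerivAt.comp y (hAd y)
    rw [norm_gradient, norm_gradient, h1.fderiv]
    have h2 : (fderiv ℝ η (A y)).comp (ε⁻¹ • ContinuousLinearMap.id ℝ (Euc n)) =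
        ε⁻¹ • fderiv ℝ η (A y) := by ext; simp
    rw [h2, norm_smul, norm_inv, Real.norm_of_nonneg hε.le]
    field_simp
  rw [setIntegral_eq_integral_of_forall_compl_eq_zero] at h0
  · let F : Euc n → ℝ := fun z =>
      ‖gradient η z‖ ^ 2 + iteratedDeriv 2 W (u (x + ε • z)) * (η z) ^ 2
    have h1 : ∀ y, ε ^ 2 * ‖gradient ζ y‖ ^ 2 + iteratedDeriv 2 W (u y) * (ζ y) ^ 2 =
        F (ε⁻¹ • (y - x)) := by
      intro y
      change _ = ‖gradient η (A y)‖ ^ 2 + iteratedDeriv 2 W (u (x + ε • A y)) * (η (A y)) ^ 2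
      rw [hgrad, hAinv]
    simp only [h1] at h0
    rw [integral_sub_right_eq_self (fun y => F (ε⁻¹ • y)) x, Measure.integral_comp_smul,
      smul_eq_mul] at h0
    have h2 : 0 < |((ε⁻¹) ^ Module.finrank ℝ (Euc n))⁻¹| := by positivity
    exact nonneg_of_mul_nonneg_right h0 h2
  · intro y hy
    have hy' : y ∉ tsupport ζ := fun h => hy (hζs h)
    rw [gradient_eq_zero_of_notMem_tsupport hy', image_eq_zero_of_notMem_tsupport hy']
    simp

theorem LayerSol.of_acSolution {b Λ : ℝ} (h : ACSolution W ε u (ball 0 1))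
    (hs : StableAC W ε u (ball 0 1)) (hc : CurvBound u b Λ (ball 0 1)) (hε : 0 < ε)
    (hx : x ∈ ball (0 : Euc n) (7 / 8)) (hR : ε * R ≤ 1 / 8) :
    LayerSol (_root_.deriv W) (iteratedDeriv 2 W) b ((n + 2) * Λ * ε) R (fun z => u (x + ε • z))
      (fun z => ε • gradient u (x + ε • z))
      (fun z => ε ^ 2 • fderiv ℝ (gradient u) (x + ε • z)) := by
  obtain ⟨hC, hran, hpde⟩ := h
  have hmem : ∀ z ∈ ball (0 : Euc n) R, x + ε • z ∈ ball (0 : Euc n) 1 := fun z hz =>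
    add_smul_mem_ball hε hx hR hz
  have hat : ∀ z ∈ ball (0 : Euc n) 1, ContDiffAt ℝ 2 u z := fun z hz =>
    hC.contDiffAt (isOpen_ball.mem_nhds hz)
  have hAd : ∀ z : Euc n, HasFDerivAt (fun z => x + ε • z) (ε • ContinuousLinearMap.id ℝ (Euc n)) z :=
    fun z => ((hasFDerivAt_id z).const_smul ε).const_add x
  have htr : ∀ y ∈ ball (0 : Euc n) 1, _root_.deriv W (u y) = ε ^ 2 * lap u y := by
    intro y hy
    have := hpde y hy
    field_simp at this
    linarith
  refine ⟨fun z hz => ?_, fun z hz => ?_, ?_, fun z hz => hran _ (hmem z hz), fun z hz X Y => ?_,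
    fun z hz => ?_, fun z hz hb => ?_, fun z hz hb X => ?_,
    fun η h1 h2 h3 => hs.rescale hε hx hR h1 h2 h3⟩
  · have h1 := ((hat _ (hmem z hz)).differentiableAt (by norm_num)).hasGradientAt
    rw [hasGradientAt_iff_hasFDerivAt] at h1 ⊢
    refine (h1.comp z (hAd z)).congr_fderiv ?_
    ext X
    simp
  · have h1 := (fderiv_gradient_apply (hat _ (hmem z hz))).1.hasFDerivAt
    refine ((h1.comp z (hAd z)).const_smul ε).congr_fderiv ?_
    ext X : 1
    simp [smul_smul, sq]
  · have h1 : ContDiffOn ℝ 1 (gradient u) (ball 0 1) := by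
      have h2 : ContDiffOn ℝ 1 (fderiv ℝ u) (ball 0 1) :=
        hC.fderiv_of_isOpen isOpen_ball (by norm_num)
      exact (InnerProductSpace.toDual ℝ (Euc n)).symm.toContinuousLinearEquiv.contDiff.comp_contDiffOn h2
    have h3 : ContinuousOn (fderiv ℝ (gradient u)) (ball 0 1) :=
      h1.continuousOn_fderiv_of_isOpen isOpen_ball le_rfl
    have h4 : ContinuousOn (fun z => fderiv ℝ (gradient u) (x + ε • z)) (ball 0 R) :=
      h3.comp (by fun_prop) hmem
    exact h4.const_smul (ε ^ 2)
  · have := inner_fderiv_gradient_comm (hat _ (hmem z hz)) X Y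
    simp only [smul_apply]
    rw [inner_smul_left, inner_smul_right, this]
    rfl
  · rw [htr _ (hmem z hz), lap, Finset.mul_sum]
    refine Finset.sum_congr rfl fun i _ => ?_
    rw [iteratedFDeriv_two_eq_inner (hat _ (hmem z hz))]
    simp only [smul_apply]
    rw [inner_smul_left]
    rfl
  · exact smul_ne_zero hε.ne' (hc _ (hmem z hz) hb).1
  · obtain ⟨h0, hB⟩ := hc _ (hmem z hz) hb
    have h1 := norm_hess_sub_le_of_Bnorm_le (hat _ (hmem z hz)) h0 hB X
    have hn : 0 < ‖gradient u (x + ε • z)‖ := norm_pos_iff.2 h0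
    have h2 : (ε ^ 2 • fderiv ℝ (gradient u) (x + ε • z)) X - (_root_.deriv W (u (x + ε • z)) *
        ⟪ε • gradient u (x + ε • z), X⟫ / ‖ε • gradient u (x + ε • z)‖ ^ 2) •
          ε • gradient u (x + ε • z) = ε ^ 2 • (fderiv ℝ (gradient u) (x + ε • z) X -
        (lap u (x + ε • z) * ⟪gradient u (x + ε • z), X⟫ / ‖gradient u (x + ε • z)‖ ^ 2) •
          gradient u (x + ε • z)) := by
      rw [htr _ (hmem z hz), norm_smul, Real.norm_of_nonneg hε.le, inner_smul_left, smul_sub,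
        smul_smul, smul_smul, smul_apply]
      congr 2
      simp only [conj_trivial]
      field_simp
    rw [h2, norm_smul, norm_smul, Real.norm_of_nonneg hε.le, Real.norm_of_nonneg (by positivity)]
    calc _ ≤ ε ^ 2 * _ := mul_le_mul_of_nonneg_left h1 (by positivity)
      _ = _ := by ring

end Rescaling

/-- Lemma 2.1 (consequence): different connected components of the zero set are at
distance `≫ ε` from each other, uniformly. -/
theorem stmt4 (n : ℕ) (W : ℝ → ℝ) (hW : IsDoubleWell W) (b Λ : ℝ)
    (hb : b ∈ Ioo (0:ℝ) 1) (hΛ : 0 < Λ) :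
    ∀ L > 0, ∃ ε₀ > 0, ∀ ε : ℝ, 0 < ε → ε ≤ ε₀ → ∀ u : Euc n → ℝ,
      ACSolution W ε u (ball 0 1) → StableAC W ε u (ball 0 1) →
      CurvBound u b Λ (ball 0 1) →
      ∀ x : Euc n, u x = 0 → x ∈ ball (0:Euc n) (7/8) →
        ∀ y ∈ compSet u x, L * ε ≤ dist x y := by
  intro L hL
  obtain ⟨K, hf⟩ := hW.exists_nonlinearity
  obtain ⟨R₀, hR₀, κ₀, hκ₀, hmain⟩ := LayerSol.exists_isPreconnected_zeros n hb hf.nonneg hL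
  have hn : (0:ℝ) < (n + 2) * Λ := by positivity
  refine ⟨min (1 / (8 * R₀)) (κ₀ / ((n + 2) * Λ)), by positivity, ?_⟩
  intro ε hε hεle u hu hs hc x hx0 hx y hy
  by_contra! hlt
  have h1 : ε * R₀ ≤ 1 / 8 := by
    have := mul_le_mul_of_nonneg_right (hεle.trans (min_le_left _ _)) hR₀.le
    refine this.trans_eq ?_
    field_simp
  have h2 : (n + 2) * Λ * ε ≤ κ₀ := by
    have := (le_div_iff₀ hn).1 (hεle.trans (min_le_right _ _))
    linarith
  have hy' : x + ε • (ε⁻¹ • (y - x)) = y := by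
    rw [smul_smul, mul_inv_cancel₀ hε.ne', one_smul, add_sub_cancel]
  obtain ⟨C, hC, hCs, h0C, hyC⟩ := hmain _ _ _ R₀ _ _ _ hf (LayerSol.of_acSolution hu hs hc hε hx h1)
    (by positivity) h2 le_rfl (by simpa using hx0) (ε⁻¹ • (y - x))
    (by rw [hy']; exact hy.1) (by
      rw [norm_smul, norm_inv, Real.norm_of_nonneg hε.le, ← dist_eq_norm, dist_comm,
        inv_mul_le_iff₀ hε, mul_comm]
      exact hlt.le)
  refine hy.2 ((hC.image (fun z => x + ε • z) (by fun_prop)).subset_connectedComponentIn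
    ⟨0, h0C, by simp⟩ ?_ ⟨_, hyC, hy'⟩)
  rintro _ ⟨z, hz, rfl⟩
  exact hCs hz
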